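/- arXiv:1003.3044 — 3 statements merged into one kernel-verified Lean document; each statement's English description precedes it below -/
import Mathlib

section
/- For every d ≥ 2 and every basepoint w₀ ∈ W_d, the fundamental group π₁(W_d, w₀) is isomorphic to the spherical braid group Br^s_d, i.e. to the presented group with generators σ_1,…,σ_{d−1} and relations σ_iσ_j = σ_jσ_i for |i−j| ≥ 2, σ_iσ_{i+1}σ_i = σ_{i+1}σ_iσ_{i+1} for 1 ≤ i ≤ d−2, and σ_1σ_2⋯σ_{d−2}σ_{d−1}^2σ_{d−2}⋯σ_2σ_1 = 1. -/
open Polynomial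

noncomputable section

/-- Defining relations of the Artin braid group on `m` strands: the generators are
indexed by `Fin (m - 1)`, with index `i` corresponding to `σ_{i+1}`; the relations are
`σ_i σ_j = σ_j σ_i` for `|i - j| ≥ 2` and `σ_i σ_{i+1} σ_i = σ_{i+1} σ_i σ_{i+1}`. -/
def braidRels (m : ℕ) : Set (FreeGroup (Fin (m - 1))) :=
  { r | (∃ i j : Fin (m - 1), (i : ℕ) + 2 ≤ (j : ℕ) ∧
          r = .of i * .of j * (.of i)⁻¹ * (.of j)⁻¹) ∨
        (∃ i j : Fin (m - 1), (j : ℕ) = (i : ℕ) + 1 ∧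
          r = .of i * .of j * .of i * (.of j * .of i * .of j)⁻¹) }

/-- The Artin braid group on `m` strands. -/
def BraidGroup (m : ℕ) : Type := PresentedGroup (braidRels m)

instance (m : ℕ) : Group (BraidGroup m) :=
  inferInstanceAs (Group (PresentedGroup (braidRels m)))

/-- The Artin generator `σ_i` of the braid group on `m` strands, for `1 ≤ i ≤ m - 1`
(junk value `1` for invalid indices). -/
def σg (m : ℕ) (i : ℕ) : BraidGroup m :=
  if h : 0 < i ∧ i < m then PresentedGroup.of ⟨i - 1, by omega⟩ else 1

/-- The band generator `σ_{i,j} = (σ_{j-1} σ_{j-2} ⋯ σ_{i+1}) σ_i (σ_{j-1} σ_{j-2} ⋯ σ_{i+1})⁻¹`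
of the braid group on `m` strands; in particular `σ_{i,i+1} = σ_i`. -/
def band (m i j : ℕ) : BraidGroup m :=
  (((List.range' (i + 1) (j - i - 1)).reverse.map (σg m)).prod) * σg m i *
    (((List.range' (i + 1) (j - i - 1)).reverse.map (σg m)).prod)⁻¹

/-- The generator `σ_i` as an element of the free group on `Fin (d - 1)`, for
`1 ≤ i ≤ d - 1` (junk value `1` for invalid indices). -/
def fgen (d : ℕ) (i : ℕ) : FreeGroup (Fin (d - 1)) :=
  if h : 0 < i ∧ i < d then FreeGroup.of ⟨i - 1, by omega⟩ else 1

/-- The spherical relation word `σ_1 σ_2 ⋯ σ_{d-2} σ_{d-1}² σ_{d-2} ⋯ σ_2 σ_1`. -/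
def sphWord (d : ℕ) : FreeGroup (Fin (d - 1)) :=
  ((List.range' 1 (d - 2)).map (fgen d)).prod * fgen d (d - 1) * fgen d (d - 1) *
    ((List.range' 1 (d - 2)).reverse.map (fgen d)).prod

/-- The spherical braid group on `d` strands: generators `σ_1, …, σ_{d-1}`, braid
relations, and the additional relation `σ_1 ⋯ σ_{d-2} σ_{d-1}² σ_{d-2} ⋯ σ_1 = 1`. -/
def SphBraidGroup (d : ℕ) : Type := PresentedGroup (braidRels d ∪ {sphWord d})

instance (d : ℕ) : Group (SphBraidGroup d) :=
  inferInstanceAs (Group (PresentedGroup (braidRels d ∪ {sphWord d})))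

/-- The binary form `∑_{i ≤ d} v_i X^i Y^{d-i}` associated to a coefficient vector
`v ∈ ℂ^{d+1}`. -/
def binForm (d : ℕ) (v : Fin (d + 1) → ℂ) : MvPolynomial (Fin 2) ℂ :=
  ∑ i : Fin (d + 1),
    MvPolynomial.C (v i) * MvPolynomial.X 0 ^ (i : ℕ) * MvPolynomial.X 1 ^ (d - (i : ℕ))

instance (d : ℕ) : TopologicalSpace (Projectivization ℂ (Fin (d + 1) → ℂ)) :=
  instTopologicalSpaceQuotient

/-- The space `W_d ⊆ ℙ(ℂ^{d+1})` of classes of coefficient vectors whose binary form of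
degree `d` is squarefree, i.e. of homogeneous degree-`d` polynomials on `ℙ¹` with simple
roots only, with the topology inherited from the quotient topology on `ℙ(ℂ^{d+1})`. -/
def WSph (d : ℕ) : Type :=
  { p : Projectivization ℂ (Fin (d + 1) → ℂ) // Squarefree (binForm d p.rep) }

instance (d : ℕ) : TopologicalSpace (WSph d) :=
  instTopologicalSpaceSubtype

namespace SphBraid
open Topology Filter Set unitInterval

section Paths
variable {X : Type*} [TopologicalSpace X]

/-- The homotopy class of paths. -/
local notation "Cls" => Path.Homotopic.Quotient

theorem path_induction {ι : Type*} {V : ι → Set X} (hV : ∀ i, IsOpen (V i))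
    (hc : ∀ x, ∃ i, x ∈ V i) {P : ∀ x y : X, Cls x y → Prop}
    (htrans : ∀ x y z (γ : Cls x y) (δ : Cls y z), P x y γ → P y z δ → P x z (γ.trans δ))
    (hsmall : ∀ i x y (γ : Path x y), (∀ t, γ t ∈ V i) → P x y (.mk γ)) :
    ∀ x y (γ : Cls x y), P x y γ := by
  intro x y γ
  induction γ using Path.Homotopic.Quotient.ind with
  | mk γ =>
  obtain ⟨t, ht0, hmono, ⟨N, hN⟩, ht⟩ := exists_monotone_Icc_subset_open_cover_unitInterval
    (c := fun i => γ ⁻¹' V i) (fun i => (hV i).preimage γ.continuous)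
    (by intro s _; obtain ⟨i, hi⟩ := hc (γ s); exact mem_iUnion.2 ⟨i, hi⟩)
  have key : ∀ n, P _ _ (.mk (γ.subpath 0 (t n))) := by
    intro n
    induction n with
    | zero =>
      rw [ht0]
      obtain ⟨i, hi⟩ := hc (γ 0)
      exact hsmall i _ _ _ (by intro s; simpa using hi)
    | succ n ih =>
      have := Path.Homotopic.Quotient.eq.2 ⟨Path.Homotopy.subpathTransSubpath γ 0 (t n) (t (n+1))⟩
      rw [← this, Path.Homotopic.Quotient.mk_trans]
      refine htrans _ _ _ _ _ ih ?_
      obtain ⟨i, hi⟩ := ht n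
      refine hsmall i _ _ _ fun s => ?_
      have h1 : (γ.subpath (t n) (t (n+1))) s ∈ range (γ.subpath (t n) (t (n+1))) := ⟨s, rfl⟩
      rw [Path.range_subpath_of_le _ _ _ (hmono n.le_succ)] at h1
      obtain ⟨u, hu, hu'⟩ := h1
      rw [← hu']
      exact hi hu
  have h := key N
  rw [hN N le_rfl] at h
  have e0 : γ 0 = x := γ.source
  have e1 : γ 1 = y := γ.target
  rw [Path.subpath_zero_one] at h
  clear key
  generalize hγ : γ.cast γ.source γ.target = γ' at h
  have : ∀ (a b : X) (ha : a = x) (hb : b = y) (h : P a b (.mk (γ.cast ha hb))), P x y (.mk γ) := by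
    rintro a b rfl rfl h; exact h
  exact this _ _ e0 e1 (by rw [← hγ] at h; exact h)

/-- Any two paths in `V` with common endpoints are homotopic in the ambient space. -/
def RelSC (V : Set X) : Prop :=
  ∀ x y (γ δ : Path x y), (∀ t, γ t ∈ V) → (∀ t, δ t ∈ V) →
    Path.Homotopic.Quotient.mk γ = Path.Homotopic.Quotient.mk δ

end Paths

section Holonomy
variable {X : Type*} [TopologicalSpace X] {ι G : Type*} [Group G]

theorem exists_holonomy_of_cocycle {V : ι → Set X} (hV : ∀ i, IsOpen (V i))
    (idx : X → ι) (hidx : ∀ x, x ∈ V (idx x)) (g : ι → ι → X → G)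
    (hg1 : ∀ i x, x ∈ V i → g i i x = 1)
    (hg : ∀ i j k x, x ∈ V i → x ∈ V j → x ∈ V k → g j k x * g i j x = g i k x)
    (hloc : ∀ i j x, x ∈ V i → x ∈ V j → ∀ᶠ y in 𝓝 x, g i j y = g i j x) :
    ∃ M : ∀ x y : X, Path.Homotopic.Quotient x y → G,
      (∀ x y z γ δ, M x z (γ.trans δ) = M y z δ * M x y γ) ∧
      ∀ i x y (γ : Path x y), (∀ t, γ t ∈ V i) →
        M x y (.mk γ) = (g (idx y) i y)⁻¹ * g (idx x) i x := by
  let _ : TopologicalSpace G := ⊥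
  have _ : DiscreteTopology G := ⟨rfl⟩
  let Z : FiberBundleCore ι X G :=
    { baseSet := V
      isOpen_baseSet := hV
      indexAt := idx
      mem_baseSet_at := hidx
      coordChange := fun i j x v => g i j x * v
      coordChange_self := by
        intro i x hx v
        simp [hg1 i x hx]
      continuousOn_coordChange := by
        intro i j
        rintro ⟨x, v⟩ ⟨⟨hi, hj⟩, -⟩
        apply ContinuousAt.continuousWithinAt
        have h1 : ∀ᶠ p : X × G in 𝓝 (x, v), g i j p.1 * p.2 = g i j x * p.2 := by
          rw [nhds_prod_eq]
          filter_upwards [(hloc i j x hi hj).prod_inl (𝓝 v)] with p hp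
          rw [hp]
        refine ContinuousAt.congr ?_ (h1.mono fun p hp => hp.symm)
        exact (continuous_of_discreteTopology (f := fun v : G => g i j x * v)).continuousAt.comp
          continuousAt_snd
      coordChange_comp := by
        intro i j k x hx v
        rw [← mul_assoc, hg i j k x hx.1.1 hx.1.2 hx.2] }
  have cov : IsCoveringMap Z.proj :=
    FiberBundle.isCoveringMap (F := G) (E := Z.Fiber)
  let pt : ∀ x : X, G → Z.proj ⁻¹' {x} := fun x a => ⟨⟨x, a⟩, rfl⟩
  let val : ∀ x : X, Z.proj ⁻¹' {x} → G := fun x e => e.1.2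
  have pt_val : ∀ x e, pt x (val x e) = e := by
    rintro x ⟨⟨x', a⟩, h⟩
    cases h
    rfl
  have small : ∀ i x y (γ : Path x y), (∀ t, γ t ∈ V i) → ∀ a,
      val y (cov.monodromy (.mk γ) (pt x a)) = (g (idx y) i y)⁻¹ * g (idx x) i x * a := by
    intro i x y γ hγ a
    have hx : x ∈ V i := by simpa using hγ 0
    have hy : y ∈ V i := by simpa using hγ 1
    let b : G := g (idx x) i x * a
    let L : I → Z.TotalSpace := fun t => (Z.localTriv i).toOpenPartialHomeomorph.symm (γ t, b)
    have hL : Continuous L := by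
      have := (Z.localTriv i).toOpenPartialHomeomorph.continuousOn_symm
      refine this.comp_continuous (by fun_prop) ?_
      intro t
      exact (Z.mem_localTriv_target i _).2 (hγ t)
    have hL0 : L 0 = ⟨x, a⟩ := by
      have h0 : γ 0 = x := γ.source
      change (⟨γ 0, g i (idx (γ 0)) (γ 0) * b⟩ : Z.TotalSpace) = _
      rw [h0]
      congr 1
      rw [← mul_assoc, hg _ _ _ x (hidx x) hx (hidx x), hg1 _ _ (hidx x), one_mul]
    have hL1 : L 1 = ⟨y, g i (idx y) y * b⟩ := by
      have h0 : γ 1 = y := γ.target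
      change (⟨γ 1, g i (idx (γ 1)) (γ 1) * b⟩ : Z.TotalSpace) = _
      rw [h0]
    have hm : cov.monodromy (.mk γ) (pt x a) = pt y (g i (idx y) y * b) := by
      let Γ : Path (X := Z.TotalSpace) (pt x a).1 (pt y (g i (idx y) y * b)).1 :=
        ⟨⟨L, hL⟩, hL0, hL1⟩
      refine cov.monodromy_eq_of_map_eq (Path.Homotopic.Quotient.mk Γ) ?_
      rw [← Path.Homotopic.Quotient.mk_map]
      rfl
    rw [hm]
    change g i (idx y) y * (g (idx x) i x * a) = _
    rw [mul_assoc]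
    congr 1
    rw [eq_inv_iff_mul_eq_one, hg _ _ _ y (hidx y) hy (hidx y), hg1 _ _ (hidx y)]
  have equi : ∀ x y (γ : Path.Homotopic.Quotient x y), ∀ a,
      val y (cov.monodromy γ (pt x a)) = val y (cov.monodromy γ (pt x 1)) * a := by
    refine path_induction hV (fun x => ⟨_, hidx x⟩) ?_ ?_
    · intro x y z γ δ h1 h2 a
      rw [cov.monodromy_trans_apply, cov.monodromy_trans_apply,
        ← pt_val y (cov.monodromy γ (pt x a)), ← pt_val y (cov.monodromy γ (pt x 1)),
        h2, h1 a, h2 (val y (cov.monodromy γ (pt x 1))), mul_assoc]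
    · intro i x y γ hγ a
      rw [small i x y γ hγ, small i x y γ hγ, mul_one]
  refine ⟨fun x y γ => val y (cov.monodromy γ (pt x 1)), ?_, ?_⟩
  · intro x y z γ δ
    simp only
    rw [cov.monodromy_trans_apply, ← pt_val y (cov.monodromy γ (pt x 1)), equi y z δ]
  · intro i x y γ hγ
    simp only
    rw [small i x y γ hγ, mul_one]

theorem exists_holonomy {V : ι → Set X} (hV : ∀ i, IsOpen (V i))
    (hc : ∀ x, ∃ i, x ∈ V i) {D : Set X} (hD : Dense D) (f : ι → X → G)
    (hf : ∀ i j p, p ∈ V i → p ∈ V j → ∃ h, ∀ᶠ x in 𝓝[D] p, f i x * (f j x)⁻¹ = h) :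
    ∃ M : ∀ x y : X, Path.Homotopic.Quotient x y → G,
      (∀ x y z γ δ, M x z (γ.trans δ) = M y z δ * M x y γ) ∧
      ∀ i x y (γ : Path x y), (∀ t, γ t ∈ V i) → x ∈ D → y ∈ D →
        M x y (.mk γ) = (f i y)⁻¹ * f i x := by
  classical
  choose idx hidx using hc
  have hne : ∀ p, (𝓝[D] p).NeBot := fun p => mem_closure_iff_nhdsWithin_neBot.1 (hD p)
  choose h hh using hf
  let g : ι → ι → X → G := fun i j p =>
    if hp : p ∈ V i ∧ p ∈ V j then h j i p hp.2 hp.1 else 1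
  have hg : ∀ i j p, p ∈ V i → p ∈ V j → ∀ᶠ x in 𝓝[D] p, f j x * (f i x)⁻¹ = g i j p := by
    intro i j p hi hj
    simp only [g, dif_pos (And.intro hi hj)]
    exact hh j i p hj hi
  have huniq : ∀ i j p k, p ∈ V i → p ∈ V j → (∀ᶠ x in 𝓝[D] p, f j x * (f i x)⁻¹ = k) →
      g i j p = k := by
    intro i j p k hi hj hk
    obtain ⟨x, hx1, hx2⟩ := (hk.and (hg i j p hi hj)).exists
    rw [← hx1, ← hx2]
  have hgD : ∀ i j p, p ∈ V i → p ∈ V j → p ∈ D → g i j p = f j p * (f i p)⁻¹ := by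
    intro i j p hi hj hp
    have := (hg i j p hi hj)
    have h2 := this.self_of_nhdsWithin hp
    exact h2.symm
  obtain ⟨M, hM1, hM2⟩ := exists_holonomy_of_cocycle hV idx hidx g
    (by
      intro i x hx
      exact huniq i i x 1 hx hx (Eventually.of_forall fun x => by simp))
    (by
      intro i j k x hi hj hk
      refine (huniq i k x _ hi hk ?_).symm
      filter_upwards [hg i j x hi hj, hg j k x hj hk] with y h1 h2
      rw [← h1, ← h2]
      group)
    (by
      intro i j x hi hj
      have h1 := eventually_eventually_nhdsWithin.2 (hg i j x hi hj)
      have h2 := hg i j x hi hj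
      rw [eventually_nhdsWithin_iff] at h2
      have h3 := eventually_eventually_nhds.2 h2
      filter_upwards [h3, (hV i).mem_nhds hi, (hV j).mem_nhds hj] with y hy hyi hyj
      exact huniq i j y _ hyi hyj (eventually_nhdsWithin_iff.2 hy))
  refine ⟨fun x y γ => (f (idx y) y)⁻¹ * M x y γ * f (idx x) x, ?_, ?_⟩
  · intro x y z γ δ
    simp only [hM1]
    group
  · intro i x y γ hγ hx hy
    have hxi : x ∈ V i := by simpa using hγ 0
    have hyi : y ∈ V i := by simpa using hγ 1
    simp only
    rw [hM2 i x y γ hγ, hgD _ _ _ (hidx y) hyi hy, hgD _ _ _ (hidx x) hxi hx]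
    group

end Holonomy
end SphBraid

namespace SphBraid
open Topology Filter Set unitInterval

section Charts
variable {X : Type*} [TopologicalSpace X]

local notation "Cls" => Path.Homotopic.Quotient
local infixr:70 "⬝" => Path.Homotopic.Quotient.trans

theorem homotopic_of_convex_lift {E : Type*} [AddCommGroup E] [Module ℝ E] [TopologicalSpace E]
    [ContinuousAdd E] [ContinuousSMul ℝ E] {C : Set E} (hC : Convex ℝ C) {φ : E → X}
    (hφ : ContinuousOn φ C) {x y : X} {γ δ : Path x y} {g d : I → E} (hg : Continuous g)
    (hd : Continuous d) (hgC : ∀ t, g t ∈ C) (hdC : ∀ t, d t ∈ C) (h0 : g 0 = d 0)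
    (h1 : g 1 = d 1) (hgγ : ∀ t, φ (g t) = γ t) (hdδ : ∀ t, φ (d t) = δ t) :
    Path.Homotopic.Quotient.mk γ = Path.Homotopic.Quotient.mk δ := by
  apply Path.Homotopic.Quotient.eq.2
  have hmem : ∀ p : I × I, (1 - (p.1 : ℝ)) • g p.2 + (p.1 : ℝ) • d p.2 ∈ C := fun p =>
    hC (hgC _) (hdC _) (by linarith [p.1.2.2]) p.1.2.1 (by ring)
  refine ⟨{ toFun := fun p => φ ((1 - (p.1 : ℝ)) • g p.2 + (p.1 : ℝ) • d p.2)
            continuous_toFun := hφ.comp_continuous (by fun_prop) hmem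
            map_zero_left := ?_
            map_one_left := ?_
            prop' := ?_ }⟩
  · intro t; simp [hgγ]
  · intro t; simp [hdδ]
  · intro t s hs
    rcases hs with rfl | rfl
    · have : (1 - (t : ℝ)) • g 0 + (t : ℝ) • d 0 = g 0 := by
        rw [← h0, ← add_smul]; simp
      simp only [ContinuousMap.coe_mk, this]
      exact hgγ 0
    · have : (1 - (t : ℝ)) • g 1 + (t : ℝ) • d 1 = g 1 := by
        rw [← h1, ← add_smul]; simp
      simp only [ContinuousMap.coe_mk, this]
      exact hgγ 1

theorem relSC_of_convex {E : Type*} [AddCommGroup E] [Module ℝ E] [TopologicalSpace E]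
    [ContinuousAdd E] [ContinuousSMul ℝ E] {C : Set E} (hC : Convex ℝ C) {φ : E → X}
    (hφ : ContinuousOn φ C) {V : Set X} {ψ : X → E} (hψ : ContinuousOn ψ V) (hm : MapsTo ψ V C)
    (hinv : ∀ x ∈ V, φ (ψ x) = x) : RelSC V := by
  intro x y γ δ hγ hδ
  exact homotopic_of_convex_lift hC hφ (g := fun t => ψ (γ t)) (d := fun t => ψ (δ t))
    (hψ.comp_continuous γ.continuous hγ) (hψ.comp_continuous δ.continuous hδ)
    (fun t => hm (hγ t)) (fun t => hm (hδ t)) (by simp) (by simp)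
    (fun t => hinv _ (hγ t)) (fun t => hinv _ (hδ t))

variable (X) in
/-- A path-connected subset whose paths are determined up to homotopy by their endpoints. -/
structure SCSet where
  /-- The underlying set. -/
  carrier : Set X
  pc : IsPathConnected carrier
  sc : RelSC carrier

namespace SCSet

/-- The class of the paths from `x` to `y` inside `V`. -/
def seg (V : SCSet X) {x y : X} (hx : x ∈ V.carrier) (hy : y ∈ V.carrier) : Cls x y :=
  .mk (V.pc.joinedIn x hx y hy).somePath

theorem mk_eq_seg (V : SCSet X) {x y : X} (γ : Path x y) (h : ∀ t, γ t ∈ V.carrier)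
    (hx : x ∈ V.carrier) (hy : y ∈ V.carrier) :
    Path.Homotopic.Quotient.mk γ = V.seg hx hy :=
  V.sc _ _ _ _ h (JoinedIn.somePath_mem _)

theorem seg_exists (V : SCSet X) {x y : X} (hx : x ∈ V.carrier) (hy : y ∈ V.carrier) :
    ∃ γ : Path x y, (∀ t, γ t ∈ V.carrier) ∧ .mk γ = V.seg hx hy :=
  ⟨_, JoinedIn.somePath_mem (V.pc.joinedIn x hx y hy), rfl⟩

theorem path_trans_mem {V : Set X} {x y z : X} {γ : Path x y} {δ : Path y z}
    (hγ : ∀ t, γ t ∈ V) (hδ : ∀ t, δ t ∈ V) (t : I) : (γ.trans δ) t ∈ V := by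
  rw [Path.trans_apply]
  split_ifs
  · exact hγ _
  · exact hδ _

theorem seg_trans (V : SCSet X) {x y z : X} (hx : x ∈ V.carrier) (hy : y ∈ V.carrier)
    (hz : z ∈ V.carrier) : V.seg hx hy ⬝ V.seg hy hz = V.seg hx hz := by
  obtain ⟨γ, h1, h2⟩ := V.seg_exists hx hy
  obtain ⟨δ, h3, h4⟩ := V.seg_exists hy hz
  rw [← h2, ← h4, ← Path.Homotopic.Quotient.mk_trans]
  exact V.mk_eq_seg _ (path_trans_mem h1 h3) _ _

theorem seg_self (V : SCSet X) {x : X} (hx : x ∈ V.carrier) :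
    V.seg hx hx = .refl x := by
  rw [← V.mk_eq_seg (Path.refl x) (by simpa using hx)]; rfl

theorem seg_trans_assoc (V : SCSet X) {x y z w : X} (hx : x ∈ V.carrier) (hy : y ∈ V.carrier)
    (hz : z ∈ V.carrier) (γ : Cls z w) : V.seg hx hy ⬝ (V.seg hy hz ⬝ γ) = V.seg hx hz ⬝ γ := by
  rw [← Path.Homotopic.Quotient.trans_assoc, seg_trans]

theorem seg_back (V : SCSet X) {x y w : X} (hx : x ∈ V.carrier) (hy : y ∈ V.carrier)
    (γ : Cls x w) : V.seg hx hy ⬝ (V.seg hy hx ⬝ γ) = γ := by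
  rw [seg_trans_assoc, seg_self, Path.Homotopic.Quotient.refl_trans]

/-- The loop at `b` which goes to `x` inside `V` and comes back inside `W`. -/
def loop (V W : SCSet X) {b x : X} (hbV : b ∈ V.carrier) (hbW : b ∈ W.carrier)
    (hV : x ∈ V.carrier) (hW : x ∈ W.carrier) : FundamentalGroup X b :=
  FundamentalGroup.fromPath (V.seg hbV hV ⬝ W.seg hW hbW)

theorem loop_self_left (V W : SCSet X) {b : X} (hbV : b ∈ V.carrier) (hbW : b ∈ W.carrier) :
    loop V W hbV hbW hbV hbW = 1 := by
  rw [loop, seg_self, seg_self, Path.Homotopic.Quotient.refl_trans]; rfl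

theorem loop_same (V : SCSet X) {b x : X} (hbV : b ∈ V.carrier) (hV : x ∈ V.carrier) :
    loop V V hbV hbV hV hV = 1 := by
  rw [loop, seg_trans, seg_self]; rfl

theorem loop_mul (U V W : SCSet X) {b x : X} (hbU : b ∈ U.carrier) (hbV : b ∈ V.carrier)
    (hbW : b ∈ W.carrier) (hU : x ∈ U.carrier) (hV : x ∈ V.carrier) (hW : x ∈ W.carrier) :
    loop V W hbV hbW hV hW * loop U V hbU hbV hU hV = loop U W hbU hbW hU hW := by
  rw [FundamentalGroup.mul_def]
  simp only [loop, Path.Homotopic.Quotient.trans_assoc]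
  rw [V.seg_back]

theorem loop_eq_of_joinedIn (V W : SCSet X) {b x y : X} (hbV : b ∈ V.carrier)
    (hbW : b ∈ W.carrier) (hV : x ∈ V.carrier) (hW : x ∈ W.carrier) (hV' : y ∈ V.carrier)
    (hW' : y ∈ W.carrier) (h : JoinedIn (V.carrier ∩ W.carrier) x y) :
    loop V W hbV hbW hV hW = loop V W hbV hbW hV' hW' := by
  simp only [loop]
  have h1 := V.mk_eq_seg h.somePath (fun t => (h.somePath_mem t).1) hV hV'
  have h2 := W.mk_eq_seg h.somePath (fun t => (h.somePath_mem t).2) hW hW'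
  rw [← V.seg_trans hbV hV hV', ← W.seg_trans hW hW' hbW, ← h2, h1,
    Path.Homotopic.Quotient.trans_assoc]

theorem closure_loops_eq_top {ι : Type*} (V : ι → SCSet X) (hV : ∀ i, IsOpen (V i).carrier)
    (hc : ∀ x, ∃ i, x ∈ (V i).carrier) {b : X} (hb : ∀ i, b ∈ (V i).carrier)
    (S : Subgroup (FundamentalGroup X b))
    (hS : ∀ i j x (hi : x ∈ (V i).carrier) (hj : x ∈ (V j).carrier),
      loop (V i) (V j) (hb i) (hb j) hi hj ∈ S) : S = ⊤ := by
  have key : ∀ x y (γ : Cls x y), ∀ i j (hx : x ∈ (V i).carrier) (hy : y ∈ (V j).carrier),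
      FundamentalGroup.fromPath ((V i).seg (hb i) hx ⬝ γ ⬝ (V j).seg hy (hb j)) ∈ S := by
    refine path_induction hV hc ?_ ?_
    · intro x y z γ δ h1 h2 i j hx hz
      obtain ⟨k, hk⟩ := hc y
      have := S.mul_mem (h2 k j hk hz) (h1 i k hx hk)
      rw [FundamentalGroup.mul_def] at this
      convert this using 1
      simp only [Path.Homotopic.Quotient.trans_assoc, seg_back]
    · intro k x y γ hγ i j hx hy
      have hxk : x ∈ (V k).carrier := by simpa using hγ 0
      have hyk : y ∈ (V k).carrier := by simpa using hγ 1
      have := S.mul_mem (hS k j y hyk hy) (hS i k x hx hxk)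
      rw [FundamentalGroup.mul_def] at this
      convert this using 1
      rw [(V k).mk_eq_seg γ hγ hxk hyk]
      simp only [loop, Path.Homotopic.Quotient.trans_assoc, seg_trans_assoc]
  rw [eq_top_iff]
  intro γ _
  obtain ⟨i, hi⟩ := hc b
  have := key b b γ i i hi hi
  rwa [seg_self, Path.Homotopic.Quotient.refl_trans, Path.Homotopic.Quotient.trans_refl] at this

theorem exists_path_in_dense {ι : Type*} (V : ι → SCSet X) (hV : ∀ i, IsOpen (V i).carrier)
    (hc : ∀ x, ∃ i, x ∈ (V i).carrier) {D : Set X}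
    (hpc : ∀ i, ∀ x ∈ (V i).carrier ∩ D, ∀ y ∈ (V i).carrier ∩ D,
      JoinedIn ((V i).carrier ∩ D) x y)
    (hD : ∀ i j x, x ∈ (V i).carrier → x ∈ (V j).carrier →
      ∃ a ∈ D, JoinedIn ((V i).carrier ∩ (V j).carrier) a x)
    {x y : X} (hx : x ∈ D) (hy : y ∈ D) (γ : Cls x y) :
    ∃ δ : Path x y, (∀ t, δ t ∈ D) ∧ Path.Homotopic.Quotient.mk δ = γ := by
  have key : ∀ x y (γ : Cls x y), ∀ i j (hx : x ∈ (V i).carrier) (hy : y ∈ (V j).carrier),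
      ∀ a c (ha : a ∈ (V i).carrier) (hcc : c ∈ (V j).carrier), a ∈ D → c ∈ D →
      ∃ δ : Path a c, (∀ t, δ t ∈ D) ∧ Path.Homotopic.Quotient.mk δ =
        (V i).seg ha hx ⬝ γ ⬝ (V j).seg hy hcc := by
    refine path_induction hV hc ?_ ?_
    · intro x y z γ δ h1 h2 i j hx hz a c ha hcc haD hcD
      obtain ⟨k, hk⟩ := hc y
      obtain ⟨m, hmD, hm⟩ := hD k k y hk hk
      have hmk : m ∈ (V k).carrier := hm.source_mem.1
      obtain ⟨δ1, h3, h4⟩ := h1 i k hx hk a m ha hmk haD hmD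
      obtain ⟨δ2, h5, h6⟩ := h2 k j hk hz m c hmk hcc hmD hcD
      refine ⟨δ1.trans δ2, path_trans_mem h3 h5, ?_⟩
      rw [Path.Homotopic.Quotient.mk_trans, h4, h6]
      simp only [Path.Homotopic.Quotient.trans_assoc, seg_back]
    · intro k x y γ hγ i j hx hy a c ha hcc haD hcD
      have hxk : x ∈ (V k).carrier := by simpa using hγ 0
      have hyk : y ∈ (V k).carrier := by simpa using hγ 1
      obtain ⟨a', haD', p⟩ := hD i k x hx hxk
      obtain ⟨c', hcD', q⟩ := hD j k y hy hyk
      have hai := p.source_mem.1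
      have hak := p.source_mem.2
      have hcj := q.source_mem.1
      have hck := q.source_mem.2
      have j1 := hpc i a ⟨ha, haD⟩ a' ⟨hai, haD'⟩
      have j2 := hpc k a' ⟨hak, haD'⟩ c' ⟨hck, hcD'⟩
      have j3 := hpc j c' ⟨hcj, hcD'⟩ c ⟨hcc, hcD⟩
      refine ⟨(j1.somePath.trans j2.somePath).trans j3.somePath,
        path_trans_mem (path_trans_mem (fun t => (j1.somePath_mem t).2)
          (fun t => (j2.somePath_mem t).2)) (fun t => (j3.somePath_mem t).2), ?_⟩
      rw [Path.Homotopic.Quotient.mk_trans, Path.Homotopic.Quotient.mk_trans,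
        (V i).mk_eq_seg _ (fun t => (j1.somePath_mem t).1) ha hai,
        (V k).mk_eq_seg _ (fun t => (j2.somePath_mem t).1) hak hck,
        (V j).mk_eq_seg _ (fun t => (j3.somePath_mem t).1) hcj hcc,
        (V k).mk_eq_seg γ hγ hxk hyk]
      have p1 := (V i).mk_eq_seg p.somePath (fun t => (p.somePath_mem t).1) hai hx
      have p2 := (V k).mk_eq_seg p.somePath (fun t => (p.somePath_mem t).2) hak hxk
      have q1 := (V j).mk_eq_seg q.somePath (fun t => (q.somePath_mem t).1) hcj hy
      have q2 := (V k).mk_eq_seg q.somePath (fun t => (q.somePath_mem t).2) hck hyk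
      rw [← (V i).seg_trans ha hai hx, ← (V k).seg_trans hak hxk hck,
        ← (V k).seg_trans hxk hyk hck, p1.symm.trans p2, ← (V j).seg_trans hy hcj hcc]
      have q3 : (V j).seg hy hcj = (V k).seg hyk hck := by
        rw [← (V j).mk_eq_seg q.somePath.symm (fun t => (q.somePath_mem _).1),
          ← (V k).mk_eq_seg q.somePath.symm (fun t => (q.somePath_mem _).2)]
      rw [q3]
      simp only [Path.Homotopic.Quotient.trans_assoc]
  obtain ⟨i, hi⟩ := hc x
  obtain ⟨j, hj⟩ := hc y
  obtain ⟨δ, h1, h2⟩ := key x y γ i j hi hj x y hi hj hx hy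
  refine ⟨δ, h1, ?_⟩
  rw [h2, seg_self, seg_self, Path.Homotopic.Quotient.refl_trans,
    Path.Homotopic.Quotient.trans_refl]

end SCSet
end Charts
end SphBraid

namespace SphBraid

section Algebra
open Equiv

/-- The adjacent transposition exchanging `i` and `i + 1`. -/
def sw {n : ℕ} (i : ℕ) (h : i + 1 < n) : Perm (Fin n) :=
  swap ⟨i, by omega⟩ ⟨i + 1, h⟩

variable {n : ℕ}

theorem sw_val (i : ℕ) (h : i + 1 < n) (a : Fin n) :
    (sw i h a : ℕ) = if (a : ℕ) = i then i + 1 else if (a : ℕ) = i + 1 then i else a := by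
  simp only [sw, swap_apply_def, Fin.ext_iff]
  split_ifs <;> simp

theorem sw_mul_self (i : ℕ) (h : i + 1 < n) : (sw i h : Perm (Fin n)) * sw i h = 1 :=
  swap_mul_self _ _

theorem mul_sw_cancel (w : Perm (Fin n)) (i : ℕ) (h : i + 1 < n) : w * sw i h * sw i h = w := by
  rw [mul_assoc, sw_mul_self, mul_one]

theorem sw_left (i : ℕ) (h : i + 1 < n) : sw i h ⟨i, by omega⟩ = ⟨i + 1, h⟩ :=
  swap_apply_left _ _

theorem sw_right (i : ℕ) (h : i + 1 < n) : sw i h ⟨i + 1, h⟩ = ⟨i, by omega⟩ :=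
  swap_apply_right _ _

theorem sw_of_ne (i : ℕ) (h : i + 1 < n) (j : ℕ) (hj : j < n) (h1 : j ≠ i) (h2 : j ≠ i + 1) :
    sw i h ⟨j, hj⟩ = ⟨j, hj⟩ :=
  swap_apply_of_ne_of_ne (by simpa using h1) (by simpa using h2)

theorem sw_lt_sw (i : ℕ) (h : i + 1 < n) {a b : Fin n} (hab : a < b)
    (hne : ¬ ((a : ℕ) = i ∧ (b : ℕ) = i + 1)) : sw i h a < sw i h b := by
  rw [Fin.lt_def] at *
  rw [sw_val, sw_val]
  split_ifs <;> omega

theorem sw_comm {i j : ℕ} (hi : i + 1 < n) (hj : j + 1 < n) (hij : i + 2 ≤ j) :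
    (sw i hi : Perm (Fin n)) * sw j hj = sw j hj * sw i hi := by
  ext a
  simp only [Perm.mul_apply, sw_val]
  split_ifs <;> omega

theorem sw_braid {i : ℕ} (hi : i + 1 < n) (hj : i + 1 + 1 < n) :
    (sw i hi : Perm (Fin n)) * sw (i + 1) hj * sw i hi =
      sw (i + 1) hj * sw i hi * sw (i + 1) hj := by
  ext a
  simp only [Perm.mul_apply, sw_val]
  split_ifs <;> omega

/-- The set of inversions of a permutation. -/
def invSet (w : Perm (Fin n)) : Finset (Fin n × Fin n) :=
  Finset.univ.filter fun p => p.1 < p.2 ∧ w p.2 < w p.1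

theorem mem_invSet {w : Perm (Fin n)} {p : Fin n × Fin n} :
    p ∈ invSet w ↔ p.1 < p.2 ∧ w p.2 < w p.1 := by
  simp [invSet]

theorem card_invSet_mul_sw_lt (w : Perm (Fin n)) (i : ℕ) (h : i + 1 < n)
    (hd : w ⟨i + 1, h⟩ < w ⟨i, by omega⟩) :
    (invSet (w * sw i h)).card < (invSet w).card := by
  have hmem : ((⟨i, by omega⟩ : Fin n), (⟨i + 1, h⟩ : Fin n)) ∈ invSet w := by
    exact mem_invSet.2 ⟨Fin.mk_lt_mk.2 i.lt_succ_self, hd⟩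
  rw [← Finset.card_erase_add_one hmem, Nat.lt_succ_iff]
  refine Finset.card_le_card_of_injOn (fun p => (sw i h p.1, sw i h p.2)) ?_ ?_
  · rintro ⟨a, b⟩ hp
    simp only [Finset.mem_coe, mem_invSet, Perm.mul_apply] at hp
    have hne : ¬ ((a : ℕ) = i ∧ (b : ℕ) = i + 1) := by
      rintro ⟨h1, h2⟩
      obtain ⟨a, ha⟩ := a
      obtain ⟨b, hb⟩ := b
      simp only at h1 h2
      subst h1 h2
      have hp2 := hp.2
      rw [sw_left, sw_right] at hp2
      exact lt_asymm hd hp2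
    simp only [Finset.mem_coe, Finset.mem_erase, mem_invSet, ne_eq, Prod.mk.injEq]
    refine ⟨?_, sw_lt_sw i h hp.1 hne, hp.2⟩
    rintro ⟨h1, h2⟩
    have h1' := congrArg Fin.val h1
    have h2' := congrArg Fin.val h2
    have hlt := hp.1
    rw [Fin.lt_def] at hlt
    rw [sw_val] at h1' h2'
    simp only at h1' h2'
    split_ifs at h1' h2' <;> omega
  · rintro ⟨a, b⟩ _ ⟨c, e⟩ _ h
    simpa using h

theorem eq_one_of_forall_lt (w : Perm (Fin n))
    (h : ∀ i (hi : i + 1 < n), w ⟨i, by omega⟩ < w ⟨i + 1, hi⟩) : w = 1 := by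
  have hm : StrictMono w := by
    intro a b hab
    obtain ⟨a, ha⟩ := a
    obtain ⟨b, hb⟩ := b
    rw [Fin.mk_lt_mk] at hab
    induction b with
    | zero => omega
    | succ b ih =>
      rcases Nat.lt_succ_iff_lt_or_eq.1 hab with h1 | h1
      · exact (ih (by omega) h1).trans (h b hb)
      · subst h1; exact h a hb
  let o : Fin n ≃o Fin n := ⟨w, by intro a b; exact hm.le_iff_le⟩
  have : o = OrderIso.refl _ := Subsingleton.elim _ _
  ext a
  have := congrArg (fun f : Fin n ≃o Fin n => (f a : ℕ)) this
  exact this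

theorem exists_descent_of_ne_one {w : Perm (Fin n)} (h : w ≠ 1) :
    ∃ i, ∃ hi : i + 1 < n, w ⟨i + 1, hi⟩ < w ⟨i, by omega⟩ := by
  by_contra! hc
  refine h (eq_one_of_forall_lt w fun i hi => lt_of_le_of_ne (hc i hi) fun he => ?_)
  have := w.injective he
  simp at this

theorem descent_induction {P : Perm (Fin n) → Prop} (h1 : P 1)
    (hs : ∀ w i (hi : i + 1 < n), w ⟨i + 1, hi⟩ < w ⟨i, by omega⟩ → P (w * sw i hi) → P w) :
    ∀ w, P w := by
  intro w
  induction hk : (invSet w).card using Nat.strong_induction_on generalizing w with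
  | _ k ih =>
    by_cases hw : w = 1
    · rwa [hw]
    · obtain ⟨i, hi, hd⟩ := exists_descent_of_ne_one hw
      exact hs w i hi hd (ih _ (hk ▸ card_invSet_mul_sw_lt w i hi hd) _ rfl)

variable {G : Type*} [Group G]

/-- A map on permutations which is multiplicative along removals of descents. -/
structure PosLift (E : Perm (Fin n) → G) : Prop where
  one : E 1 = 1
  mul : ∀ w i (hi : i + 1 < n), w ⟨i + 1, hi⟩ < w ⟨i, by omega⟩ →
    E w = E (w * sw i hi) * E (sw i hi)

namespace PosLift
variable {E : Perm (Fin n) → G}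

theorem mul_of_asc (hE : PosLift E) (w : Perm (Fin n)) (i : ℕ) (hi : i + 1 < n)
    (h : w ⟨i, by omega⟩ < w ⟨i + 1, hi⟩) : E (w * sw i hi) = E w * E (sw i hi) := by
  rw [hE.mul (w * sw i hi) i hi, mul_sw_cancel]
  rwa [Perm.mul_apply, Perm.mul_apply, sw_left, sw_right]

theorem comm (hE : PosLift E) {i j : ℕ} (hi : i + 1 < n) (hj : j + 1 < n) (hij : i + 2 ≤ j) :
    E (sw i hi) * E (sw j hj) = E (sw j hj) * E (sw i hi) := by
  rw [← hE.mul_of_asc, ← hE.mul_of_asc, sw_comm hi hj hij]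
  · rw [Fin.lt_def, sw_val, sw_val]; simp only; split_ifs <;> omega
  · rw [Fin.lt_def, sw_val, sw_val]; simp only; split_ifs <;> omega

theorem braid (hE : PosLift E) {i : ℕ} (hi : i + 1 < n) (hj : i + 1 + 1 < n) :
    E (sw i hi) * E (sw (i + 1) hj) * E (sw i hi) =
      E (sw (i + 1) hj) * E (sw i hi) * E (sw (i + 1) hj) := by
  rw [← hE.mul_of_asc, ← hE.mul_of_asc, ← hE.mul_of_asc, ← hE.mul_of_asc, sw_braid]
  all_goals
    simp only [Fin.lt_def, Perm.mul_apply, sw_val]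
    split_ifs <;> omega

theorem mem_closure (hE : PosLift E) (w : Perm (Fin n)) :
    E w ∈ Subgroup.closure {g | ∃ i, ∃ hi : i + 1 < n, g = E (sw i hi)} := by
  induction w using descent_induction with
  | h1 => rw [hE.one]; exact one_mem _
  | hs w i hi hd ih =>
    rw [hE.mul w i hi hd]
    exact mul_mem ih (Subgroup.subset_closure ⟨i, hi, rfl⟩)

theorem mul_of_inv (hE : PosLift E) (w w' : Perm (Fin n))
    (h : ∀ a b, a < b → w' b < w' a → w (w' b) < w (w' a)) : E (w * w') = E w * E w' := by
  induction w' using descent_induction with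
  | h1 => rw [hE.one, mul_one, mul_one]
  | hs w' i hi hd ih =>
    rw [hE.mul w' i hi hd, hE.mul (w * w') i hi (h _ _ (by simp [Fin.lt_def]) hd), ← mul_assoc,
      mul_assoc w w', ih]
    intro a b hab hlt
    rw [Perm.mul_apply, Perm.mul_apply] at *
    refine h _ _ (sw_lt_sw i hi hab ?_) hlt
    rintro ⟨h1, h2⟩
    obtain ⟨a, ha⟩ := a
    obtain ⟨b, hb⟩ := b
    simp only at h1 h2
    subst h1 h2
    rw [sw_left, sw_right] at hlt
    exact lt_asymm hd hlt

end PosLift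

open Classical in
/-- The positive lift of a permutation, obtained by removing descents. -/
def posWord (σ : ℕ → G) (w : Perm (Fin n)) : G :=
  if h : ∃ i, ∃ hi : i + 1 < n, w ⟨i + 1, hi⟩ < w ⟨i, by omega⟩ then
    posWord σ (w * sw h.choose h.choose_spec.choose) * σ h.choose
  else 1
termination_by (invSet w).card
decreasing_by exact card_invSet_mul_sw_lt _ _ _ h.choose_spec.choose_spec

theorem posWord_step {σ : ℕ → G}
    (hcomm : ∀ i j, i + 2 ≤ j → j + 1 < n → σ i * σ j = σ j * σ i)
    (hbraid : ∀ i, i + 2 < n → σ i * σ (i + 1) * σ i = σ (i + 1) * σ i * σ (i + 1))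
    (w : Perm (Fin n)) : ∀ i (hi : i + 1 < n), w ⟨i + 1, hi⟩ < w ⟨i, by omega⟩ →
      posWord σ w = posWord σ (w * sw i hi) * σ i := by
  induction hk : (invSet w).card using Nat.strong_induction_on generalizing w with
  | _ k ih =>
  have ih' : ∀ w' : Perm (Fin n), (invSet w').card < (invSet w).card →
      ∀ i (hi : i + 1 < n), w' ⟨i + 1, hi⟩ < w' ⟨i, by omega⟩ →
      posWord σ w' = posWord σ (w' * sw i hi) * σ i := fun w' hw' => ih _ (hk ▸ hw') w' rfl
  clear ih
  -- two descents give the same value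
  have key : ∀ i j (hi : i + 1 < n) (hj : j + 1 < n), i < j → w ⟨i + 1, hi⟩ < w ⟨i, by omega⟩ →
      w ⟨j + 1, hj⟩ < w ⟨j, by omega⟩ →
      posWord σ (w * sw i hi) * σ i = posWord σ (w * sw j hj) * σ j := by
    intro i j hi hj hij hdi hdj
    have li := card_invSet_mul_sw_lt w i hi hdi
    have lj := card_invSet_mul_sw_lt w j hj hdj
    rcases Nat.lt_or_ge (i + 1) j with h2 | h2
    · rw [ih' _ li j hj, ih' _ lj i hi, mul_assoc, mul_assoc (posWord σ _) (σ i),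
        hcomm i j h2 hj, mul_assoc w, mul_assoc w, sw_comm hi hj h2]
      · rw [Perm.mul_apply, Perm.mul_apply, sw_of_ne, sw_of_ne] <;> omega
      · rw [Perm.mul_apply, Perm.mul_apply, sw_of_ne, sw_of_ne] <;> omega
    · obtain rfl : j = i + 1 := by omega
      have e1 : (w * sw i hi) ⟨i + 1 + 1, hj⟩ < (w * sw i hi) ⟨i + 1, hi⟩ := by
        rw [Perm.mul_apply, Perm.mul_apply, sw_right, sw_of_ne] <;>
          omega
      have e2 : (w * sw (i + 1) hj) ⟨i + 1, hi⟩ < (w * sw (i + 1) hj) ⟨i, by omega⟩ := by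
        rw [Perm.mul_apply, Perm.mul_apply, sw_left, sw_of_ne] <;>
          omega
      have l1 := card_invSet_mul_sw_lt _ _ hj e1
      have l2 := card_invSet_mul_sw_lt _ _ hi e2
      rw [ih' _ li (i + 1) hj e1, ih' _ lj i hi e2, ih' _ (l1.trans li) i hi,
        ih' _ (l2.trans lj) (i + 1) hj]
      · have := hbraid i (by omega)
        have hb := sw_braid hi hj
        simp only [mul_assoc] at this hb ⊢
        rw [this, hb]
      · simp only [Perm.mul_apply]
        rw [sw_of_ne i hi (i + 1 + 1), sw_right (i + 1) hj, sw_right i hi,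
          sw_of_ne (i + 1) hj i] <;> omega
      · simp only [Perm.mul_apply]
        rw [sw_left (i + 1) hj, sw_of_ne (i + 1) hj i, sw_of_ne i hi (i + 1 + 1),
          sw_left i hi] <;> omega
  intro i hi hd
  have h : ∃ i, ∃ hi : i + 1 < n, w ⟨i + 1, hi⟩ < w ⟨i, by omega⟩ := ⟨i, hi, hd⟩
  rw [posWord, dif_pos h]
  rcases lt_trichotomy h.choose i with hlt | heq | hgt
  · exact key _ _ _ _ hlt h.choose_spec.choose_spec hd
  · have : ∀ j (hj : j + 1 < n), j = i → posWord σ (w * sw j hj) * σ j =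
      posWord σ (w * sw i hi) * σ i := by
      rintro j hj rfl; rfl
    exact this _ _ heq
  · exact (key _ _ _ _ hgt hd h.choose_spec.choose_spec).symm

theorem posWord_one (σ : ℕ → G) : posWord σ (1 : Perm (Fin n)) = 1 := by
  rw [posWord, dif_neg]
  rintro ⟨i, hi, h⟩
  simp [Fin.lt_def] at h

theorem posWord_sw {σ : ℕ → G}
    (hcomm : ∀ i j, i + 2 ≤ j → j + 1 < n → σ i * σ j = σ j * σ i)
    (hbraid : ∀ i, i + 2 < n → σ i * σ (i + 1) * σ i = σ (i + 1) * σ i * σ (i + 1))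
    (i : ℕ) (hi : i + 1 < n) : posWord σ (sw i hi : Perm (Fin n)) = σ i := by
  rw [posWord_step hcomm hbraid _ i hi, sw_mul_self, posWord_one, one_mul]
  rw [sw_left, sw_right]; simp [Fin.lt_def]

theorem posLift_posWord {σ : ℕ → G}
    (hcomm : ∀ i j, i + 2 ≤ j → j + 1 < n → σ i * σ j = σ j * σ i)
    (hbraid : ∀ i, i + 2 < n → σ i * σ (i + 1) * σ i = σ (i + 1) * σ i * σ (i + 1)) :
    PosLift (posWord σ : Perm (Fin n) → G) where
  one := posWord_one σ
  mul w i hi hd := by rw [posWord_sw hcomm hbraid, posWord_step hcomm hbraid w i hi hd]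

/-- The values of `E` on the cycle `0 ↦ n - 1`, `k + 1 ↦ k`. -/
theorem PosLift.cycle {E : Perm (Fin n) → G} (hE : PosLift E) {σ : ℕ → G}
    (hσ : ∀ i (hi : i + 1 < n), E (sw i hi) = σ i) (w : Perm (Fin n))
    (hw : ∀ a : Fin n, (w a : ℕ) = if (a : ℕ) = 0 then n - 1 else (a : ℕ) - 1) :
    E w = ((List.range (n - 1)).reverse.map σ).prod := by
  have key : ∀ k, k + 1 ≤ n → ∀ w : Perm (Fin n), (∀ a : Fin n, (w a : ℕ) =
      if (a : ℕ) < k then (a : ℕ) else if (a : ℕ) = k then n - 1 else (a : ℕ) - 1) →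
      E w * ((List.range k).reverse.map σ).prod = ((List.range (n - 1)).reverse.map σ).prod := by
    intro k hk
    induction h : n - 1 - k generalizing k with
    | zero =>
      obtain rfl : k = n - 1 := by omega
      intro w hw
      have : w = 1 := by
        ext a; rw [hw]; simp only [Perm.one_apply]; split_ifs <;> omega
      rw [this, hE.one, one_mul]
    | succ m ih =>
      intro w hw
      have hk1 : k + 1 < n := by omega
      have hd : w ⟨k + 1, hk1⟩ < w ⟨k, by omega⟩ := by
        rw [Fin.lt_def, hw, hw]; simp only; split_ifs <;> omega
      have := ih (k + 1) (by omega) (by omega) (w * sw k hk1) (by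
        intro a
        rw [Perm.mul_apply, hw, sw_val]; split_ifs <;> omega)
      rw [hE.mul w k hk1 hd, ← this, List.range_succ, List.reverse_append, hσ]
      simp [mul_assoc]
  rcases Nat.eq_zero_or_pos n with rfl | hn
  · simp [Subsingleton.elim w 1, hE.one]
  · have := key 0 hn w (by intro a; rw [hw]; split_ifs <;> omega)
    simpa using this

/-- The values of `E` on the inverse cycle `n - 1 ↦ 0`, `k ↦ k + 1`. -/
theorem PosLift.cycle_inv {E : Perm (Fin n) → G} (hE : PosLift E) {σ : ℕ → G}
    (hσ : ∀ i (hi : i + 1 < n), E (sw i hi) = σ i) (w : Perm (Fin n))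
    (hw : ∀ a : Fin n, (w a : ℕ) = if (a : ℕ) = n - 1 then 0 else (a : ℕ) + 1) :
    E w = ((List.range (n - 1)).map σ).prod := by
  have key : ∀ k, k + 1 ≤ n → ∀ w : Perm (Fin n), (∀ a : Fin n, (w a : ℕ) =
      if (a : ℕ) < k then (a : ℕ) + 1 else if (a : ℕ) = k then 0 else (a : ℕ)) →
      E w = ((List.range k).map σ).prod := by
    intro k hk
    induction k with
    | zero =>
      intro w hw
      have : w = 1 := by
        ext a; rw [hw]; simp only [Perm.one_apply]; split_ifs <;> omega
      rw [this, hE.one]; simp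
    | succ k ih =>
      intro w hw
      have hk1 : k + 1 < n := by omega
      have hd : w ⟨k + 1, hk1⟩ < w ⟨k, by omega⟩ := by
        rw [Fin.lt_def, hw, hw]; simp only; split_ifs <;> omega
      rw [hE.mul w k hk1 hd, ih (by omega) (w * sw k hk1) (by
        intro a
        rw [Perm.mul_apply, hw, sw_val]; split_ifs <;> omega), List.range_succ, hσ]
      simp
  rcases Nat.eq_zero_or_pos n with rfl | hn
  · simp [Subsingleton.elim w 1, hE.one]
  · exact key (n - 1) (by omega) w (by intro a; rw [hw]; split_ifs <;> omega)

end Algebra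
end SphBraid

namespace SphBraid
open Topology Filter Set

section Roots
variable {n : ℕ}

/-- The monic polynomial with prescribed roots. -/
def rootPoly (z : Fin n → ℂ) : ℂ[X] := ∏ k, (X - C (z k))

/-- The lower coefficients of the monic polynomial with prescribed roots. -/
def vieta (z : Fin n → ℂ) : Fin n → ℂ := fun i => (rootPoly z).coeff i

theorem rootPoly_monic (z : Fin n → ℂ) : (rootPoly z).Monic :=
  monic_prod_of_monic _ _ fun _ _ => monic_X_sub_C _

theorem rootPoly_natDegree (z : Fin n → ℂ) : (rootPoly z).natDegree = n := by
  rw [rootPoly, natDegree_prod_of_monic _ _ fun _ _ => monic_X_sub_C _]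
  simp

theorem rootPoly_coeff_self (z : Fin n → ℂ) : (rootPoly z).coeff n = 1 := by
  have := (rootPoly_monic z).coeff_natDegree
  rwa [rootPoly_natDegree] at this

theorem rootPoly_ne_zero (z : Fin n → ℂ) : rootPoly z ≠ 0 := (rootPoly_monic z).ne_zero

theorem rootPoly_eq (z : Fin n → ℂ) :
    rootPoly z = X ^ n + ∑ i : Fin n, C (vieta z i) * X ^ (i : ℕ) := by
  conv_lhs => rw [(rootPoly z).as_sum_range_C_mul_X_pow' (n := n + 1)
    (by rw [rootPoly_natDegree]; omega)]
  rw [Finset.sum_range_succ, rootPoly_coeff_self, add_comm, Finset.sum_range]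
  simp [vieta]

theorem rootPoly_eq_of_vieta_eq {z z' : Fin n → ℂ} (h : vieta z = vieta z') :
    rootPoly z = rootPoly z' := by
  rw [rootPoly_eq, rootPoly_eq, h]

theorem continuous_coeff_rootPoly (i : ℕ) :
    Continuous fun z : Fin n → ℂ => (rootPoly z).coeff i := by
  have key : ∀ s : Finset (Fin n), ∀ i,
      Continuous fun z : Fin n → ℂ => (∏ k ∈ s, (X - C (z k))).coeff i := by
    intro s
    induction s using Finset.induction_on with
    | empty => intro i; simpa using continuous_const
    | insert a s ha ih =>
      intro i
      simp_rw [Finset.prod_insert ha, coeff_mul]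
      refine continuous_finsetSum _ fun p _ => ?_
      refine Continuous.mul ?_ (ih _)
      simp only [coeff_sub, coeff_C, coeff_X]
      split_ifs <;> fun_prop
  exact key _ i

theorem continuous_vieta : Continuous (vieta : (Fin n → ℂ) → Fin n → ℂ) :=
  continuous_pi fun i => continuous_coeff_rootPoly i

theorem vieta_comp_perm (z : Fin n → ℂ) (w : Equiv.Perm (Fin n)) : vieta (z ∘ w) = vieta z := by
  have : rootPoly (z ∘ w) = rootPoly z := by
    simp only [rootPoly, Function.comp]
    exact Equiv.prod_comp w fun k => X - C (z k)
  funext i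
  rw [vieta, this]; rfl

theorem roots_rootPoly (z : Fin n → ℂ) : (rootPoly z).roots = Finset.univ.val.map z := by
  have : rootPoly z = ((Finset.univ.val.map z).map fun a => X - C a).prod := by
    rw [Multiset.map_map]; rfl
  rw [this, roots_multiset_prod_X_sub_C]

theorem exists_rootPoly_eq {p : ℂ[X]} (hp : p.Monic) (hd : p.natDegree = n) :
    ∃ z : Fin n → ℂ, rootPoly z = p := by
  have hs := IsAlgClosed.splits p
  have hc : Multiset.card p.roots = n := by rw [← hd]; exact hs.natDegree_eq_card_roots.symm
  have hl : p.roots.toList.length = n := by simp [hc]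
  subst hl
  refine ⟨p.roots.toList.get, ?_⟩
  rw [hs.eq_prod_roots_of_monic hp, rootPoly]
  conv_rhs => rw [← p.roots.coe_toList]
  rw [Multiset.map_coe, Multiset.prod_coe, ← List.prod_ofFn]
  congr 1
  apply List.ext_get <;> simp

theorem vieta_surjective : Function.Surjective (vieta : (Fin n → ℂ) → Fin n → ℂ) := by
  intro u
  have hlt : (∑ i : Fin n, C (u i) * X ^ (i : ℕ)).degree < (n : WithBot ℕ) := by
    exact degree_sum_fin_lt u
  obtain ⟨z, hz⟩ := exists_rootPoly_eq (n := n) (p := X ^ n + ∑ i : Fin n, C (u i) * X ^ (i : ℕ))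
    (monic_X_pow_add hlt) (by
      refine natDegree_eq_of_degree_eq_some ?_
      rw [degree_add_eq_left_of_degree_lt] <;> rw [degree_X_pow]
      exact hlt)
  refine ⟨z, ?_⟩
  funext i
  rw [vieta, hz, coeff_add, coeff_X_pow, if_neg (by have := i.2; omega), zero_add, finsetSum_coeff,
    Finset.sum_eq_single i]
  · simp
  · intro j _ hj
    rw [coeff_C_mul, coeff_X_pow, if_neg (fun h => hj (Fin.ext h.symm)), mul_zero]
  · simp

theorem injective_of_vieta_eq {z z' : Fin n → ℂ} (hz : Function.Injective z)
    (h : vieta z' = vieta z) : Function.Injective z' := by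
  have h1 := roots_rootPoly z
  rw [← rootPoly_eq_of_vieta_eq h, roots_rootPoly] at h1
  have h2 : (Finset.univ.val.map z).Nodup := Multiset.Nodup.map hz Finset.univ.nodup
  rw [← h1, Multiset.nodup_map_iff_inj_on Finset.univ.nodup] at h2
  intro a b hab
  exact h2 a (Finset.mem_univ_val _) b (Finset.mem_univ_val _) hab

theorem exists_perm_of_vieta_eq {z z' : Fin n → ℂ} (hz : Function.Injective z)
    (h : vieta z' = vieta z) : ∃ w : Equiv.Perm (Fin n), z' = z ∘ w := by
  have hz' := injective_of_vieta_eq hz h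
  have h1 := roots_rootPoly z
  rw [← rootPoly_eq_of_vieta_eq h, roots_rootPoly] at h1
  have h2 : ∀ k, ∃ l, z l = z' k := by
    intro k
    have : z' k ∈ Finset.univ.val.map z := by
      rw [← h1]; exact Multiset.mem_map_of_mem _ (Finset.mem_univ k)
    simpa using this
  choose w hw using h2
  have hwi : Function.Injective w := by
    intro a b hab
    apply hz'
    rw [← hw, ← hw, hab]
  refine ⟨Equiv.ofBijective w (Finite.injective_iff_bijective.1 hwi), ?_⟩
  funext k
  exact (hw k).symm

theorem norm_root_le (z : Fin n → ℂ) (k : Fin n) : ‖z k‖ ≤ ‖vieta z‖ + 1 := by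
  have hroot : (rootPoly z).IsRoot (z k) := by
    rw [IsRoot.def, rootPoly, eval_prod]
    exact Finset.prod_eq_zero (Finset.mem_univ k) (by simp)
  have h := (hroot.norm_lt_cauchyBound (rootPoly_ne_zero z)).le
  have h2 : cauchyBound (rootPoly z) ≤ ‖vieta z‖₊ + 1 := by
    rw [cauchyBound, (rootPoly_monic z).leadingCoeff, nnnorm_one, div_one]
    gcongr
    refine Finset.sup_le fun i hi => ?_
    rw [rootPoly_natDegree, Finset.mem_range] at hi
    exact nnnorm_le_pi_nnnorm (vieta z) ⟨i, hi⟩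
  exact_mod_cast h.trans h2

theorem isClosedMap_vieta : IsClosedMap (vieta : (Fin n → ℂ) → Fin n → ℂ) := by
  apply IsProperMap.isClosedMap
  rw [isProperMap_iff_isCompact_preimage]
  refine ⟨continuous_vieta, fun K hK => ?_⟩
  obtain ⟨R, hR⟩ := hK.isBounded.exists_norm_le
  refine Metric.isCompact_of_isClosed_isBounded (hK.isClosed.preimage continuous_vieta) ?_
  refine (Metric.isBounded_closedBall (x := (0 : Fin n → ℂ)) (r := |R| + 1)).subset ?_
  intro z hz
  rw [mem_closedBall_zero_iff, pi_norm_le_iff_of_nonneg (by positivity)]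
  intro k
  have := hR _ hz
  have := le_abs_self R
  linarith [norm_root_le z k]

theorem isOpen_vieta_image {O : Set (Fin n → ℂ)} (hO : IsOpen O)
    (hinj : ∀ z ∈ O, Function.Injective z) : IsOpen (vieta '' O) := by
  have h1 : (vieta '' O)ᶜ = vieta '' (⋃ w : Equiv.Perm (Fin n), (fun z => z ∘ w) ⁻¹' O)ᶜ := by
    ext u
    constructor
    · intro hu
      obtain ⟨z, rfl⟩ := vieta_surjective u
      refine ⟨z, ?_, rfl⟩
      intro hz
      obtain ⟨w, hw⟩ := mem_iUnion.1 hz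
      exact hu ⟨_, hw, vieta_comp_perm z w⟩
    · rintro ⟨z, hz, rfl⟩ ⟨z', hz', h⟩
      obtain ⟨w, hw⟩ := exists_perm_of_vieta_eq (hinj _ hz') h.symm
      refine hz (mem_iUnion.2 ⟨w⁻¹, ?_⟩)
      have : z ∘ ⇑(w⁻¹ : Equiv.Perm (Fin n)) = z' := by
        rw [hw]; funext k; simp
      rw [mem_preimage, this]
      exact hz'
  rw [← isClosed_compl_iff, h1]
  refine isClosedMap_vieta _ ?_
  rw [isClosed_compl_iff]
  refine isOpen_iUnion fun w => hO.preimage ?_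
  exact continuous_pi fun k => continuous_apply (w k)

theorem isOpen_injective : IsOpen {z : Fin n → ℂ | Function.Injective z} := by
  have : {z : Fin n → ℂ | Function.Injective z} =
      ⋂ a : Fin n, ⋂ b : Fin n, {z | z a = z b → a = b} := by
    ext z; simp [Function.Injective]
  rw [this]
  refine isOpen_iInter_of_finite fun a => isOpen_iInter_of_finite fun b => ?_
  by_cases hab : a = b
  · simp [hab]
  · have : {z : Fin n → ℂ | z a = z b → a = b} = {z | z a = z b}ᶜ := by
      ext z; simp [hab]
    rw [this, isOpen_compl_iff]
    exact isClosed_eq (continuous_apply a) (continuous_apply b)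

variable (n) in
/-- Coefficient vectors of monic polynomials of degree `n` with distinct roots. -/
abbrev Conf : Type := {u : Fin n → ℂ // ∃ z, Function.Injective z ∧ vieta z = u}

variable (n) in
/-- The tuple `(0, 1, …, n - 1)`. -/
def stdTuple : Fin n → ℂ := fun k => (k : ℂ)

theorem stdTuple_injective : Function.Injective (stdTuple n) := by
  intro a b h
  simpa [stdTuple, Fin.ext_iff] using h

open Classical in
/-- The configuration with prescribed roots (the standard one if the roots are not distinct). -/
def toConf (z : Fin n → ℂ) : Conf n :=
  if h : Function.Injective z then ⟨vieta z, z, h, rfl⟩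
  else ⟨vieta (stdTuple n), _, stdTuple_injective, rfl⟩

theorem toConf_val {z : Fin n → ℂ} (h : Function.Injective z) : (toConf z).1 = vieta z := by
  rw [toConf, dif_pos h]

theorem toConf_comp_perm (z : Fin n → ℂ) (w : Equiv.Perm (Fin n)) : toConf (z ∘ w) = toConf z := by
  by_cases h : Function.Injective z
  · apply Subtype.ext
    rw [toConf_val h, toConf_val (h.comp w.injective), vieta_comp_perm]
  · rw [toConf, toConf, dif_neg h, dif_neg]
    intro h'
    apply h
    have := h'.comp (w⁻¹ : Equiv.Perm (Fin n)).injective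
    convert this
    funext k; simp

theorem exists_toConf (u : Conf n) : ∃ z, Function.Injective z ∧ toConf z = u := by
  obtain ⟨u, z, hz, h⟩ := u
  exact ⟨z, hz, Subtype.ext ((toConf_val hz).trans h)⟩

theorem exists_perm_of_toConf_eq {z z' : Fin n → ℂ} (hz : Function.Injective z)
    (hz' : Function.Injective z') (h : toConf z' = toConf z) :
    ∃ w : Equiv.Perm (Fin n), z' = z ∘ w := by
  apply exists_perm_of_vieta_eq hz
  rw [← toConf_val hz, ← toConf_val hz', h]

theorem continuousOn_toConf : ContinuousOn (toConf (n := n)) {z | Function.Injective z} := by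
  refine Topology.IsInducing.subtypeVal.continuousOn_iff.2 ?_
  exact continuous_vieta.continuousOn.congr fun z hz => toConf_val hz

theorem isOpen_toConf_image {O : Set (Fin n → ℂ)} (hO : IsOpen O)
    (hinj : ∀ z ∈ O, Function.Injective z) : IsOpen (toConf '' O) := by
  have : toConf '' O = Subtype.val ⁻¹' (vieta '' O) := by
    ext u
    constructor
    · rintro ⟨z, hz, rfl⟩
      exact ⟨z, hz, (toConf_val (hinj z hz)).symm⟩
    · rintro ⟨z, hz, h⟩
      exact ⟨z, hz, Subtype.ext ((toConf_val (hinj z hz)).trans h)⟩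
  rw [this]
  exact (isOpen_vieta_image hO hinj).preimage continuous_subtype_val

theorem isOpen_conf : IsOpen {u : Fin n → ℂ | ∃ z, Function.Injective z ∧ vieta z = u} :=
  isOpen_vieta_image isOpen_injective fun _ h => h

/-- A chart of the space of configurations given by a convex set of tuples. -/
theorem exists_continuousOn_section {O : Set (Fin n → ℂ)} (hO : IsOpen O)
    (hinj : ∀ z ∈ O, Function.Injective z) (hinjOn : InjOn toConf O) :
    ∃ ψ : Conf n → (Fin n → ℂ), ContinuousOn ψ (toConf '' O) ∧ MapsTo ψ (toConf '' O) O ∧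
      ∀ u ∈ toConf '' O, toConf (ψ u) = u := by
  classical
  refine ⟨Function.invFunOn toConf O, ?_, ?_, ?_⟩
  · rw [continuousOn_iff']
    intro t ht
    refine ⟨toConf '' (t ∩ O), isOpen_toConf_image (ht.inter hO) fun z hz => hinj z hz.2, ?_⟩
    ext u
    constructor
    · rintro ⟨h1, z, hz, rfl⟩
      refine ⟨⟨z, ⟨?_, hz⟩, rfl⟩, z, hz, rfl⟩
      have := hinjOn.leftInvOn_invFunOn hz
      rwa [mem_preimage, this] at h1
    · rintro ⟨⟨z, hz, rfl⟩, h2⟩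
      refine ⟨?_, h2⟩
      have := hinjOn.leftInvOn_invFunOn hz.2
      rw [mem_preimage, this]
      exact hz.1
  · intro u hu
    exact Function.invFunOn_mem hu
  · intro u hu
    exact Function.invFunOn_eq hu

/-- The chart of configurations given by an open convex set of tuples on which `toConf` is
injective. -/
def confChart (O : Set (Fin n → ℂ)) (hO : IsOpen O) (hC : Convex ℝ O) (hne : O.Nonempty)
    (hinj : ∀ z ∈ O, Function.Injective z) (hinjOn : InjOn toConf O) : SCSet (Conf n) where
  carrier := toConf '' O
  pc := (hC.isPathConnected hne).image' (continuousOn_toConf.mono hinj)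
  sc := by
    obtain ⟨ψ, h1, h2, h3⟩ := exists_continuousOn_section hO hinj hinjOn
    exact relSC_of_convex hC (continuousOn_toConf.mono hinj) h1 h2 h3

end Roots
end SphBraid

namespace SphBraid
open Topology Filter Set Equiv

section Affine
variable {n : ℕ}

/-- The linear functional `x + iy ↦ x + t y`. -/
def slope (t : ℝ) (c : ℂ) : ℝ := c.re + t * c.im

theorem continuous_slope (t : ℝ) : Continuous (slope t) := by
  unfold slope; fun_prop

/-- Tuples which are strictly increasing for the functional `slope t`. -/
def sorted (n : ℕ) (t : ℝ) : Set (Fin n → ℂ) := {z | StrictMono fun k => slope t (z k)}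

theorem isOpen_strictMono {f : Fin n → ℂ → ℝ} (hf : ∀ k, Continuous (f k)) :
    IsOpen {z : Fin n → ℂ | StrictMono fun k => f k (z k)} := by
  have : {z : Fin n → ℂ | StrictMono fun k => f k (z k)} =
      ⋂ a : Fin n, ⋂ b : Fin n, {z | a < b → f a (z a) < f b (z b)} := by
    ext z; simp [StrictMono]
  rw [this]
  refine isOpen_iInter_of_finite fun a => isOpen_iInter_of_finite fun b => ?_
  by_cases hab : a < b
  · simp only [hab, true_imp_iff]
    exact isOpen_lt ((hf a).comp (continuous_apply a)) ((hf b).comp (continuous_apply b))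
  · simp [hab]

theorem isOpen_sorted (t : ℝ) : IsOpen (sorted n t) :=
  isOpen_strictMono fun _ => continuous_slope t

theorem convex_sorted (t : ℝ) : Convex ℝ (sorted n t) := by
  intro z hz w hw a b ha hb hab i j hij
  have h1 := hz hij
  have h2 := hw hij
  simp only [slope, Pi.add_apply, Pi.smul_apply, Complex.add_re, Complex.add_im, Complex.real_smul,
    Complex.re_ofReal_mul, Complex.im_ofReal_mul] at *
  rcases ha.eq_or_lt with rfl | ha'
  · have hb1 : b = 1 := by linarith
    subst hb1
    linarith
  · nlinarith

theorem injective_of_mem_sorted {t : ℝ} {z : Fin n → ℂ} (hz : z ∈ sorted n t) :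
    Function.Injective z := fun a b h => hz.injective (by simp only [h])

theorem eq_one_of_strictMono {α : Type*} [LinearOrder α] {f : Fin n → α} (hf : StrictMono f)
    {w : Perm (Fin n)} (hw : StrictMono (f ∘ w)) : w = 1 := by
  have hm : StrictMono w := fun a b hab => hf.lt_iff_lt.1 (hw hab)
  have : (hm.orderIsoOfSurjective w w.surjective) = OrderIso.refl (Fin n) := Subsingleton.elim _ _
  ext k
  have := congrArg (fun e : Fin n ≃o Fin n => ((e k : Fin n) : ℕ)) this
  simpa using this

theorem injOn_toConf_sorted (t : ℝ) : InjOn toConf (sorted n t) := by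
  intro z hz z' hz' h
  obtain ⟨w, rfl⟩ := exists_perm_of_toConf_eq (injective_of_mem_sorted hz)
    (injective_of_mem_sorted hz') h.symm
  have : w = 1 := eq_one_of_strictMono (f := fun k => slope t (z k)) hz hz'
  subst this; rfl

theorem stdTuple_mem_sorted (t : ℝ) : stdTuple n ∈ sorted n t := by
  intro a b hab
  simpa [slope, stdTuple] using hab

/-- Configurations whose points have distinct images under `slope t`. -/
def chart (n : ℕ) (t : ℝ) : SCSet (Conf n) :=
  confChart (sorted n t) (isOpen_sorted t) (convex_sorted t) ⟨_, stdTuple_mem_sorted t⟩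
    (fun _ => injective_of_mem_sorted) (injOn_toConf_sorted t)

theorem mem_chart {t : ℝ} {z : Fin n → ℂ} (hz : z ∈ sorted n t) : toConf z ∈ (chart n t).carrier :=
  ⟨z, hz, rfl⟩

theorem mem_chart_comp {t : ℝ} {z : Fin n → ℂ} {v : Perm (Fin n)} (hz : z ∘ v ∈ sorted n t) :
    toConf z ∈ (chart n t).carrier := ⟨_, hz, toConf_comp_perm z v⟩

theorem isOpen_chart (t : ℝ) : IsOpen (chart n t).carrier :=
  isOpen_toConf_image (isOpen_sorted t) fun _ => injective_of_mem_sorted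

/-- The standard configuration. -/
def stdConf (n : ℕ) : Conf n := toConf (stdTuple n)

theorem stdConf_mem (t : ℝ) : stdConf n ∈ (chart n t).carrier := mem_chart (stdTuple_mem_sorted t)

theorem exists_sort {α : Type*} [LinearOrder α] {f : Fin n → α} (hf : Function.Injective f) :
    StrictMono (f ∘ Tuple.sort f) :=
  (Tuple.monotone_sort f).strictMono_of_injective (hf.comp (Tuple.sort f).injective)

theorem exists_slope_injective {z : Fin n → ℂ} (hz : Function.Injective z) (T : ℝ) :
    ∃ t, T < t ∧ Function.Injective fun k => slope t (z k) := by
  have hfin : (⋃ a : Fin n, ⋃ b : Fin n, {t | a ≠ b ∧ slope t (z a) = slope t (z b)}).Finite := by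
    refine finite_iUnion fun a => finite_iUnion fun b => Set.Subsingleton.finite ?_
    rintro s ⟨hab, hs⟩ t ⟨-, ht⟩
    simp only [slope] at hs ht
    by_contra hst
    have h1 : (s - t) * ((z a).im - (z b).im) = 0 := by linarith
    have h2 : (z a).im = (z b).im := by
      have := (mul_eq_zero.1 h1).resolve_left (sub_ne_zero.2 hst)
      linarith
    rw [h2] at hs
    exact hab (hz (Complex.ext (by linarith) h2))
  obtain ⟨t, ht, h⟩ := (Set.Ioi_infinite T).exists_notMem_finite hfin
  refine ⟨t, ht, fun a b hab => ?_⟩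
  by_contra hne
  exact h (mem_iUnion.2 ⟨a, mem_iUnion.2 ⟨b, hne, hab⟩⟩)

theorem exists_mem_chart (u : Conf n) : ∃ t, u ∈ (chart n t).carrier := by
  obtain ⟨z, hz, rfl⟩ := exists_toConf u
  obtain ⟨t, -, ht⟩ := exists_slope_injective hz 0
  exact ⟨t, mem_chart_comp (v := Tuple.sort fun k => slope t (z k)) (exists_sort ht)⟩

theorem exists_crossing {s t : ℝ} {u : Conf n} (hs : u ∈ (chart n s).carrier)
    (ht : u ∈ (chart n t).carrier) :
    ∃ z v, z ∈ sorted n s ∧ z ∘ ⇑(v : Perm (Fin n)) ∈ sorted n t ∧ toConf z = u := by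
  obtain ⟨z, hz, rfl⟩ := hs
  obtain ⟨z', hz', h⟩ := ht
  obtain ⟨v, rfl⟩ := exists_perm_of_toConf_eq (injective_of_mem_sorted hz)
    (injective_of_mem_sorted hz') h
  exact ⟨z, v, hz, hz', rfl⟩

/-- The permutation sorting a tuple by imaginary part, then by real part. -/
def lexPerm (z : Fin n → ℂ) : Perm (Fin n) := Tuple.sort fun k => toLex ((z k).im, (z k).re)

theorem lexKey_injective {z : Fin n → ℂ} (hz : Function.Injective z) :
    Function.Injective fun k => toLex ((z k).im, (z k).re) := by
  intro a b h
  have := toLex.injective h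
  simp only [Prod.mk.injEq] at this
  exact hz (Complex.ext this.2 this.1)

theorem lexPerm_comp {z : Fin n → ℂ} (hz : Function.Injective z) (v : Perm (Fin n)) :
    lexPerm z = v * lexPerm (z ∘ v) := by
  have h1 := exists_sort (lexKey_injective hz)
  have h2 := exists_sort (lexKey_injective (hz.comp v.injective))
  have : (lexPerm z)⁻¹ * (v * lexPerm (z ∘ v)) = 1 := by
    refine eq_one_of_strictMono h1 ?_
    convert h2 using 1
    funext k
    simp [lexPerm, Function.comp_def]
  rw [inv_mul_eq_one] at this
  exact this

theorem lexPerm_stdTuple : lexPerm (stdTuple n) = 1 := by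
  refine eq_one_of_strictMono (f := fun k => toLex ((stdTuple n k).im, (stdTuple n k).re)) ?_
    (exists_sort (lexKey_injective stdTuple_injective))
  intro a b hab
  rw [Prod.Lex.toLex_lt_toLex]
  simpa [stdTuple] using hab

variable {G : Type*}

/-- The local value of a positive lift on a configuration seen from `chart n t`. -/
def val (r : Perm (Fin n) → G) (t : ℝ) (u : Conf n) : G :=
  r (lexPerm (Function.invFunOn toConf (sorted n t) u))

theorem val_toConf (r : Perm (Fin n) → G) {t : ℝ} {z : Fin n → ℂ} (hz : z ∈ sorted n t) :
    val r t (toConf z) = r (lexPerm z) := by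
  rw [val, (injOn_toConf_sorted t).leftInvOn_invFunOn hz]

variable [Group G]

theorem val_stdConf {r : Perm (Fin n) → G} (hr : PosLift r) (t : ℝ) : val r t (stdConf n) = 1 := by
  rw [stdConf, val_toConf r (stdTuple_mem_sorted t), lexPerm_stdTuple, hr.one]

theorem val_crossing {r : Perm (Fin n) → G} (hr : PosLift r) {s t : ℝ} (hst : s < t)
    {z : Fin n → ℂ} {v : Perm (Fin n)} (hz : z ∈ sorted n s) (hv : z ∘ v ∈ sorted n t) :
    val r s (toConf z) * (val r t (toConf z))⁻¹ = r v := by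
  have hzi := injective_of_mem_sorted hz
  rw [val_toConf r hz, ← toConf_comp_perm z v, val_toConf r hv, mul_inv_eq_iff_eq_mul,
    lexPerm_comp hzi v]
  refine hr.mul_of_inv v _ ?_
  intro a b hab hlt
  have h1 := exists_sort (lexKey_injective (hzi.comp v.injective)) hab
  change toLex ((z (v (lexPerm (z ∘ v) a))).im, (z (v (lexPerm (z ∘ v) a))).re) <
    toLex ((z (v (lexPerm (z ∘ v) b))).im, (z (v (lexPerm (z ∘ v) b))).re) at h1
  have h2 : slope t (z (v (lexPerm (z ∘ v) b))) < slope t (z (v (lexPerm (z ∘ v) a))) := hv hlt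
  have h3 : (z (v (lexPerm (z ∘ v) a))).im ≤ (z (v (lexPerm (z ∘ v) b))).im := by
    rw [Prod.Lex.toLex_lt_toLex] at h1
    rcases h1 with h | h
    · exact h.le
    · exact h.1.le
  refine (StrictMono.lt_iff_lt (f := fun k => slope s (z k)) hz).1 ?_
  simp only [slope] at *
  nlinarith

theorem isOpen_crossing (s t : ℝ) (v : Perm (Fin n)) :
    IsOpen {z | z ∈ sorted n s ∧ z ∘ v ∈ sorted n t} :=
  (isOpen_sorted s).inter (IsOpen.preimage (f := fun z : Fin n → ℂ => z ∘ v)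
    (continuous_pi fun k => continuous_apply (v k)) (isOpen_sorted t))

theorem convex_crossing (s t : ℝ) (v : Perm (Fin n)) :
    Convex ℝ {z | z ∈ sorted n s ∧ z ∘ v ∈ sorted n t} :=
  (convex_sorted s).inter fun _ hz _ hw _ _ ha hb hab => convex_sorted t hz hw ha hb hab

theorem eventually_val {r : Perm (Fin n) → G} (hr : PosLift r) {s t : ℝ} {u : Conf n}
    (hs : u ∈ (chart n s).carrier) (ht : u ∈ (chart n t).carrier) :
    ∃ h, ∀ᶠ x in 𝓝 u, val r s x * (val r t x)⁻¹ = h := by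
  have key : ∀ {s t : ℝ}, s < t → u ∈ (chart n s).carrier → u ∈ (chart n t).carrier →
      ∃ h, ∀ᶠ x in 𝓝 u, val r s x * (val r t x)⁻¹ = h := by
    intro s t hst hs ht
    obtain ⟨z, v, hz, hv, rfl⟩ := exists_crossing hs ht
    refine ⟨r v, ?_⟩
    have ho := isOpen_toConf_image (isOpen_crossing s t v) fun z hz => injective_of_mem_sorted hz.1
    filter_upwards [ho.mem_nhds ⟨z, ⟨hz, hv⟩, rfl⟩]
    rintro _ ⟨z', hz', rfl⟩
    exact val_crossing hr hst hz'.1 hz'.2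
  rcases lt_trichotomy s t with h | rfl | h
  · exact key h hs ht
  · exact ⟨1, by simp⟩
  · obtain ⟨g, hg⟩ := key h ht hs
    refine ⟨g⁻¹, ?_⟩
    filter_upwards [hg] with x hx
    rw [← hx]; group

theorem joinedIn_crossing {s t : ℝ} {v : Perm (Fin n)} {z z' : Fin n → ℂ} (hz : z ∈ sorted n s)
    (hv : z ∘ v ∈ sorted n t) (hz' : z' ∈ sorted n s) (hv' : z' ∘ v ∈ sorted n t) :
    JoinedIn ((chart n s).carrier ∩ (chart n t).carrier) (toConf z) (toConf z') := by
  have h1 := (convex_crossing s t v).isPathConnected ⟨z, hz, hv⟩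
  have h2 := h1.image' (continuousOn_toConf.mono fun z hz => injective_of_mem_sorted hz.1)
  refine (h2.joinedIn _ ⟨z, ⟨hz, hv⟩, rfl⟩ _ ⟨z', ⟨hz', hv'⟩, rfl⟩).mono ?_
  rintro _ ⟨y, hy, rfl⟩
  exact ⟨mem_chart hy.1, mem_chart_comp hy.2⟩

/-- The loop obtained by leaving `stdConf n` inside `chart n t` and coming back inside
`chart n s`. -/
def crossLoop {s t : ℝ} {u : Conf n} (hs : u ∈ (chart n s).carrier)
    (ht : u ∈ (chart n t).carrier) : FundamentalGroup (Conf n) (stdConf n) :=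
  (chart n t).loop (chart n s) (stdConf_mem t) (stdConf_mem s) ht hs

/-- The point of `ℂ` with prescribed values of `slope s` and `slope t`. -/
def ptOf (s t a b : ℝ) : ℂ := ⟨a - s * ((b - a) / (t - s)), (b - a) / (t - s)⟩

theorem slope_ptOf {s t : ℝ} (h : s < t) (a b c : ℝ) :
    (t - s) * slope c (ptOf s t a b) = (t - c) * a + (c - s) * b := by
  have : t - s ≠ 0 := by linarith
  simp only [slope, ptOf]
  field_simp
  ring

theorem mem_sorted_iff {s t : ℝ} (h : s < t) (a b : Fin n → ℝ) (c : ℝ) :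
    (fun k => ptOf s t (a k) (b k)) ∈ sorted n c ↔
      StrictMono fun k => (t - c) * a k + (c - s) * b k := by
  have h' : 0 < t - s := by linarith
  simp only [sorted, Set.mem_ofPred_eq, StrictMono]
  refine forall₃_congr fun i j _ => ?_
  rw [← slope_ptOf h, ← slope_ptOf h, mul_lt_mul_iff_right₀ h']

theorem exists_config {s t : ℝ} (h : s < t) (v : Perm (Fin n)) {a b : Fin n → ℝ}
    (ha : StrictMono a) (hb : StrictMono b) : ∃ z, z ∈ sorted n s ∧ z ∘ v ∈ sorted n t ∧
      (∀ (v' : Perm (Fin n)) c, (StrictMono fun k => (t - c) * a (v (v' k)) + (c - s) * b (v' k)) →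
        z ∘ ⇑(v * v') ∈ sorted n c) := by
  have h' : 0 < t - s := by linarith
  have key : ∀ (v' : Perm (Fin n)) c,
      (StrictMono fun k => (t - c) * a (v (v' k)) + (c - s) * b (v' k)) →
        (fun k => ptOf s t (a k) (b (v⁻¹ k))) ∘ ⇑(v * v') ∈ sorted n c := by
    intro v' c hc
    have : (fun k => ptOf s t (a k) (b (v⁻¹ k))) ∘ ⇑(v * v') =
        fun k => ptOf s t (a (v (v' k))) (b (v' k)) := by
      funext k; simp
    rw [this, mem_sorted_iff h]
    exact hc
  refine ⟨fun k => ptOf s t (a k) (b (v⁻¹ k)), ?_, ?_, key⟩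
  · rw [mem_sorted_iff h]
    intro i j hij
    have := ha hij
    simp only [sub_self, zero_mul, add_zero]
    gcongr
  · have := key 1 t ?_
    · simpa using this
    · intro i j hij
      have := hb hij
      simp only [sub_self, zero_mul, zero_add, Perm.one_apply]
      gcongr

open Classical in
/-- The class of the loop crossing from `chart n t` to `chart n s` at a configuration with
relative permutation `v`. -/
def crossing (s t : ℝ) (v : Perm (Fin n)) : FundamentalGroup (Conf n) (stdConf n) :=
  if h : ∃ z, z ∈ sorted n s ∧ z ∘ v ∈ sorted n t then
    crossLoop (mem_chart h.choose_spec.1) (mem_chart_comp h.choose_spec.2) else 1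

theorem crossLoop_eq_crossing {s t : ℝ} {z : Fin n → ℂ} {v : Perm (Fin n)} (hz : z ∈ sorted n s)
    (hv : z ∘ v ∈ sorted n t) :
    crossLoop (mem_chart hz) (mem_chart_comp hv) = crossing s t v := by
  have h : ∃ z, z ∈ sorted n s ∧ z ∘ v ∈ sorted n t := ⟨z, hz, hv⟩
  rw [crossing, dif_pos h]
  refine SCSet.loop_eq_of_joinedIn _ _ _ _ _ _ _ _ ?_
  rw [inter_comm]
  exact joinedIn_crossing hz hv h.choose_spec.1 h.choose_spec.2

theorem crossing_one (s t : ℝ) : crossing s t (1 : Perm (Fin n)) = 1 := by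
  rw [← crossLoop_eq_crossing (stdTuple_mem_sorted s) (v := 1) (stdTuple_mem_sorted t)]
  exact SCSet.loop_self_left _ _ _ _

theorem crossing_mul {s t u : ℝ} {z : Fin n → ℂ} {v v' : Perm (Fin n)} (hz : z ∈ sorted n s)
    (hv : z ∘ v ∈ sorted n t) (hv' : z ∘ ⇑(v * v') ∈ sorted n u) :
    crossing s t v * crossing t u v' = crossing s u (v * v') := by
  have h1 : (z ∘ v) ∘ v' ∈ sorted n u := hv'
  rw [← crossLoop_eq_crossing hz hv, ← crossLoop_eq_crossing hv h1, ← crossLoop_eq_crossing hz hv']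
  have : ∀ (x y : Conf n) (hxy : y = x) (h1 : y ∈ (chart n t).carrier)
      (h2 : y ∈ (chart n u).carrier) (h3 : x ∈ (chart n t).carrier) (h4 : x ∈ (chart n u).carrier),
      crossLoop h1 h2 = crossLoop h3 h4 := by
    rintro x _ rfl _ _ _ _; rfl
  rw [this _ _ (toConf_comp_perm z v) _ _ (mem_chart_comp hv) (mem_chart_comp hv')]
  exact SCSet.loop_mul _ _ _ _ _ _ _ _ _

theorem strictMono_cast_mul {c : ℝ} (hc : 0 < c) : StrictMono fun k : Fin n => c * (k : ℝ) := by
  intro a b hab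
  have : (a : ℝ) < (b : ℝ) := by exact_mod_cast hab
  simp only
  gcongr

theorem crossing_right {s t u : ℝ} (hst : s < t) (htu : t < u) (v : Perm (Fin n)) :
    crossing s t v = crossing s u v := by
  have h0 : 0 < t - s := by linarith
  have h1 : 0 < u - t := by linarith
  set c : ℝ := (u - t) / (t - s) * (n + 1) with hc
  have hc0 : 0 < c := by positivity
  obtain ⟨z, hz, hu, H⟩ := exists_config (hst.trans htu) v (strictMono_cast_mul one_pos)
    (strictMono_cast_mul hc0)
  have ht : z ∘ v ∈ sorted n t := by
    have := H 1 t ?_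
    · simpa using this
    intro i j hij
    have hij' : (i : ℝ) + 1 ≤ j := by exact_mod_cast hij
    have hi : ((v i : ℕ) : ℝ) < n := by exact_mod_cast (v i).2
    have hj : (0 : ℝ) ≤ ((v j : ℕ) : ℝ) := by positivity
    have hcc : (t - s) * c = (u - t) * (n + 1) := by rw [hc]; field_simp
    simp only [Perm.one_apply, one_mul, ← mul_assoc, hcc]
    have : (u - t) * (n + 1) * ((i : ℝ) + 1) ≤ (u - t) * (n + 1) * j := by gcongr
    nlinarith
  have := crossing_mul hz ht (v' := 1) (u := u) (by simpa using hu)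
  rwa [crossing_one, mul_one, mul_one] at this

theorem crossing_left {s t u : ℝ} (hst : s < t) (htu : t < u) (v : Perm (Fin n)) :
    crossing t u v = crossing s u v := by
  have h0 : 0 < t - s := by linarith
  have h1 : 0 < u - t := by linarith
  set c : ℝ := (t - s) / (u - t) * (n + 1) with hc
  have hc0 : 0 < c := by positivity
  obtain ⟨z, hz, hu, H⟩ := exists_config (hst.trans htu) v (strictMono_cast_mul hc0)
    (strictMono_cast_mul one_pos)
  have ht : z ∈ sorted n t := by
    have := H v⁻¹ t ?_
    · simpa using this
    intro i j hij
    have hij' : (i : ℝ) + 1 ≤ j := by exact_mod_cast hij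
    have hi : (((v⁻¹ : Perm (Fin n)) i : ℕ) : ℝ) < n := by
      exact_mod_cast ((v⁻¹ : Perm (Fin n)) i).2
    have hj : (0 : ℝ) ≤ (((v⁻¹ : Perm (Fin n)) j : ℕ) : ℝ) := by positivity
    have hcc : (u - t) * c = (t - s) * (n + 1) := by rw [hc]; field_simp
    simp only [one_mul, ← mul_assoc, hcc]
    rw [(show ∀ k, v (v⁻¹ k) = k from fun k => by simp), (show ∀ k, v (v⁻¹ k) = k from fun k => by simp)]
    have : (t - s) * (n + 1) * ((i : ℝ) + 1) ≤ (t - s) * (n + 1) * j := by gcongr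
    nlinarith
  have := crossing_mul hz (v := 1) (v' := v) (t := t) (u := u) (by simpa using ht)
    (by simpa using hu)
  rwa [crossing_one, one_mul, one_mul] at this

theorem crossing_eq {s t s' t' : ℝ} (hst : s < t) (hst' : s' < t') (v : Perm (Fin n)) :
    crossing s t v = crossing s' t' v := by
  have h1 : t < max t t' + 1 := by linarith [le_max_left t t']
  have h2 : t' < max t t' + 1 := by linarith [le_max_right t t']
  have h3 : min s s' - 1 < s := by linarith [min_le_left s s']
  have h4 : min s s' - 1 < s' := by linarith [min_le_right s s']
  rw [crossing_right hst h1, crossing_right hst' h2, crossing_left h3 (hst.trans h1),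
    crossing_left h4 (hst'.trans h2)]

/-- The positive lift of permutations to the fundamental group of the space of configurations. -/
def lift (v : Perm (Fin n)) : FundamentalGroup (Conf n) (stdConf n) := crossing 0 1 v

theorem crossLoop_eq_lift {s t : ℝ} (hst : s < t) {z : Fin n → ℂ} {v : Perm (Fin n)}
    (hz : z ∈ sorted n s) (hv : z ∘ v ∈ sorted n t) :
    crossLoop (mem_chart hz) (mem_chart_comp hv) = lift v := by
  rw [crossLoop_eq_crossing hz hv, crossing_eq hst zero_lt_one, lift]

theorem posLift_lift : PosLift (lift (n := n)) where
  one := crossing_one _ _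
  mul := by
    intro w i hi hlt
    have hb : StrictMono fun k : Fin n =>
        if (k : ℕ) = i + 1 then 2 * (n : ℝ) * i + 1 / 2 else 2 * (n : ℝ) * (k : ℝ) := by
      intro a b hab
      have hn : (1 : ℝ) ≤ n := by exact_mod_cast (by omega : 1 ≤ n)
      have hab' : (a : ℝ) + 1 ≤ b := by exact_mod_cast hab
      have h1 : (n : ℝ) * ((a : ℝ) + 1) ≤ n * b := by gcongr
      simp only
      split_ifs with ha hb hb
      · have := Fin.lt_def.1 hab; omega
      · have : (a : ℝ) = i + 1 := by exact_mod_cast ha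
        rw [this] at h1
        nlinarith
      · have : (b : ℝ) = i + 1 := by exact_mod_cast hb
        have h2 : (n : ℝ) * a ≤ n * i := by rw [this] at hab'; exact mul_le_mul_of_nonneg_left (by linarith) (by linarith)
        nlinarith
      · nlinarith
    obtain ⟨z, hz, hu, H⟩ := exists_config (zero_lt_two' ℝ) w (strictMono_cast_mul one_pos) hb
    have h1 : z ∘ ⇑(w * sw i hi) ∈ sorted n 1 := by
      refine H _ _ ?_
      intro a b hab
      have hn : (1 : ℝ) ≤ n := by exact_mod_cast (by omega : 1 ≤ n)
      have hab' : (a : ℝ) + 1 ≤ b := by exact_mod_cast hab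
      have h1 : (n : ℝ) * ((a : ℝ) + 1) ≤ n * b := by gcongr
      have hwa : ∀ k : Fin n, ((k : ℕ) : ℝ) ≤ n - 1 := by
        intro k
        have : ((k : ℕ) : ℝ) + 1 ≤ n := by exact_mod_cast k.2
        linarith
      have hw1 := hwa (w (sw i hi a))
      have hw2 := hwa (w (sw i hi b))
      have hw3 : (0 : ℝ) ≤ ((w (sw i hi a) : ℕ) : ℝ) := by positivity
      have hw4 : (0 : ℝ) ≤ ((w (sw i hi b) : ℕ) : ℝ) := by positivity
      have hc : ∀ k : Fin n, (if ((sw i hi k : Fin n) : ℕ) = i + 1 then 2 * (n : ℝ) * i + 1 / 2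
          else 2 * (n : ℝ) * ((sw i hi k : Fin n) : ℝ)) = if (k : ℕ) = i then 2 * (n : ℝ) * i + 1 / 2
            else if (k : ℕ) = i + 1 then 2 * (n : ℝ) * i else 2 * (n : ℝ) * (k : ℝ) := by
        intro k
        have := sw_val i hi k
        rw [this]
        split_ifs <;> first | rfl | omega
      simp only [hc]
      by_cases hai : (a : ℕ) = i
      · by_cases hbi : (b : ℕ) = i + 1
        · have ha' : a = ⟨i, by omega⟩ := Fin.ext hai
          have hb' : b = ⟨i + 1, hi⟩ := Fin.ext hbi
          simp only [if_pos hai, if_pos hbi, if_neg (show ¬ (b : ℕ) = i by omega)]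
          rw [ha', hb', sw_left, sw_right]
          have : ((w ⟨i + 1, hi⟩ : ℕ) : ℝ) + 1 ≤ ((w ⟨i, by omega⟩ : ℕ) : ℝ) := by
            exact_mod_cast hlt
          linarith
        · have hb2 : (b : ℕ) ≠ i := by have := Fin.lt_def.1 hab; omega
          have : (i : ℝ) + 2 ≤ b := by
            have : i + 2 ≤ (b : ℕ) := by have := Fin.lt_def.1 hab; omega
            exact_mod_cast this
          have h2 : (n : ℝ) * ((i : ℝ) + 2) ≤ n * b := by gcongr
          simp only [if_pos hai, if_neg hbi, if_neg hb2]
          nlinarith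
      · by_cases hai2 : (a : ℕ) = i + 1
        · have hb2 : (b : ℕ) ≠ i := by have := Fin.lt_def.1 hab; omega
          have hb3 : (b : ℕ) ≠ i + 1 := by have := Fin.lt_def.1 hab; omega
          simp only [if_neg hai, if_pos hai2, if_neg hb2, if_neg hb3]
          have : (a : ℝ) = i + 1 := by exact_mod_cast hai2
          rw [this] at h1
          nlinarith
        · simp only [if_neg hai, if_neg hai2]
          split_ifs with hb1 hb2
          · have : (b : ℝ) = i := by exact_mod_cast hb1
            rw [this] at h1
            nlinarith
          · have : (a : ℝ) + 1 ≤ i := by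
              have : (a : ℕ) + 1 ≤ i := by have := Fin.lt_def.1 hab; omega
              exact_mod_cast this
            have h2 : (n : ℝ) * ((a : ℝ) + 1) ≤ n * i := by gcongr
            nlinarith
          · nlinarith
    have h2 : z ∘ ⇑(w * sw i hi * sw i hi) ∈ sorted n 2 := by rwa [mul_sw_cancel]
    have := crossing_mul hz h1 h2
    rw [mul_sw_cancel, crossing_eq zero_lt_two zero_lt_one,
      crossing_eq one_lt_two (zero_lt_one' ℝ)] at this
    exact this.symm

theorem closure_lift_sw (n : ℕ) :
    Subgroup.closure {g | ∃ i, ∃ hi : i + 1 < n, g = lift (sw i hi)} = ⊤ := by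
  refine SCSet.closure_loops_eq_top (chart n) isOpen_chart exists_mem_chart stdConf_mem _ ?_
  have key : ∀ s t, s < t → ∀ u (hs : u ∈ (chart n s).carrier) (ht : u ∈ (chart n t).carrier),
      crossLoop hs ht ∈ Subgroup.closure {g | ∃ i, ∃ hi : i + 1 < n, g = lift (sw i hi)} := by
    intro s t hst u hs ht
    obtain ⟨z, v, hz, hv, rfl⟩ := exists_crossing hs ht
    rw [crossLoop_eq_lift hst hz hv]
    exact posLift_lift.mem_closure v
  intro i j x hi hj
  rcases lt_trichotomy i j with h | rfl | h
  · have h1 := SCSet.loop_mul (chart n i) (chart n j) (chart n i) (stdConf_mem i) (stdConf_mem j)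
      (stdConf_mem i) hi hj hi
    rw [SCSet.loop_same] at h1
    rw [← inv_eq_of_mul_eq_one_right h1]
    exact Subgroup.inv_mem _ (key i j h x hi hj)
  · rw [SCSet.loop_same]
    exact Subgroup.one_mem _
  · exact key j i h x hj hi

end Affine
end SphBraid

namespace SphBraid
open Topology Filter Set Equiv

section Forms

/-- The univariate polynomial with prescribed coefficients. -/
def polyOf {d : ℕ} (v : Fin (d + 1) → ℂ) : ℂ[X] := ∑ i, C (v i) * X ^ (i : ℕ)

theorem binForm_eq_homogenize {d : ℕ} (v : Fin (d + 1) → ℂ) :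
    binForm d v = (polyOf v).homogenize d := by
  rw [polyOf, homogenize_finsetSum, binForm]
  refine Finset.sum_congr rfl fun i _ => ?_
  rw [homogenize_C_mul, homogenize_X_pow (by omega), mul_assoc]

theorem polyOf_smul {d : ℕ} (c : ℂ) (v : Fin (d + 1) → ℂ) : polyOf (c • v) = C c * polyOf v := by
  simp [polyOf, Finset.mul_sum, mul_assoc]

theorem squarefree_binForm_smul {d : ℕ} {c : ℂ} (hc : c ≠ 0) (v : Fin (d + 1) → ℂ) :
    Squarefree (binForm d (c • v)) ↔ Squarefree (binForm d v) := by
  rw [binForm_eq_homogenize, polyOf_smul, homogenize_C_mul, ← binForm_eq_homogenize]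
  have hu : IsUnit (MvPolynomial.C c : MvPolynomial (Fin 2) ℂ) :=
    (IsUnit.mk0 c hc).map MvPolynomial.C
  exact (associated_unit_mul_left _ _ hu).squarefree_iff

/-- The linear form vanishing at the point `[a : 1]`. -/
def linForm (a : ℂ) : MvPolynomial (Fin 2) ℂ :=
  MvPolynomial.X 0 - MvPolynomial.C a * MvPolynomial.X 1

theorem eval_linForm (a x : ℂ) : MvPolynomial.eval ![x, 1] (linForm a) = x - a := by
  simp [linForm]

theorem irreducible_linForm (a : ℂ) : Irreducible (linForm a) := by
  have h := MvPolynomial.irreducible_mul_X_add (R := ℂ) (n := Fin 2) 1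
    (-(MvPolynomial.C a * MvPolynomial.X 1)) 0 one_ne_zero ?_ ?_ ?_
  · convert h using 1
    rw [linForm]; ring
  · simp [MvPolynomial.vars_one]
  · intro h
    rw [MvPolynomial.vars_neg] at h
    have := MvPolynomial.vars_mul _ _ h
    simp [MvPolynomial.vars_C, MvPolynomial.vars_X] at this
  · exact isRelPrime_one_left

theorem irreducible_X_one : Irreducible (MvPolynomial.X 1 : MvPolynomial (Fin 2) ℂ) := by
  have h := MvPolynomial.irreducible_mul_X_add (R := ℂ) (n := Fin 2) 1 0 1 one_ne_zero ?_ ?_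
    isRelPrime_one_left
  · simpa using h
  · simp [MvPolynomial.vars_one]
  · simp

theorem isRelPrime_linForm {a b : ℂ} (h : a ≠ b) : IsRelPrime (linForm a) (linForm b) := by
  rw [(irreducible_linForm a).isRelPrime_iff_not_dvd]
  rintro ⟨q, hq⟩
  have := congrArg (MvPolynomial.eval ![a, 1]) hq
  rw [map_mul, eval_linForm, eval_linForm, sub_self, zero_mul] at this
  exact h (sub_eq_zero.1 this)

theorem isRelPrime_linForm_X (a : ℂ) : IsRelPrime (linForm a) (MvPolynomial.X 1) := by
  rw [(irreducible_linForm a).isRelPrime_iff_not_dvd]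
  rintro ⟨q, hq⟩
  have := congrArg (MvPolynomial.eval ![a, 1]) hq
  rw [map_mul, eval_linForm, sub_self, zero_mul] at this
  simp at this

theorem squarefree_prod_linForm {n : ℕ} (z : Fin n → ℂ) :
    Squarefree (∏ k, linForm (z k)) ↔ Function.Injective z := by
  constructor
  · intro h a b hab
    by_contra hne
    have h1 : linForm (z a) * linForm (z a) ∣ ∏ k, linForm (z k) := by
      have : ∏ k ∈ {a, b}, linForm (z k) ∣ ∏ k, linForm (z k) :=
        Finset.prod_dvd_prod_of_subset _ _ _ (Finset.subset_univ _)
      rwa [Finset.prod_pair hne, ← hab] at this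
    exact (irreducible_linForm _).not_isUnit (h _ h1)
  · intro h
    suffices H : ∀ s : Finset (Fin n), Squarefree (∏ k ∈ s, linForm (z k)) from H _
    intro s
    induction s using Finset.induction_on with
    | empty => simp
    | insert a s ha ih =>
      rw [Finset.prod_insert ha, squarefree_mul_iff]
      refine ⟨IsRelPrime.prod_right fun i hi => isRelPrime_linForm fun h' => ?_,
        (irreducible_linForm _).squarefree, ih⟩
      exact ha (h h' ▸ hi)

theorem homogenize_rootPoly {n : ℕ} (z : Fin n → ℂ) :
    (rootPoly z).homogenize n = ∏ k, linForm (z k) := by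
  have := homogenize_finsetProd (s := Finset.univ) (p := fun k => X - C (z k)) (n := fun _ : Fin n => 1)
    fun i _ => (natDegree_X_sub_C _).le
  simp only [Finset.sum_const, Finset.card_univ, Fintype.card_fin, smul_eq_mul, mul_one] at this
  rw [rootPoly, this]
  refine Finset.prod_congr rfl fun k _ => ?_
  rw [homogenize_sub, homogenize_X one_ne_zero, homogenize_C, linForm]
  simp

theorem polyOf_snoc_one {n : ℕ} (z : Fin n → ℂ) :
    polyOf (Fin.snoc (vieta z) 1 : Fin (n + 1) → ℂ) = rootPoly z := by
  rw [polyOf, Fin.sum_univ_castSucc, rootPoly_eq]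
  simp [add_comm]

theorem squarefree_snoc_one {n : ℕ} (u : Fin n → ℂ) :
    Squarefree (binForm n (Fin.snoc u 1)) ↔ ∃ z, Function.Injective z ∧ vieta z = u := by
  obtain ⟨z, rfl⟩ := vieta_surjective u
  rw [binForm_eq_homogenize, polyOf_snoc_one, homogenize_rootPoly, squarefree_prod_linForm]
  exact ⟨fun h => ⟨z, h, rfl⟩, fun ⟨z', h, h'⟩ => injective_of_vieta_eq h h'.symm⟩

theorem polyOf_snoc_zero {n : ℕ} (v : Fin (n + 1) → ℂ) :
    polyOf (Fin.snoc v 0 : Fin (n + 1 + 1) → ℂ) = polyOf v := by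
  rw [polyOf, Fin.sum_univ_castSucc, polyOf]
  simp

theorem natDegree_polyOf_le {n : ℕ} (v : Fin (n + 1) → ℂ) : (polyOf v).natDegree ≤ n := by
  refine natDegree_sum_le_of_forall_le _ _ fun i _ => ?_
  exact (natDegree_C_mul_X_pow_le _ _).trans (by omega)

theorem binForm_snoc_zero {n : ℕ} (v : Fin (n + 1) → ℂ) :
    binForm (n + 1) (Fin.snoc v 0) = binForm n v * MvPolynomial.X 1 := by
  rw [binForm_eq_homogenize, polyOf_snoc_zero, binForm_eq_homogenize, ← mul_one (polyOf v),
    homogenize_mul _ _ (natDegree_polyOf_le v) (by simp), homogenize_one, pow_one, mul_one]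

theorem squarefree_snoc_snoc_one_zero {m : ℕ} (w : Fin m → ℂ) :
    Squarefree (binForm (m + 1) (Fin.snoc (Fin.snoc w 1 : Fin (m + 1) → ℂ) 0)) ↔
      ∃ z, Function.Injective z ∧ vieta z = w := by
  rw [binForm_snoc_zero, squarefree_mul_iff, squarefree_snoc_one]
  refine ⟨fun h => h.2.1, fun h => ⟨?_, h, irreducible_X_one.squarefree⟩⟩
  obtain ⟨z, -, rfl⟩ := h
  rw [binForm_eq_homogenize, polyOf_snoc_one, homogenize_rootPoly]
  exact IsRelPrime.prod_left fun i _ => isRelPrime_linForm_X _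

theorem not_squarefree_snoc_snoc_zero {m : ℕ} (v : Fin (m + 1) → ℂ) :
    ¬ Squarefree (binForm (m + 2) (Fin.snoc (Fin.snoc v 0 : Fin (m + 2) → ℂ) 0)) := by
  intro h
  rw [binForm_snoc_zero, binForm_snoc_zero, mul_assoc] at h
  exact irreducible_X_one.not_isUnit (h _ (dvd_mul_left _ _))

theorem binForm_zero (d : ℕ) : binForm d 0 = 0 := by simp [binForm]

theorem ne_zero_of_squarefree {d : ℕ} {v : Fin (d + 1) → ℂ} (h : Squarefree (binForm d v)) :
    v ≠ 0 := by
  rintro rfl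
  rw [binForm_zero] at h
  exact not_squarefree_zero h

end Forms
end SphBraid

namespace SphBraid
open Topology Filter Set Equiv

section Proj
variable {d : ℕ}

instance : Nonempty (WSph d) := by
  have h := (squarefree_snoc_one (vieta (stdTuple d))).2 ⟨_, stdTuple_injective, rfl⟩
  refine ⟨⟨Projectivization.mk ℂ _ (ne_zero_of_squarefree h), ?_⟩⟩
  obtain ⟨a, ha⟩ := Projectivization.exists_smul_eq_mk_rep ℂ _ (ne_zero_of_squarefree h)
  rw [← ha, Units.smul_def, squarefree_binForm_smul a.ne_zero]
  exact h

open Classical in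
/-- The point of `WSph d` defined by a coefficient vector (arbitrary if the form is not
squarefree). -/
def toW (v : Fin (d + 1) → ℂ) : WSph d :=
  if h : Squarefree (binForm d v) then
    ⟨Projectivization.mk ℂ v (ne_zero_of_squarefree h), by
      obtain ⟨a, ha⟩ := Projectivization.exists_smul_eq_mk_rep ℂ v (ne_zero_of_squarefree h)
      rw [← ha, Units.smul_def, squarefree_binForm_smul a.ne_zero]
      exact h⟩
  else Classical.choice inferInstance

/-- A coefficient vector of a point of `WSph d`. -/
def vec (p : WSph d) : Fin (d + 1) → ℂ := p.1.rep

theorem squarefree_vec (p : WSph d) : Squarefree (binForm d (vec p)) := p.2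

theorem toW_val {v : Fin (d + 1) → ℂ} (h : Squarefree (binForm d v)) :
    (toW v).1 = Projectivization.mk ℂ v (ne_zero_of_squarefree h) :=
  congrArg Subtype.val (dif_pos h)

theorem toW_vec (p : WSph d) : toW (vec p) = p := by
  refine Subtype.ext ((toW_val (squarefree_vec p)).trans ?_)
  exact p.1.mk_rep

theorem exists_vec_toW {v : Fin (d + 1) → ℂ} (h : Squarefree (binForm d v)) :
    ∃ c : ℂ, c ≠ 0 ∧ vec (toW v) = c • v := by
  obtain ⟨a, ha⟩ := Projectivization.exists_smul_eq_mk_rep ℂ v (ne_zero_of_squarefree h)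
  refine ⟨a, a.ne_zero, ?_⟩
  rw [vec, toW_val h, ← ha, Units.smul_def]

theorem toW_smul {c : ℂ} (hc : c ≠ 0) (v : Fin (d + 1) → ℂ) : toW (c • v) = toW v := by
  by_cases h : Squarefree (binForm d v)
  · have h' := (squarefree_binForm_smul hc v).2 h
    refine Subtype.ext ?_
    rw [toW_val h, toW_val h', Projectivization.mk_eq_mk_iff']
    exact ⟨c, rfl⟩
  · have h' := mt (squarefree_binForm_smul hc v).1 h
    have key : ∀ {u : Fin (d + 1) → ℂ}, ¬ Squarefree (binForm d u) →
        toW u = Classical.choice inferInstance := fun hu => dif_neg hu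
    rw [key h, key h']

theorem isOpen_setOf_vec {S : Set (Fin (d + 1) → ℂ)} (hS : IsOpen S)
    (hinv : ∀ c : ℂ, c ≠ 0 → ∀ v ∈ S, c • v ∈ S) : IsOpen {p : WSph d | vec p ∈ S} := by
  have : IsOpen {p : Projectivization ℂ (Fin (d + 1) → ℂ) | p.rep ∈ S} := by
    have h1 : IsQuotientMap (Projectivization.mk' ℂ : {v : Fin (d + 1) → ℂ // v ≠ 0} → _) :=
      isQuotientMap_quot_mk
    rw [← h1.isOpen_preimage]
    convert hS.preimage continuous_subtype_val using 1
    ext v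
    obtain ⟨a, ha⟩ := Projectivization.exists_smul_eq_mk_rep ℂ v.1 v.2
    change (Projectivization.mk ℂ v.1 v.2).rep ∈ S ↔ v.1 ∈ S
    rw [← ha, Units.smul_def]
    refine ⟨fun h => ?_, fun h => hinv _ a.ne_zero _ h⟩
    have := hinv _ (inv_ne_zero a.ne_zero) _ h
    rwa [smul_smul, inv_mul_cancel₀ a.ne_zero, one_smul] at this
  exact this.preimage continuous_subtype_val

theorem continuousOn_toW : ContinuousOn toW {v : Fin (d + 1) → ℂ | Squarefree (binForm d v)} := by
  rw [continuousOn_iff_continuous_domRestrict]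
  refine Topology.IsInducing.subtypeVal.continuous_iff.2 ?_
  have h : Continuous fun v : {v : Fin (d + 1) → ℂ | Squarefree (binForm d v)} =>
      (⟨v.1, ne_zero_of_squarefree v.2⟩ : {v : Fin (d + 1) → ℂ // v ≠ 0}) := by fun_prop
  refine ((continuous_quot_mk).comp h).congr fun v => ?_
  exact (toW_val v.2).symm

section Chart
variable {E : Type*} {k : Fin (d + 1)} {e : E → Fin (d + 1) → ℂ}
  {c : (Fin (d + 1) → ℂ) → E}

theorem coord_smul (hce : ∀ q, c (e q) = q) (hec : ∀ v, v k ≠ 0 → e (c v) = (v k)⁻¹ • v) {a : ℂ}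
    (ha : a ≠ 0) {v : Fin (d + 1) → ℂ} (hv : v k ≠ 0) : c (a • v) = c v := by
  have h1 := hec (a • v) (mul_ne_zero ha hv)
  rw [Pi.smul_apply, smul_smul, smul_eq_mul, mul_inv, mul_right_comm, inv_mul_cancel₀ ha, one_mul,
    ← hec v hv] at h1
  rw [← hce (c v), ← h1, hce]

theorem isOpen_image_toW [TopologicalSpace E] (hc : ContinuousOn c {v | v k ≠ 0}) (hce : ∀ q, c (e q) = q)
    (hk : ∀ q, e q k = 1) (hec : ∀ v, v k ≠ 0 → e (c v) = (v k)⁻¹ • v) {O : Set E} (hO : IsOpen O)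
    (hsq : ∀ q ∈ O, Squarefree (binForm d (e q))) : IsOpen ((fun q => toW (e q)) '' O) := by
  have hopen : IsOpen {v : Fin (d + 1) → ℂ | v k ≠ 0} :=
    isOpen_ne_fun (continuous_apply k) continuous_const
  have := isOpen_setOf_vec (hc.isOpen_inter_preimage hopen hO) (fun a ha v hv =>
    ⟨mul_ne_zero ha hv.1, by rw [mem_preimage, coord_smul hce hec ha hv.1]; exact hv.2⟩)
  convert this using 1
  ext p
  constructor
  · rintro ⟨q, hq, rfl⟩
    obtain ⟨a, ha, h⟩ := exists_vec_toW (hsq q hq)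
    have h1 : e q k ≠ 0 := by rw [hk]; exact one_ne_zero
    simp only [Set.mem_ofPred_eq, h]
    refine ⟨mul_ne_zero ha h1, ?_⟩
    rw [mem_preimage, coord_smul hce hec ha h1, hce]
    exact hq
  · rintro ⟨h1, h2⟩
    refine ⟨_, h2, ?_⟩
    simp only
    rw [hec _ h1, toW_smul (inv_ne_zero h1), toW_vec]

theorem coord_vec_toW (hce : ∀ q, c (e q) = q)
    (hk : ∀ q, e q k = 1) (hec : ∀ v, v k ≠ 0 → e (c v) = (v k)⁻¹ • v) {q : E}
    (hsq : Squarefree (binForm d (e q))) : c (vec (toW (e q))) = q := by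
  obtain ⟨a, ha, h⟩ := exists_vec_toW hsq
  rw [h, coord_smul hce hec ha (by rw [hk]; exact one_ne_zero), hce]

end Chart

theorem continuous_snoc {n : ℕ} {Z : Type*} [TopologicalSpace Z] {f : Z → Fin n → ℂ} {g : Z → ℂ}
    (hf : Continuous f) (hg : Continuous g) :
    Continuous fun z => (Fin.snoc (f z) (g z) : Fin (n + 1) → ℂ) := by
  refine continuous_pi fun i => ?_
  refine Fin.lastCases ?_ (fun i => ?_) i
  · simpa using hg
  · have := (continuous_apply i).comp hf
    simpa [Function.comp_def] using this

/-- The affine part of `WSph d`. -/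
def aff (u : Conf d) : WSph d := toW (Fin.snoc u.1 1)

theorem continuous_aff : Continuous (aff : Conf d → WSph d) :=
  continuousOn_toW.comp_continuous (continuous_snoc continuous_subtype_val continuous_const)
    fun u => (squarefree_snoc_one u.1).2 u.2

/-- The affine coordinates of a coefficient vector. -/
def affCoord (v : Fin (d + 1) → ℂ) : Fin d → ℂ := (v (Fin.last d))⁻¹ • Fin.init v

theorem affCoord_snoc (u : Fin d → ℂ) : affCoord (Fin.snoc u 1) = u := by
  simp [affCoord]

theorem snoc_affCoord (v : Fin (d + 1) → ℂ) (h : v (Fin.last d) ≠ 0) :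
    (Fin.snoc (affCoord v) 1 : Fin (d + 1) → ℂ) = (v (Fin.last d))⁻¹ • v := by
  funext i
  refine Fin.lastCases ?_ (fun i => ?_) i
  · simp [h]
  · simp [affCoord, Fin.init]

theorem continuousOn_affCoord :
    ContinuousOn affCoord {v : Fin (d + 1) → ℂ | v (Fin.last d) ≠ 0} := by
  refine ContinuousOn.smul (ContinuousOn.inv₀ (by fun_prop) fun v hv => hv) ?_
  unfold Fin.init
  fun_prop

theorem isOpenMap_aff : IsOpenMap (aff : Conf d → WSph d) := by
  intro O hO
  have := isOpen_image_toW continuousOn_affCoord affCoord_snoc (k := Fin.last d) (by simp)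
    snoc_affCoord (isOpen_conf.isOpenMap_subtype_val O hO) (by
      rintro _ ⟨u, -, rfl⟩
      exact (squarefree_snoc_one u.1).2 u.2)
  rwa [image_image] at this

theorem injective_aff : Function.Injective (aff : Conf d → WSph d) := by
  intro u u' h
  have key : ∀ u : Conf d, affCoord (vec (aff u)) = u.1 := fun u =>
    coord_vec_toW affCoord_snoc (k := Fin.last d) (by simp) snoc_affCoord
      ((squarefree_snoc_one u.1).2 u.2)
  exact Subtype.ext (by rw [← key u, ← key u', h])

theorem isOpenEmbedding_aff : IsOpenEmbedding (aff : Conf d → WSph d) :=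
  .of_continuous_injective_isOpenMap continuous_aff injective_aff isOpenMap_aff

theorem mem_range_aff {p : WSph d} (h : vec p (Fin.last d) ≠ 0) : p ∈ range aff := by
  have h1 : toW (Fin.snoc (affCoord (vec p)) 1) = p := by
    rw [snoc_affCoord _ h, toW_smul (inv_ne_zero h), toW_vec]
  have h2 : Squarefree (binForm d (Fin.snoc (affCoord (vec p)) 1)) := by
    rw [snoc_affCoord _ h, squarefree_binForm_smul (inv_ne_zero h)]
    exact squarefree_vec p
  exact ⟨⟨_, (squarefree_snoc_one _).1 h2⟩, h1⟩

theorem vec_aff_ne_zero (u : Conf d) : vec (aff u) (Fin.last d) ≠ 0 := by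
  obtain ⟨a, ha, h⟩ := exists_vec_toW ((squarefree_snoc_one u.1).2 u.2)
  rw [aff, h]
  simpa using ha

end Proj

section Infinity
variable {n : ℕ}

/-- Coefficient vectors near the hyperplane at infinity. -/
def hvec (q : (Fin n → ℂ) × ℂ) : Fin (n + 1 + 1) → ℂ :=
  Fin.snoc (Fin.snoc q.1 1 : Fin (n + 1) → ℂ) q.2

/-- The coordinates of a coefficient vector near the hyperplane at infinity. -/
def hcoord (v : Fin (n + 1 + 1) → ℂ) : (Fin n → ℂ) × ℂ :=
  (v (Fin.last n).castSucc)⁻¹ • (Fin.init (Fin.init v : Fin (n + 1) → ℂ), v (Fin.last (n + 1)))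

theorem continuous_hvec : Continuous (hvec : (Fin n → ℂ) × ℂ → _) :=
  continuous_snoc (continuous_snoc continuous_fst continuous_const) continuous_snd

theorem hvec_apply (q : (Fin n → ℂ) × ℂ) : hvec q (Fin.last n).castSucc = 1 := by simp [hvec]

theorem hcoord_hvec (q : (Fin n → ℂ) × ℂ) : hcoord (hvec q) = q := by
  rw [hcoord, hvec_apply, inv_one, one_smul]
  simp [hvec]

theorem hvec_hcoord (v : Fin (n + 1 + 1) → ℂ) (h : v (Fin.last n).castSucc ≠ 0) :
    hvec (hcoord v) = (v (Fin.last n).castSucc)⁻¹ • v := by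
  funext i
  refine Fin.lastCases ?_ (fun i => Fin.lastCases ?_ (fun i => ?_) i) i
  · simp [hvec, hcoord]
  · simp [hvec, h]
  · simp [hvec, hcoord, Fin.init]

theorem continuousOn_hcoord :
    ContinuousOn hcoord {v : Fin (n + 1 + 1) → ℂ | v (Fin.last n).castSucc ≠ 0} := by
  refine ContinuousOn.smul (ContinuousOn.inv₀ (by fun_prop) fun v hv => hv) ?_
  unfold Fin.init
  fun_prop

/-- The map from coordinates near infinity to `WSph (n + 1)`. -/
def inf (q : (Fin n → ℂ) × ℂ) : WSph (n + 1) := toW (hvec q)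

theorem isOpen_image_inf {O : Set ((Fin n → ℂ) × ℂ)} (hO : IsOpen O)
    (hsq : ∀ q ∈ O, Squarefree (binForm (n + 1) (hvec q))) : IsOpen (inf '' O) :=
  isOpen_image_toW continuousOn_hcoord hcoord_hvec hvec_apply hvec_hcoord hO hsq

theorem hcoord_vec_inf {q : (Fin n → ℂ) × ℂ} (h : Squarefree (binForm (n + 1) (hvec q))) :
    hcoord (vec (inf q)) = q := coord_vec_toW hcoord_hvec hvec_apply hvec_hcoord h

theorem continuousOn_inf {O : Set ((Fin n → ℂ) × ℂ)}
    (hsq : ∀ q ∈ O, Squarefree (binForm (n + 1) (hvec q))) : ContinuousOn inf O :=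
  continuousOn_toW.comp continuous_hvec.continuousOn hsq

theorem continuousOn_hcoord_vec {O : Set ((Fin n → ℂ) × ℂ)} (hO : IsOpen O)
    (hsq : ∀ q ∈ O, Squarefree (binForm (n + 1) (hvec q))) :
    ContinuousOn (fun p : WSph (n + 1) => hcoord (vec p)) (inf '' O) := by
  rw [continuousOn_iff']
  intro t ht
  refine ⟨inf '' (t ∩ O), isOpen_image_inf (ht.inter hO) fun q hq => hsq q hq.2, ?_⟩
  ext p
  constructor
  · rintro ⟨h1, q, hq, rfl⟩
    rw [mem_preimage, hcoord_vec_inf (hsq q hq)] at h1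
    exact ⟨⟨q, ⟨h1, hq⟩, rfl⟩, q, hq, rfl⟩
  · rintro ⟨⟨q, hq, rfl⟩, h2⟩
    refine ⟨?_, h2⟩
    rw [mem_preimage, hcoord_vec_inf (hsq q hq.2)]
    exact hq.1

theorem injective_iff_eval_ne_zero {z : Fin n → ℂ} : Function.Injective z ↔
    ∀ x, (rootPoly z).eval x ≠ 0 ∨ (derivative (rootPoly z)).eval x ≠ 0 := by
  rw [← separable_prod_X_sub_C_iff, Separable,
    isCoprime_iff_aeval_ne_zero_of_isAlgClosed ℂ ℂ]
  simp only [coe_aeval_eq_eval]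
  rfl

theorem polyOf_hvec_zero (z : Fin n → ℂ) : polyOf (hvec (vieta z, 0)) = rootPoly z := by
  rw [hvec, polyOf_snoc_zero, polyOf_snoc_one]

theorem hvec_eq_smul (w : Fin n → ℂ) {s : ℂ} (hs : s ≠ 0) :
    hvec (w, s) = s • (Fin.snoc (s⁻¹ • Fin.snoc w 1 : Fin (n + 1) → ℂ) 1 : Fin (n + 1 + 1) → ℂ) := by
  funext i
  refine Fin.lastCases ?_ (fun i => ?_) i
  · simp [hvec]
  · simp [hvec, hs]

theorem squarefree_hvec {q : (Fin n → ℂ) × ℂ} (h : ∀ x, (polyOf (hvec q)).eval x ≠ 0 ∨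
    (derivative (polyOf (hvec q))).eval x ≠ 0) : Squarefree (binForm (n + 1) (hvec q)) := by
  obtain ⟨w, s⟩ := q
  by_cases hs : s = 0
  · subst hs
    obtain ⟨z, rfl⟩ := vieta_surjective w
    rw [polyOf_hvec_zero, ← injective_iff_eval_ne_zero] at h
    exact (squarefree_snoc_snoc_one_zero _).2 ⟨z, h, rfl⟩
  · obtain ⟨z, hz⟩ := vieta_surjective (s⁻¹ • Fin.snoc w 1 : Fin (n + 1) → ℂ)
    rw [hvec_eq_smul w hs, ← hz] at h ⊢
    rw [squarefree_binForm_smul hs, squarefree_snoc_one]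
    refine ⟨z, injective_iff_eval_ne_zero.2 fun x => ?_, rfl⟩
    have := h x
    rw [polyOf_smul, polyOf_snoc_one, derivative_C_mul, eval_C_mul, eval_C_mul] at this
    simpa [hs] using this

theorem norm_le_of_double_root {w : Fin n → ℂ} {s x : ℂ} (h : (polyOf (hvec (w, s))).eval x = 0)
    (h' : (derivative (polyOf (hvec (w, s)))).eval x = 0) : ‖x‖ ≤ (n + 1) * ‖w‖ + 1 := by
  set c : Fin n → ℂ := fun i => ((n : ℂ) + 1 - (i : ℕ)) * w i with hc
  have key : x ^ n + ∑ i : Fin n, c i * x ^ (i : ℕ) = 0 := by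
    have h1 : ∀ i : ℕ, x * ((i : ℂ) * x ^ (i - 1)) = i * x ^ i := by
      intro i
      cases i with
      | zero => simp
      | succ i => simp [pow_succ]; ring
    have e1 : x * (derivative (polyOf (hvec (w, s)))).eval x =
        ∑ i : Fin (n + 1 + 1), (i : ℂ) * (hvec (w, s) i * x ^ (i : ℕ)) := by
      rw [polyOf, derivative_sum, eval_finsetSum, Finset.mul_sum]
      refine Finset.sum_congr rfl fun i _ => ?_
      rw [derivative_C_mul_X_pow, eval_mul, eval_C, eval_pow, eval_X]
      linear_combination hvec (w, s) i * h1 i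
    have e2 : (polyOf (hvec (w, s))).eval x =
        ∑ i : Fin (n + 1 + 1), hvec (w, s) i * x ^ (i : ℕ) := by
      rw [polyOf, eval_finsetSum]
      simp
    rw [h', mul_zero] at e1
    rw [h] at e2
    have e3 : ∑ i : Fin (n + 1 + 1), ((n : ℂ) + 1 - (i : ℕ)) * (hvec (w, s) i * x ^ (i : ℕ)) = 0 := by
      simp only [sub_mul, Finset.sum_sub_distrib, ← Finset.mul_sum]
      rw [← e2, ← e1]; simp
    rw [Fin.sum_univ_castSucc, Fin.sum_univ_castSucc] at e3
    simp only [hvec, Fin.snoc_castSucc, Fin.snoc_last, Fin.val_castSucc, Fin.val_last] at e3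
    push_cast at e3
    simp only [hc, mul_assoc]
    linear_combination e3
  obtain ⟨z, hz⟩ := vieta_surjective c
  have h2 : (rootPoly z).eval x = 0 := by
    rw [rootPoly_eq, hz, eval_add, eval_finsetSum]
    simpa using key
  rw [rootPoly, eval_prod, Finset.prod_eq_zero_iff] at h2
  obtain ⟨k, -, hk⟩ := h2
  rw [eval_sub, eval_X, eval_C, sub_eq_zero] at hk
  have h3 := norm_root_le z k
  rw [hz, ← hk] at h3
  refine h3.trans (add_le_add_left ?_ 1)
  rw [pi_norm_le_iff_of_nonneg (by positivity)]
  intro i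
  rw [hc, norm_mul]
  refine mul_le_mul ?_ (norm_le_pi_norm w i) (norm_nonneg _) (by positivity)
  have : ((n : ℂ) + 1 - (i : ℕ)) = ((n + 1 - (i : ℕ) : ℕ) : ℂ) := by
    rw [Nat.cast_sub (by omega)]; push_cast; ring
  rw [this, Complex.norm_natCast]
  have : n + 1 - (i : ℕ) ≤ n + 1 := Nat.sub_le _ _
  exact_mod_cast this

theorem eventually_squarefree_hvec {z : Fin n → ℂ} (hz : Function.Injective z) :
    ∀ᶠ q in 𝓝 ((vieta z, 0) : (Fin n → ℂ) × ℂ), Squarefree (binForm (n + 1) (hvec q)) := by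
  set K : ℝ := (n + 1) * (‖vieta z‖ + 1) + 1 with hK
  have h1 : ∀ᶠ q in 𝓝 ((vieta z, 0) : (Fin n → ℂ) × ℂ), ‖q.1‖ < ‖vieta z‖ + 1 :=
    (continuous_fst.norm.tendsto ((vieta z, 0) : (Fin n → ℂ) × ℂ)).eventually_lt_const
      (lt_add_one _)
  have h2 : ∀ᶠ q in 𝓝 ((vieta z, 0) : (Fin n → ℂ) × ℂ), ∀ x ∈ Metric.closedBall (0 : ℂ) K,
      (polyOf (hvec q)).eval x ≠ 0 ∨ (derivative (polyOf (hvec q))).eval x ≠ 0 := by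
    refine (isCompact_closedBall (0 : ℂ) K).eventually_forall_of_forall_eventually fun x _ => ?_
    have hv : ∀ i, Continuous fun y : ((Fin n → ℂ) × ℂ) × ℂ => hvec y.1 i := fun i =>
      (continuous_apply i).comp (continuous_hvec.comp continuous_fst)
    have c1 : Continuous fun y : ((Fin n → ℂ) × ℂ) × ℂ => (polyOf (hvec y.1)).eval y.2 := by
      simp only [polyOf, eval_finsetSum, eval_mul, eval_C, eval_pow, eval_X]
      exact continuous_finsetSum _ fun i _ => (hv i).mul (continuous_snd.pow _)
    have c2 : Continuous fun y : ((Fin n → ℂ) × ℂ) × ℂ =>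
        (derivative (polyOf (hvec y.1))).eval y.2 := by
      simp only [polyOf, derivative_sum, derivative_C_mul_X_pow, eval_finsetSum, eval_mul, eval_C,
        eval_pow, eval_X]
      exact continuous_finsetSum _ fun i _ =>
        ((hv i).mul continuous_const).mul (continuous_snd.pow _)
    have hx := (injective_iff_eval_ne_zero.1 hz) x
    rw [← polyOf_hvec_zero] at hx
    rcases hx with hx | hx
    · filter_upwards [c1.continuousAt.eventually_ne hx] with y hy using Or.inl hy
    · filter_upwards [c2.continuousAt.eventually_ne hx] with y hy using Or.inr hy
  filter_upwards [h1, h2] with q hq1 hq2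
  refine squarefree_hvec fun x => ?_
  by_contra hx
  push Not at hx
  have := norm_le_of_double_root (w := q.1) (s := q.2) hx.1 hx.2
  have hxK : x ∈ Metric.closedBall (0 : ℂ) K := by
    rw [mem_closedBall_zero_iff, hK]
    have : ((n : ℝ) + 1) * ‖q.1‖ ≤ (n + 1) * (‖vieta z‖ + 1) := by gcongr
    linarith
  rcases hq2 x hxK with h | h
  · exact h hx.1
  · exact h hx.2

end Infinity
end SphBraid

namespace SphBraid
open Topology Filter Set unitInterval

section Transport
variable {Y G C : Type*} [TopologicalSpace Y]

local notation "Cls" => Path.Homotopic.Quotient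

theorem transport_congr (M : ∀ x y : Y, Cls x y → G) {x y x' y' : Y} (γ : Path x y)
    (γ' : Path x' y') (h : ∀ t, γ t = γ' t) : M x y (.mk γ) = M x' y' (.mk γ') := by
  obtain rfl : x = x' := by simpa using h 0
  obtain rfl : y = y' := by simpa using h 1
  rw [Path.ext (funext h)]

variable [Group G] [TopologicalSpace C]

/-- A multiplicative assignment of group elements to homotopy classes of paths. -/
structure Transport (Y G : Type*) [TopologicalSpace Y] [Group G] where
  /-- The group element attached to a class. -/
  val : ∀ x y : Y, Path.Homotopic.Quotient x y → G
  map_trans : ∀ x y z γ δ, val x z (γ.trans δ) = val y z δ * val x y γ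

namespace Transport

theorem map_refl (M : Transport Y G) (x : Y) : M.val x x (.refl x) = 1 := by
  have := M.map_trans x x x (.refl x) (.refl x)
  rw [Path.Homotopic.Quotient.refl_trans] at this
  exact left_eq_mul.1 this

theorem map_symm (M : Transport Y G) {x y : Y} (γ : Cls x y) :
    M.val y x γ.symm = (M.val x y γ)⁻¹ := by
  have := M.map_trans _ _ _ γ γ.symm
  rw [Path.Homotopic.Quotient.trans_symm, map_refl] at this
  exact eq_inv_of_mul_eq_one_left this.symm

/-- The homomorphism from the fundamental group defined by a transport. -/
def toHom (M : Transport Y G) (b : Y) : FundamentalGroup Y b →* G where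
  toFun γ := M.val b b γ
  map_one' := M.map_refl b
  map_mul' p q := by
    rw [FundamentalGroup.mul_def]
    exact M.map_trans _ _ _ _ _

theorem toHom_apply (M : Transport Y G) (b : Y) (γ : FundamentalGroup Y b) :
    M.toHom b γ = M.val b b γ := rfl

variable [SimplyConnectedSpace C]

/-- The transport along the image of a path from `e` to `e'`. -/
def along (M : Transport Y G) (φ : C(C, Y)) (e e' : C) : G :=
  M.val _ _ (.mk ((PathConnectedSpace.somePath e e').map φ.continuous))

theorem along_eq (M : Transport Y G) (φ : C(C, Y)) {e e' : C} (γ : Path e e') :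
    M.along φ e e' = M.val _ _ (.mk (γ.map φ.continuous)) := by
  have h := SimplyConnectedSpace.paths_homotopic (PathConnectedSpace.somePath e e') γ
  rw [along]
  congr 1
  exact Path.Homotopic.Quotient.eq.2 (h.map φ)

theorem along_eq_of_lift (M : Transport Y G) (φ : C(C, Y)) {e e' : C} {g : I → C}
    (hg : Continuous g) (h0 : g 0 = e) (h1 : g 1 = e') {x y : Y} (γ : Path x y)
    (h : ∀ t, φ (g t) = γ t) : M.along φ e e' = M.val x y (.mk γ) := by
  rw [M.along_eq φ (⟨⟨g, hg⟩, h0, h1⟩ : Path e e')]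
  exact transport_congr M.val _ _ h

theorem along_trans (M : Transport Y G) (φ : C(C, Y)) (e e' e'' : C) :
    M.along φ e e'' = M.along φ e' e'' * M.along φ e e' := by
  have γ := PathConnectedSpace.somePath e e'
  have δ := PathConnectedSpace.somePath e' e''
  rw [M.along_eq φ (γ.trans δ), M.along_eq φ γ, M.along_eq φ δ, Path.map_trans,
    Path.Homotopic.Quotient.mk_trans, M.map_trans]

theorem along_self (M : Transport Y G) (φ : C(C, Y)) (e : C) : M.along φ e e = 1 :=
  left_eq_mul.1 (M.along_trans φ e e e)

theorem along_shift (M : Transport Y G) (φ : C(C, Y)) (T : C(C, C)) (hT : ∀ e, φ (T e) = φ e)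
    (e e' : C) : M.along φ (T e) (T e') = M.along φ e e' := by
  have γ := PathConnectedSpace.somePath e e'
  rw [M.along_eq φ γ, M.along_eq φ (γ.map T.continuous)]
  exact transport_congr M.val _ _ fun t => hT _

theorem along_shift_self (M : Transport Y G) (φ : C(C, Y)) (T : C(C, C)) (hT : ∀ e, φ (T e) = φ e)
    {e₀ : C} (h : M.along φ e₀ (T e₀) = 1) (e : C) : M.along φ e (T e) = 1 := by
  rw [M.along_trans φ e e₀, M.along_trans φ e₀ (T e₀), h, along_shift M φ T hT, mul_one,
    ← M.along_trans, along_self]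

theorem along_congr {C' : Type*} [TopologicalSpace C'] [SimplyConnectedSpace C']
    (M : Transport Y G) (φ : C(C, Y)) (φ' : C(C', Y)) {e e' : C} {f f' : C'} {g : I → C} {g' : I → C'}
    (hg : Continuous g) (h0 : g 0 = e) (h1 : g 1 = e')
    (hg' : Continuous g') (h0' : g' 0 = f) (h1' : g' 1 = f')
    (h : ∀ t, φ (g t) = φ' (g' t)) : M.along φ e e' = M.along φ' f f' := by
  rw [M.along_eq φ' (⟨⟨g', hg'⟩, h0', h1'⟩ : Path f f')]
  exact M.along_eq_of_lift φ hg h0 h1 _ h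

end Transport
end Transport

theorem RelSC.image {X Y : Type*} [TopologicalSpace X] [TopologicalSpace Y] {f : Y → X}
    (hf : IsEmbedding f) {V : Set Y} (hV : RelSC V) : RelSC (f '' V) := by
  intro x y γ δ hγ hδ
  have lift : ∀ η : Path x y, (∀ t, η t ∈ f '' V) → ∃ g : I → Y, Continuous g ∧
      (∀ t, g t ∈ V) ∧ ∀ t, f (g t) = η t := by
    intro η hη
    choose g hg hgf using hη
    refine ⟨g, hf.continuous_iff.2 ?_, hg, hgf⟩
    exact η.continuous.congr fun t => (hgf t).symm
  obtain ⟨g, hgc, hgV, hg⟩ := lift γ hγ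
  obtain ⟨d, hdc, hdV, hd⟩ := lift δ hδ
  have h0 : d 0 = g 0 := hf.injective (by rw [hg, hd]; simp)
  have h1 : d 1 = g 1 := hf.injective (by rw [hg, hd]; simp)
  have key := hV _ _ (⟨⟨g, hgc⟩, rfl, rfl⟩ : Path (g 0) (g 1)) ⟨⟨d, hdc⟩, h0, h1⟩ hgV hdV
  have hx : x = f (g 0) := by rw [hg]; simp
  have hy : y = f (g 1) := by rw [hg]; simp
  subst hx hy
  have e1 : γ = (⟨⟨g, hgc⟩, rfl, rfl⟩ : Path (g 0) (g 1)).map hf.continuous :=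
    Path.ext (funext fun t => (hg t).symm)
  have e2 : δ = (⟨⟨d, hdc⟩, h0, h1⟩ : Path (g 0) (g 1)).map hf.continuous :=
    Path.ext (funext fun t => (hd t).symm)
  rw [e1, e2]
  exact Path.Homotopic.Quotient.eq.2 ((Path.Homotopic.Quotient.eq.1 key).map ⟨f, hf.continuous⟩)

/-- The image of a chart under an embedding. -/
def SCSet.image {X Y : Type*} [TopologicalSpace X] [TopologicalSpace Y] {f : Y → X}
    (hf : IsEmbedding f) (V : SCSet Y) : SCSet X where
  carrier := f '' V.carrier
  pc := V.pc.image hf.continuous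
  sc := V.sc.image hf

theorem exists_transport {n : ℕ} {G : Type*} [Group G] {r : Equiv.Perm (Fin n) → G}
    (hr : PosLift r) : ∃ M : Transport (Conf n) G, ∀ t x y (γ : Path x y),
      (∀ s, γ s ∈ (chart n t).carrier) → M.val x y (.mk γ) = (val r t y)⁻¹ * val r t x := by
  obtain ⟨M, h1, h2⟩ := exists_holonomy (V := fun t => (chart n t).carrier) isOpen_chart
    exists_mem_chart dense_univ (val r) (fun s t p hs ht => by
      rw [nhdsWithin_univ]; exact eventually_val hr hs ht)
  exact ⟨⟨M, h1⟩, fun t x y γ hγ => h2 t x y γ hγ trivial trivial⟩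

theorem Transport.val_seg {n : ℕ} {G : Type*} [Group G] {r : Equiv.Perm (Fin n) → G}
    {M : Transport (Conf n) G} (hM : ∀ t x y (γ : Path x y),
      (∀ s, γ s ∈ (chart n t).carrier) → M.val x y (.mk γ) = (SphBraid.val r t y)⁻¹ * SphBraid.val r t x)
    {t : ℝ} {x y : Conf n} (hx : x ∈ (chart n t).carrier) (hy : y ∈ (chart n t).carrier) :
    M.val x y ((chart n t).seg hx hy) = (SphBraid.val r t y)⁻¹ * SphBraid.val r t x := by
  obtain ⟨γ, h1, h2⟩ := (chart n t).seg_exists hx hy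
  rw [← h2, hM t _ _ γ h1]

theorem Transport.toHom_lift {n : ℕ} {G : Type*} [Group G] {r : Equiv.Perm (Fin n) → G}
    (hr : PosLift r) {M : Transport (Conf n) G} (hM : ∀ t x y (γ : Path x y),
      (∀ s, γ s ∈ (chart n t).carrier) → M.val x y (.mk γ) = (SphBraid.val r t y)⁻¹ * SphBraid.val r t x)
    (v : Equiv.Perm (Fin n)) : M.toHom (stdConf n) (lift v) = r v := by
  obtain ⟨z, hz, hv, -⟩ := exists_config zero_lt_one v (strictMono_cast_mul one_pos)
    (strictMono_cast_mul one_pos)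
  rw [← crossLoop_eq_lift zero_lt_one hz hv, toHom_apply, crossLoop, SCSet.loop]
  refine (M.map_trans _ _ _ _ _).trans ?_
  rw [M.val_seg hM, M.val_seg hM, val_stdConf hr, val_stdConf hr, inv_one, one_mul, mul_one,
    val_crossing hr zero_lt_one hz hv]

end SphBraid

namespace SphBraid
open Topology Filter Set unitInterval

/-- A ball of squarefree forms, in the coordinates near infinity. -/
structure Tube (n : ℕ) where
  /-- The center. -/
  center : Fin n → ℂ
  /-- The radius. -/
  radius : ℝ
  pos : 0 < radius
  sq : ∀ q ∈ Metric.ball ((center, 0) : (Fin n → ℂ) × ℂ) radius, Squarefree (binForm (n + 1) (hvec q))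

/-- The configuration with coordinates `(w, exp a)` near infinity. -/
def confAt {n : ℕ} (e : (Fin n → ℂ) × ℂ) : Conf (n + 1) :=
  haveI : Nonempty (Conf (n + 1)) := ⟨stdConf _⟩
  Function.invFun aff (inf (e.1, Complex.exp e.2))

theorem confAt_eq {n : ℕ} {e : (Fin n → ℂ) × ℂ} {u : Conf (n + 1)}
    (h : aff u = inf (e.1, Complex.exp e.2)) : confAt e = u := by
  have : Nonempty (Conf (n + 1)) := ⟨stdConf _⟩
  rw [confAt, ← h]
  exact Function.leftInverse_invFun injective_aff u

theorem confAt_eq_toConf {n : ℕ} {w : Fin n → ℂ} {a : ℂ} {z : Fin (n + 1) → ℂ}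
    (hz : Function.Injective z) (h : vieta z = (Complex.exp a)⁻¹ • Fin.snoc w 1) :
    confAt (w, a) = toConf z := by
  apply confAt_eq
  rw [aff, toConf_val hz, h, inf, hvec_eq_smul w (Complex.exp_ne_zero a),
    toW_smul (Complex.exp_ne_zero a)]

theorem confAt_congr {n : ℕ} {w : Fin n → ℂ} {a a' : ℂ} (h : Complex.exp a = Complex.exp a') :
    confAt (w, a) = confAt (w, a') := by
  simp only [confAt, h]

theorem vec_inf {n : ℕ} {q : (Fin n → ℂ) × ℂ} (h : Squarefree (binForm (n + 1) (hvec q))) :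
    vec (inf q) (Fin.last (n + 1)) ≠ 0 ↔ q.2 ≠ 0 := by
  obtain ⟨a, ha, h'⟩ := exists_vec_toW h
  rw [inf, h', Pi.smul_apply, smul_eq_mul, hvec, Fin.snoc_last]
  simp [ha]

theorem mem_range_aff_iff {d : ℕ} {p : WSph d} : p ∈ range aff ↔ vec p (Fin.last d) ≠ 0 :=
  ⟨by rintro ⟨u, rfl⟩; exact vec_aff_ne_zero u, mem_range_aff⟩

theorem inf_mem_range_aff {n : ℕ} {q : (Fin n → ℂ) × ℂ}
    (h : Squarefree (binForm (n + 1) (hvec q))) : inf q ∈ range aff ↔ q.2 ≠ 0 := by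
  rw [mem_range_aff_iff, vec_inf h]

namespace Tube
variable {n : ℕ} (N : Tube n)

/-- The ball of coordinates. -/
def ball : Set ((Fin n → ℂ) × ℂ) := Metric.ball ((N.center, 0) : (Fin n → ℂ) × ℂ) N.radius

theorem mem_ball {q : (Fin n → ℂ) × ℂ} :
    q ∈ N.ball ↔ dist q.1 N.center < N.radius ∧ ‖q.2‖ < N.radius := by
  rw [ball, Metric.mem_ball, Prod.dist_eq, max_lt_iff, dist_zero_right]

/-- The universal cover of the punctured ball. -/
def cover : Set ((Fin n → ℂ) × ℂ) :=
  {e | e.1 ∈ Metric.ball N.center N.radius ∧ e.2.re < Real.log N.radius}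

theorem mem_cover {e : (Fin n → ℂ) × ℂ} :
    e ∈ N.cover ↔ (e.1, Complex.exp e.2) ∈ N.ball := by
  rw [mem_ball, Complex.norm_exp, cover, Set.mem_ofPred_eq, Real.lt_log_iff_exp_lt N.pos,
    Metric.mem_ball]

theorem convex_cover : Convex ℝ N.cover := by
  have h1 : Convex ℝ {e : (Fin n → ℂ) × ℂ | e.1 ∈ Metric.ball N.center N.radius} :=
    (convex_ball N.center N.radius).linear_preimage (LinearMap.fst ℝ _ _)
  have h2 : Convex ℝ {e : (Fin n → ℂ) × ℂ | e.2.re < Real.log N.radius} :=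
    (convex_Iio (Real.log N.radius)).linear_preimage
      (Complex.reLm ∘ₗ LinearMap.snd ℝ (Fin n → ℂ) ℂ)
  exact h1.inter h2

theorem cover_nonempty_inter (N' : Tube n) {w : Fin n → ℂ} {s s' : ℂ} (h : (w, s) ∈ N.ball)
    (h' : (w, s') ∈ N'.ball) : (N.cover ∩ N'.cover).Nonempty := by
  refine ⟨(w, ((min (Real.log N.radius) (Real.log N'.radius) - 1 : ℝ) : ℂ)),
    ⟨(N.mem_ball.1 h).1, ?_⟩, (N'.mem_ball.1 h').1, ?_⟩
  · simp only [Complex.ofReal_re]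
    linarith [min_le_left (Real.log N.radius) (Real.log N'.radius)]
  · simp only [Complex.ofReal_re]
    linarith [min_le_right (Real.log N.radius) (Real.log N'.radius)]

theorem cover_nonempty : N.cover.Nonempty := by
  have : (N.center, (0 : ℂ)) ∈ N.ball := Metric.mem_ball_self N.pos
  simpa using N.cover_nonempty_inter N this this

instance : SimplyConnectedSpace N.cover :=
  haveI := N.convex_cover.contractibleSpace N.cover_nonempty
  inferInstance

theorem aff_confAt {e : (Fin n → ℂ) × ℂ} (h : e ∈ N.cover) :
    aff (confAt e) = inf (e.1, Complex.exp e.2) := by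
  obtain ⟨u, hu⟩ := (inf_mem_range_aff (N.sq _ (N.mem_cover.1 h))).2 (Complex.exp_ne_zero _)
  rw [confAt_eq hu, hu]

theorem continuousOn_inf : ContinuousOn inf N.ball := SphBraid.continuousOn_inf N.sq

theorem continuousOn_hcoord_vec :
    ContinuousOn (fun p : WSph (n + 1) => hcoord (vec p)) (inf '' N.ball) :=
  SphBraid.continuousOn_hcoord_vec Metric.isOpen_ball N.sq

/-- The parametrization of the punctured ball by its universal cover. -/
def param : C(N.cover, Conf (n + 1)) where
  toFun e := confAt e.1
  continuous_toFun := by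
    rw [isOpenEmbedding_aff.isEmbedding.continuous_iff]
    refine Continuous.congr ?_ fun e => (N.aff_confAt e.2).symm
    refine N.continuousOn_inf.comp_continuous ?_ fun e => N.mem_cover.1 e.2
    fun_prop

/-- The deck transformation. -/
def deck : C(N.cover, N.cover) where
  toFun e := ⟨(e.1.1, e.1.2 + 2 * Real.pi * Complex.I), e.2.1, by
    have := e.2.2
    simpa using this⟩
  continuous_toFun := by fun_prop

theorem param_deck (e : N.cover) : N.param (N.deck e) = N.param e :=
  confAt_congr (Complex.exp_periodic e.1.2)

/-- The chart of `WSph` near infinity. -/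
def chart : SCSet (WSph (n + 1)) where
  carrier := inf '' N.ball
  pc := ((convex_ball _ _).isPathConnected ⟨_, Metric.mem_ball_self N.pos⟩).image' N.continuousOn_inf
  sc := relSC_of_convex (C := N.ball) (convex_ball _ _) N.continuousOn_inf N.continuousOn_hcoord_vec
    (by rintro _ ⟨q, hq, rfl⟩; simp only [hcoord_vec_inf (N.sq q hq)]; exact hq)
    (by rintro _ ⟨q, hq, rfl⟩; simp only [hcoord_vec_inf (N.sq q hq)])

theorem mem_chart {p : WSph (n + 1)} :
    p ∈ N.chart.carrier ↔ hcoord (vec p) ∈ N.ball ∧ inf (hcoord (vec p)) = p := by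
  constructor
  · rintro ⟨q, hq, rfl⟩
    rw [hcoord_vec_inf (N.sq q hq)]
    exact ⟨hq, rfl⟩
  · rintro ⟨h1, h2⟩
    exact ⟨_, h1, h2⟩

theorem isOpen_chart : IsOpen N.chart.carrier := isOpen_image_inf Metric.isOpen_ball N.sq

theorem joinedIn_inf (N' : Tube n) {q q' : (Fin n → ℂ) × ℂ} (h1 : q ∈ N.ball) (h2 : q ∈ N'.ball)
    (h3 : q' ∈ N.ball) (h4 : q' ∈ N'.ball) :
    JoinedIn (N.chart.carrier ∩ N'.chart.carrier) (inf q) (inf q') := by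
  have hc : IsPathConnected (N.ball ∩ N'.ball) :=
    ((convex_ball _ _).inter (convex_ball _ _)).isPathConnected ⟨q, h1, h2⟩
  have := hc.image' (N.continuousOn_inf.mono inter_subset_left)
  refine (this.joinedIn _ ⟨q, ⟨h1, h2⟩, rfl⟩ _ ⟨q', ⟨h3, h4⟩, rfl⟩).mono ?_
  rintro _ ⟨y, hy, rfl⟩
  exact ⟨⟨y, hy.1, rfl⟩, ⟨y, hy.2, rfl⟩⟩

theorem exists_joinedIn (N' : Tube n) {p : WSph (n + 1)} (h : p ∈ N.chart.carrier)
    (h' : p ∈ N'.chart.carrier) :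
    ∃ a ∈ range aff, JoinedIn (N.chart.carrier ∩ N'.chart.carrier) a p := by
  rw [mem_chart] at h h'
  obtain ⟨h1, h2⟩ := h
  obtain ⟨e, he, he'⟩ := N.cover_nonempty_inter N' (w := (hcoord (vec p)).1) h1 h'.1
  refine ⟨inf (e.1, Complex.exp e.2), ⟨confAt e, N.aff_confAt he⟩, ?_⟩
  have := N.joinedIn_inf N' (N.mem_cover.1 he) (N'.mem_cover.1 he') h1 h'.1
  rwa [h2] at this

theorem exists_cover_of_mem {p : WSph (n + 1)} (h : p ∈ N.chart.carrier) (hD : p ∈ range aff) :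
    (hcoord (vec p)).2 ≠ 0 ∧
      ((hcoord (vec p)).1, Complex.log (hcoord (vec p)).2) ∈ N.cover := by
  rw [mem_chart] at h
  rw [← h.2, inf_mem_range_aff (N.sq _ h.1)] at hD
  refine ⟨hD, ?_⟩
  rw [mem_cover]
  simp only [Complex.exp_log hD]
  exact h.1

theorem joinedIn_aff {x y : WSph (n + 1)} (hx : x ∈ N.chart.carrier ∩ range aff)
    (hy : y ∈ N.chart.carrier ∩ range aff) : JoinedIn (N.chart.carrier ∩ range aff) x y := by
  have hc : ContinuousOn (fun e : (Fin n → ℂ) × ℂ => inf (e.1, Complex.exp e.2)) N.cover :=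
    N.continuousOn_inf.comp (by fun_prop) fun e he => N.mem_cover.1 he
  have h1 := (N.convex_cover.isPathConnected N.cover_nonempty).image' hc
  have key : ∀ x ∈ N.chart.carrier ∩ range aff,
      x ∈ (fun e : (Fin n → ℂ) × ℂ => inf (e.1, Complex.exp e.2)) '' N.cover := by
    rintro x ⟨h, hD⟩
    obtain ⟨h2, h3⟩ := N.exists_cover_of_mem h hD
    refine ⟨_, h3, ?_⟩
    simp only [Complex.exp_log h2]
    exact (N.mem_chart.1 h).2
  refine (h1.joinedIn x (key x hx) y (key y hy)).mono ?_
  rintro _ ⟨e, he, rfl⟩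
  exact ⟨⟨_, N.mem_cover.1 he, rfl⟩, ⟨confAt e, N.aff_confAt he⟩⟩

end Tube

theorem exists_tube {n : ℕ} {z : Fin n → ℂ} (hz : Function.Injective z) :
    ∃ N : Tube n, N.center = vieta z := by
  have key := eventually_squarefree_hvec hz
  rw [Metric.eventually_nhds_iff_ball] at key
  obtain ⟨ε, hε, h⟩ := key
  exact ⟨{ center := vieta z, radius := ε, pos := hε, sq := h }, rfl⟩

theorem Tube.exists_injective {n : ℕ} (N : Tube n) :
    ∃ z, Function.Injective z ∧ vieta z = N.center := by
  have h := N.sq (N.center, 0) (Metric.mem_ball_self N.pos)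
  rw [hvec] at h
  exact (squarefree_snoc_snoc_one_zero N.center).1 h

/-- The affine charts and the charts near infinity. -/
def wchart (n : ℕ) : ℝ ⊕ Tube n → SCSet (WSph (n + 1))
  | .inl t => (chart (n + 1) t).image isOpenEmbedding_aff.isEmbedding
  | .inr N => N.chart

theorem isOpen_wchart {n : ℕ} (i : ℝ ⊕ Tube n) : IsOpen (wchart n i).carrier := by
  rcases i with t | N
  · exact isOpenMap_aff _ (isOpen_chart t)
  · exact N.isOpen_chart

theorem wchart_inl_subset {n : ℕ} (t : ℝ) : (wchart n (.inl t)).carrier ⊆ range aff :=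
  image_subset_range _ _

theorem exists_mem_tube {m : ℕ} {p : WSph (m + 2)} (h : p ∉ range aff) :
    ∃ N : Tube (m + 1), p ∈ N.chart.carrier := by
  rw [mem_range_aff_iff, not_not] at h
  have hne : vec p (Fin.last (m + 1)).castSucc ≠ 0 := by
    intro h'
    refine not_squarefree_snoc_snoc_zero (Fin.init (Fin.init (vec p) : Fin (m + 2) → ℂ)) ?_
    convert squarefree_vec p
    funext i
    refine Fin.lastCases ?_ (fun i => Fin.lastCases ?_ (fun i => ?_) i) i
    · simp [h]
    · simp [h']
    · simp [Fin.init]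
  have e1 := hvec_hcoord _ hne
  have e2 : inf (hcoord (vec p)) = p := by
    rw [inf, e1, toW_smul (inv_ne_zero hne), toW_vec]
  have hq : hcoord (vec p) = ((hcoord (vec p)).1, 0) := by
    refine Prod.ext rfl ?_
    simp [hcoord, h]
  have hsq : Squarefree (binForm (m + 2) (hvec (hcoord (vec p)))) := by
    rw [e1, squarefree_binForm_smul (inv_ne_zero hne)]
    exact squarefree_vec p
  rw [hq] at hsq e2
  obtain ⟨z, hz, hzw⟩ := (squarefree_snoc_snoc_one_zero _).1 hsq
  obtain ⟨N, hN⟩ := exists_tube hz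
  refine ⟨N, _, ?_, e2⟩
  rw [← hzw, ← hN]
  exact Metric.mem_ball_self N.pos

theorem exists_mem_wchart {m : ℕ} (p : WSph (m + 2)) : ∃ i, p ∈ (wchart (m + 1) i).carrier := by
  by_cases h : p ∈ range aff
  · obtain ⟨u, rfl⟩ := h
    obtain ⟨t, ht⟩ := exists_mem_chart u
    exact ⟨.inl t, u, ht, rfl⟩
  · obtain ⟨N, hN⟩ := exists_mem_tube h
    exact ⟨.inr N, hN⟩

theorem exists_joinedIn_wchart {n : ℕ} (i j : ℝ ⊕ Tube n) (x : WSph (n + 1))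
    (hi : x ∈ (wchart n i).carrier) (hj : x ∈ (wchart n j).carrier) :
    ∃ a ∈ range aff, JoinedIn ((wchart n i).carrier ∩ (wchart n j).carrier) a x := by
  by_cases h : x ∈ range aff
  · exact ⟨x, h, JoinedIn.refl ⟨hi, hj⟩⟩
  · rcases i with t | N
    · exact absurd (wchart_inl_subset t hi) h
    · rcases j with t | N'
      · exact absurd (wchart_inl_subset t hj) h
      · exact N.exists_joinedIn N' hi hj

theorem joinedIn_wchart {n : ℕ} (i : ℝ ⊕ Tube n) : ∀ x ∈ (wchart n i).carrier ∩ range aff,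
    ∀ y ∈ (wchart n i).carrier ∩ range aff, JoinedIn ((wchart n i).carrier ∩ range aff) x y := by
  rcases i with t | N
  · rw [inter_eq_left.2 (wchart_inl_subset t)]
    exact fun x hx y hy => (wchart n _).pc.joinedIn x hx y hy
  · exact fun x hx y hy => N.joinedIn_aff hx hy

theorem joined_stdConf {n : ℕ} (u : Conf n) : Joined (stdConf n) u := by
  obtain ⟨t, ht⟩ := exists_mem_chart u
  exact ((chart n t).pc.joinedIn _ (stdConf_mem t) _ ht).joined

instance (m : ℕ) : PathConnectedSpace (WSph (m + 2)) := by
  have key : ∀ p : WSph (m + 2), Joined (aff (stdConf _)) p := by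
    intro p
    obtain ⟨i, hi⟩ := exists_mem_wchart p
    obtain ⟨_, ⟨u, rfl⟩, h⟩ := exists_joinedIn_wchart i i p hi hi
    exact ⟨((joined_stdConf u).somePath.map continuous_aff).trans h.joined.somePath⟩
  exact ⟨inferInstance, fun x y => (key x).symm.trans (key y)⟩

theorem dense_range_aff {m : ℕ} : Dense (range (aff : Conf (m + 2) → WSph (m + 2))) := by
  intro p
  by_cases hp : p ∈ range aff
  · exact subset_closure hp
  obtain ⟨N, hN⟩ := exists_mem_tube hp
  rw [N.mem_chart] at hN
  obtain ⟨h1, h2⟩ := hN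
  generalize hcoord (vec p) = q at h1 h2
  obtain ⟨w, s⟩ := q
  have hs : s = 0 := by
    by_contra hs
    exact hp (h2 ▸ (inf_mem_range_aff (N.sq _ h1)).2 hs)
  subst hs
  have hcont : ContinuousAt inf ((w, 0) : (Fin (m + 1) → ℂ) × ℂ) :=
    N.continuousOn_inf.continuousAt (Metric.isOpen_ball.mem_nhds h1)
  have hpair : Continuous fun s : ℂ => (w, s) := by fun_prop
  have h3 : Tendsto (fun s : ℂ => (w, s)) (𝓝[≠] 0) (𝓝 (w, 0)) :=
    (hpair.tendsto 0).mono_left nhdsWithin_le_nhds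
  have h4 := hcont.tendsto.comp h3
  rw [h2] at h4
  refine mem_closure_of_tendsto h4 ?_
  filter_upwards [h3.eventually (Metric.isOpen_ball.mem_nhds h1), self_mem_nhdsWithin] with s hs hs'
  exact (inf_mem_range_aff (N.sq _ hs)).2 hs'

theorem exists_path_aff {m : ℕ} {x y : Conf (m + 2)}
    (γ : Path.Homotopic.Quotient (aff x) (aff y)) :
    ∃ δ : Path x y, Path.Homotopic.Quotient.mk (δ.map continuous_aff) = γ := by
  obtain ⟨η, h1, h2⟩ := SCSet.exists_path_in_dense (wchart (m + 1)) isOpen_wchart exists_mem_wchart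
    joinedIn_wchart exists_joinedIn_wchart ⟨x, rfl⟩ ⟨y, rfl⟩ γ
  choose g hg using h1
  have hc : Continuous g := isOpenEmbedding_aff.isEmbedding.continuous_iff.2
    (η.continuous.congr fun t => (hg t).symm)
  refine ⟨⟨⟨g, hc⟩, injective_aff (by rw [hg]; simp), injective_aff (by rw [hg]; simp)⟩, ?_⟩
  rw [← h2]
  congr 1
  exact Path.ext (funext hg)

end SphBraid

namespace SphBraid
open Topology Filter Set unitInterval Real

theorem vieta_snoc {n : ℕ} (z : Fin n → ℂ) : ∃ (c : ℂ) (a : Fin n → ℂ), ∀ s : ℂ, s ≠ 0 →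
    vieta (Fin.snoc z (c - s⁻¹) : Fin (n + 1) → ℂ) = s⁻¹ • Fin.snoc (vieta z + s • a) 1 := by
  set c : ℂ := (X * rootPoly z).coeff n with hc
  refine ⟨c, fun k => ((X - C c) * rootPoly z).coeff k, fun s hs => ?_⟩
  have h1 : rootPoly (Fin.snoc z (c - s⁻¹) : Fin (n + 1) → ℂ) =
      (X - C c) * rootPoly z + C s⁻¹ * rootPoly z := by
    rw [rootPoly, Fin.prod_univ_castSucc]
    simp only [Fin.snoc_castSucc, Fin.snoc_last, C_sub]
    rw [rootPoly]
    ring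
  funext k
  rw [vieta, h1, coeff_add, coeff_C_mul]
  refine Fin.lastCases ?_ (fun k => ?_) k
  · simp only [Fin.val_last, Pi.smul_apply, Fin.snoc_last, smul_eq_mul, rootPoly_coeff_self,
      sub_mul, coeff_sub, coeff_C_mul, ← hc]
    ring
  · simp only [Fin.val_castSucc, Pi.smul_apply, Fin.snoc_castSucc, smul_eq_mul, Pi.add_apply, vieta]
    field_simp
    ring

theorem snoc_mem_sorted {n : ℕ} {t : ℝ} {z : Fin n → ℂ} {x : ℂ} (hz : z ∈ sorted n t)
    (h : ∀ k, slope t (z k) < slope t x) : (Fin.snoc z x : Fin (n + 1) → ℂ) ∈ sorted (n + 1) t := by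
  intro i j hij
  simp only
  induction i using Fin.lastCases with
  | last => exact absurd hij (Fin.le_last j).not_gt
  | cast i =>
    induction j using Fin.lastCases with
    | last => simpa using h i
    | cast j => simpa using hz (by simpa using hij)

theorem snoc_comp_mem_sorted {n : ℕ} {t : ℝ} {z : Fin n → ℂ} {x : ℂ} (hz : z ∈ sorted n t)
    (h : ∀ k, slope t x < slope t (z k)) :
    (Fin.snoc z x : Fin (n + 1) → ℂ) ∘ ⇑(finRotate (n + 1))⁻¹ ∈ sorted (n + 1) t := by
  have h0 : (finRotate (n + 1))⁻¹ 0 = Fin.last n := by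
    rw [Equiv.Perm.inv_eq_iff_eq, finRotate_last]
  have h1 : ∀ k : Fin n, (finRotate (n + 1))⁻¹ k.succ = k.castSucc := by
    intro k
    rw [Equiv.Perm.inv_eq_iff_eq, finRotate_apply, Fin.coeSucc_eq_succ]
  intro i j hij
  simp only [Function.comp_apply]
  induction j using Fin.cases with
  | zero => exact absurd hij (Fin.zero_le i).not_gt
  | succ j =>
    induction i using Fin.cases with
    | zero => simpa [h0, h1] using h j
    | succ i => simpa [h1] using hz (by simpa using hij)

theorem exists_sorted_pair {n : ℕ} {z : Fin n → ℂ} (hz : Function.Injective z) :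
    ∃ (s t : ℝ) (v : Equiv.Perm (Fin n)), s < t ∧ z ∘ v ∈ sorted n s ∧ z ∘ v ∈ sorted n t := by
  obtain ⟨s, -, hs⟩ := exists_slope_injective hz 0
  set v := Tuple.sort fun k => slope s (z k)
  have h1 : z ∘ v ∈ sorted n s := exists_sort hs
  have h2 : IsOpen {t : ℝ | z ∘ v ∈ sorted n t} := by
    have hc : Continuous fun t : ℝ => fun k => ((slope t (z (v k)) : ℝ) : ℂ) := by
      unfold slope; fun_prop
    exact (isOpen_strictMono (n := n) (f := fun _ => Complex.re)
      fun _ => Complex.continuous_re).preimage hc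
  obtain ⟨t, ht, hst⟩ := Filter.Eventually.exists
    (Filter.inter_mem (nhdsWithin_le_nhds (h2.mem_nhds h1)) self_mem_nhdsWithin : _ ∈ 𝓝[>] s)
  exact ⟨s, t, v, hst, h1, ht⟩

theorem eventually_lt_mul {f : ℝ → ℝ} (hf : Continuous f) {a b : ℝ} (h : ∀ x ∈ Icc a b, 0 < f x)
    (K : ℝ) : ∀ᶠ R in atTop, ∀ x ∈ Icc a b, K < R * f x := by
  rcases (Icc a b).eq_empty_or_nonempty with he | hne
  · simp [he]
  obtain ⟨x₀, hx₀, hmin⟩ := isCompact_Icc.exists_isMinOn hne hf.continuousOn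
  filter_upwards [(tendsto_id.atTop_mul_const (h x₀ hx₀)).eventually_gt_atTop K,
    eventually_ge_atTop 0] with R h1 h2 x hx
  exact h1.trans_le (mul_le_mul_of_nonneg_left (hmin hx) h2)

theorem cos_sub_arctan (t x : ℝ) : cos x + t * sin x = cos (x - arctan t) / cos (arctan t) := by
  have h := (cos_arctan_pos t).ne'
  rw [cos_sub]
  conv_lhs => rw [← tan_arctan t, tan_eq_sin_div_cos]
  field_simp

theorem exists_angle {s t : ℝ} (hst : s < t) : ∃ m : ℝ,
    (∀ x ∈ Icc 0 (π / 2), 0 < cos (m - x) + s * sin (m - x)) ∧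
    (∀ x ∈ Icc (π / 2) π, 0 < -(cos (m - x) + t * sin (m - x))) ∧
    (∀ x ∈ Icc π (3 * π / 2), 0 < -(cos (m - x) + s * sin (m - x))) ∧
    ∀ x ∈ Icc (3 * π / 2) (2 * π), 0 < cos (m - x) + t * sin (m - x) := by
  have h1 := arctan_strictMono hst
  have h2 := neg_pi_div_two_lt_arctan s
  have h3 := arctan_lt_pi_div_two t
  have hs := cos_arctan_pos s
  have ht := cos_arctan_pos t
  refine ⟨(arctan s + arctan t) / 2, fun x hx => ?_, fun x hx => ?_, fun x hx => ?_, fun x hx => ?_⟩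
  · rw [cos_sub_arctan]
    exact div_pos (cos_pos_of_mem_Ioo ⟨by linarith [hx.1, hx.2], by linarith [hx.1, hx.2]⟩) hs
  · rw [cos_sub_arctan, ← neg_div, ← cos_add_pi]
    exact div_pos (cos_pos_of_mem_Ioo ⟨by linarith [hx.1, hx.2], by linarith [hx.1, hx.2]⟩) ht
  · rw [cos_sub_arctan, ← neg_div, ← cos_add_pi]
    exact div_pos (cos_pos_of_mem_Ioo ⟨by linarith [hx.1, hx.2], by linarith [hx.1, hx.2]⟩) hs
  · rw [cos_sub_arctan, ← cos_add_two_pi]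
    exact div_pos (cos_pos_of_mem_Ioo ⟨by linarith [hx.1, hx.2], by linarith [hx.1, hx.2]⟩) ht

/-- The logarithm `-log R + i (u + π - m)`. -/
def angleLog (R m u : ℝ) : ℂ := -(Real.log R : ℂ) + ((u + (π - m) : ℝ) : ℂ) * Complex.I

theorem exp_angleLog {R : ℝ} (hR : 0 < R) (m u : ℝ) :
    (Complex.exp (angleLog R m u))⁻¹ = -(R * Complex.exp ((m - u : ℝ) * Complex.I)) := by
  have h : -angleLog R m u = Real.log R + ((m - u : ℝ) * Complex.I - π * Complex.I) := by
    rw [angleLog]; push_cast; ring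
  rw [← Complex.exp_neg, h, Complex.exp_add, Complex.exp_sub, Complex.exp_pi_mul_I,
    ← Complex.ofReal_exp, Real.exp_log hR]
  ring

theorem norm_exp_angleLog {R : ℝ} (hR : 0 < R) (m u : ℝ) :
    ‖Complex.exp (angleLog R m u)‖ = R⁻¹ := by
  rw [← inv_inv (Complex.exp _), norm_inv, exp_angleLog hR, norm_neg, norm_mul,
    Complex.norm_exp_ofReal_mul_I, mul_one, Complex.norm_real, Real.norm_of_nonneg hR.le]

theorem slope_sub_exp_angleLog {R : ℝ} (hR : 0 < R) (t m u : ℝ) (c : ℂ) :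
    slope t (c - (Complex.exp (angleLog R m u))⁻¹) =
      slope t c + R * (cos (m - u) + t * sin (m - u)) := by
  rw [exp_angleLog hR, Complex.exp_mul_I, ← Complex.ofReal_cos, ← Complex.ofReal_sin]
  simp only [slope, Complex.sub_re, Complex.sub_im, Complex.neg_re, Complex.neg_im,
    Complex.add_re, Complex.add_im, Complex.ofReal_re,
    Complex.ofReal_im, Complex.mul_re, Complex.mul_im, Complex.I_re, Complex.I_im]
  ring

theorem continuous_angleLog (R m : ℝ) : Continuous (angleLog R m) := by
  unfold angleLog; fun_prop

theorem Tube.exists_meridian {n : ℕ} (N : Tube n) :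
    ∃ (s t : ℝ) (g : ℝ → N.cover) (x : ℝ → Fin (n + 1) → ℂ), s < t ∧ Continuous g ∧
      g (2 * π) = N.deck (g 0) ∧ x (2 * π) = x 0 ∧
      (∀ u, Function.Injective (x u) → N.param (g u) = toConf (x u)) ∧
      (∀ u ∈ Icc 0 (π / 2), x u ∈ sorted (n + 1) s) ∧
      (∀ u ∈ Icc (π / 2) π, x u ∘ ⇑(finRotate (n + 1))⁻¹ ∈ sorted (n + 1) t) ∧
      (∀ u ∈ Icc π (3 * π / 2), x u ∘ ⇑(finRotate (n + 1))⁻¹ ∈ sorted (n + 1) s) ∧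
      ∀ u ∈ Icc (3 * π / 2) (2 * π), x u ∈ sorted (n + 1) t := by
  obtain ⟨z', hz', hc⟩ := N.exists_injective
  obtain ⟨s, t, v, hst, hs, ht⟩ := exists_sorted_pair hz'
  set z := z' ∘ v with hzdef
  have hz : vieta z = N.center := by rw [hzdef, vieta_comp_perm, hc]
  obtain ⟨c, b, hb⟩ := vieta_snoc z
  obtain ⟨m, m0, m1, m2, m3⟩ := exists_angle hst
  have hf : ∀ t : ℝ, Continuous fun x => cos (m - x) + t * sin (m - x) := fun t => by fun_prop
  have e0 : ∀ᶠ R : ℝ in atTop, R⁻¹ * ‖b‖ < N.radius := by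
    have := tendsto_inv_atTop_zero (𝕜 := ℝ) |>.mul_const ‖b‖
    rw [zero_mul] at this
    exact this.eventually_lt_const N.pos
  have e1 : ∀ᶠ R : ℝ in atTop, R⁻¹ < N.radius :=
    (tendsto_inv_atTop_zero (𝕜 := ℝ)).eventually_lt_const N.pos
  obtain ⟨R, hR, hRb, hRr, r0, r1, r2, r3⟩ :=
    ((eventually_gt_atTop 0).and (e0.and (e1.and
      ((eventually_all.2 fun k => eventually_lt_mul (hf s) m0 (slope s (z k) - slope s c)).and
      ((eventually_all.2 fun k => eventually_lt_mul (hf t).neg m1 (slope t c - slope t (z k))).and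
      ((eventually_all.2 fun k => eventually_lt_mul (hf s).neg m2 (slope s c - slope s (z k))).and
      (eventually_all.2 fun k => eventually_lt_mul (hf t) m3 (slope t (z k) - slope t c)))))))).exists
  have hmem : ∀ u, (vieta z + Complex.exp (angleLog R m u) • b, angleLog R m u) ∈ N.cover := by
    intro u
    rw [Tube.mem_cover, Tube.mem_ball]
    refine ⟨?_, ?_⟩
    · rw [hz, dist_eq_norm, add_sub_cancel_left, norm_smul, norm_exp_angleLog hR]
      exact hRb
    · rw [norm_exp_angleLog hR]
      exact hRr
  have hper : Complex.exp (angleLog R m (2 * π)) = Complex.exp (angleLog R m 0) :=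
    Complex.exp_eq_exp_iff_exists_int.2 ⟨1, by simp only [angleLog]; push_cast; ring⟩
  refine ⟨s, t, fun u => ⟨_, hmem u⟩, fun u => Fin.snoc z (c - (Complex.exp (angleLog R m u))⁻¹),
    hst, ?_, ?_, ?_, ?_, ?_, ?_, ?_, ?_⟩
  · have := continuous_angleLog R m
    fun_prop
  · apply Subtype.ext
    refine Prod.ext ?_ ?_
    · simp only [Tube.deck, ContinuousMap.coe_mk, hper]
    · simp only [Tube.deck, ContinuousMap.coe_mk, angleLog]; push_cast; ring
  · simp only [hper]
  · intro u hu
    exact confAt_eq_toConf hu (by rw [hb _ (Complex.exp_ne_zero _)])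
  · intro u hu
    refine snoc_mem_sorted hs fun k => ?_
    rw [slope_sub_exp_angleLog hR]
    linarith [r0 k u hu]
  · intro u hu
    refine snoc_comp_mem_sorted ht fun k => ?_
    rw [slope_sub_exp_angleLog hR]
    have := r1 k u hu
    simp only [Pi.neg_apply] at this
    linarith
  · intro u hu
    refine snoc_comp_mem_sorted hs fun k => ?_
    rw [slope_sub_exp_angleLog hR]
    have := r2 k u hu
    simp only [Pi.neg_apply] at this
    linarith
  · intro u hu
    refine snoc_mem_sorted ht fun k => ?_
    rw [slope_sub_exp_angleLog hR]
    linarith [r3 k u hu]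
end SphBraid

namespace SphBraid
open Topology Filter Set unitInterval Real

variable {G : Type*} [Group G] {n : ℕ} (N : Tube n)

/-- The transport is the coboundary of `val` in every chart. -/
def IsChartTransport {n : ℕ} (r : Equiv.Perm (Fin n) → G) (M : Transport (Conf n) G) : Prop :=
  ∀ t x y (γ : Path x y), (∀ s, γ s ∈ (chart n t).carrier) →
    M.val x y (.mk γ) = (val r t y)⁻¹ * val r t x

theorem along_arc {r : Equiv.Perm (Fin (n + 1)) → G} {M : Transport (Conf (n + 1)) G}
    (hM : IsChartTransport r M) {g : ℝ → N.cover} (hg : Continuous g) {a b t : ℝ} (hab : a ≤ b)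
    (h : ∀ u ∈ Icc a b, N.param (g u) ∈ (chart (n + 1) t).carrier) :
    M.along N.param (g a) (g b) =
      (val r t (N.param (g b)))⁻¹ * val r t (N.param (g a)) := by
  have hc : Continuous fun u : I => g (a + u * (b - a)) := by fun_prop
  rw [M.along_eq_of_lift N.param hc (by simp) (by simp)
    (⟨⟨_, N.param.continuous.comp hc⟩, by simp, by simp⟩ :
      Path (N.param (g a)) (N.param (g b))) fun t => rfl]
  refine hM t _ _ _ fun u => h _ ⟨?_, ?_⟩
  · nlinarith [u.2.1]
  · nlinarith [u.2.2]

theorem exists_along_meridian {r : Equiv.Perm (Fin (n + 1)) → G} (hr : PosLift r)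
    {M : Transport (Conf (n + 1)) G} (hM : IsChartTransport r M) :
    ∃ (e : N.cover) (g : G), M.along N.param e (N.deck e) =
      g⁻¹ * (r (finRotate (n + 1))⁻¹ * r (finRotate (n + 1)))⁻¹ * g := by
  obtain ⟨s, t, g, x, hst, hg, hd, hx, hp, h0, h1, h2, h3⟩ := N.exists_meridian
  have hπ := pi_pos
  have mem (u t) (hu : x u ∈ sorted (n + 1) t) : N.param (g u) ∈ (chart (n + 1) t).carrier := by
    rw [hp u (injective_of_mem_sorted hu)]
    exact mem_chart hu
  have hinj (u t) (hu : x u ∘ ⇑(finRotate (n + 1))⁻¹ ∈ sorted (n + 1) t) :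
      Function.Injective (x u) := by
    have := (injective_of_mem_sorted hu).comp (finRotate (n + 1)).injective
    convert this using 1
    ext k
    simp
  have mem' (u t) (hu : x u ∘ ⇑(finRotate (n + 1))⁻¹ ∈ sorted (n + 1) t) :
      N.param (g u) ∈ (chart (n + 1) t).carrier := by
    rw [hp u (hinj u t hu)]
    exact mem_chart_comp hu
  have a0 := along_arc N hM hg (by positivity : 0 ≤ π / 2) fun u hu => mem u s (h0 u hu)
  have a1 := along_arc N hM hg (by linarith : π / 2 ≤ π) fun u hu => mem' u t (h1 u hu)
  have a2 := along_arc N hM hg (by linarith : π ≤ 3 * π / 2) fun u hu => mem' u s (h2 u hu)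
  have a3 := along_arc N hM hg (by linarith : 3 * π / 2 ≤ 2 * π) fun u hu => mem u t (h3 u hu)
  have x0 := h0 0 ⟨le_rfl, by positivity⟩
  have x0' := h3 (2 * π) ⟨by linarith, le_rfl⟩
  rw [hx] at x0'
  have x1 := h0 (π / 2) ⟨by positivity, le_rfl⟩
  have x1' := h1 (π / 2) ⟨le_rfl, by linarith⟩
  have x2 := h1 π ⟨by linarith, le_rfl⟩
  have x2' := h2 π ⟨le_rfl, by linarith⟩
  have x3 := h2 (3 * π / 2) ⟨by linarith, le_rfl⟩
  have x3' := h3 (3 * π / 2) ⟨le_rfl, by linarith⟩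
  have v0 := val_crossing (v := 1) hr hst x0 x0'
  have v1 := val_crossing hr hst x1 x1'
  have v2 := val_crossing (v := 1) hr hst x2' x2
  have v3 := val_crossing (v := finRotate (n + 1)) hr hst x3 (by
    convert x3' using 1
    ext k
    simp)
  rw [hr.one] at v0 v2
  rw [toConf_comp_perm, ← hp _ (hinj _ _ x2)] at v2
  rw [toConf_comp_perm, ← hp _ (hinj _ _ x3)] at v3
  rw [← hp _ (injective_of_mem_sorted x0)] at v0
  rw [← hp _ (injective_of_mem_sorted x1)] at v1
  refine ⟨g 0, val r t (N.param (g 0)), ?_⟩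
  rw [← hd, M.along_trans _ (g 0) (g (π / 2)), M.along_trans _ (g (π / 2)) (g π),
    M.along_trans _ (g π) (g (3 * π / 2)), a0, a1, a2, a3, hd, N.param_deck, ← v1, ← v3,
    mul_inv_eq_one.1 v0, mul_inv_eq_one.1 v2]
  group

theorem finRotate_val (a : Fin (n + 1)) :
    (finRotate (n + 1) a : ℕ) = if (a : ℕ) = n then 0 else (a : ℕ) + 1 := by
  rw [coe_finRotate]
  simp [Fin.ext_iff]

theorem finRotate_inv_val (a : Fin (n + 1)) :
    ((finRotate (n + 1))⁻¹ a : ℕ) = if (a : ℕ) = 0 then n else (a : ℕ) - 1 := by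
  obtain ⟨b, rfl⟩ := (finRotate (n + 1)).surjective a
  rw [show (finRotate (n + 1))⁻¹ (finRotate (n + 1) b) = b by simp, finRotate_val]
  have := b.isLt
  split_ifs <;> simp_all

theorem map_sphWord {m : ℕ} (φ : FreeGroup (Fin (m + 2 - 1)) →* G)
    {E : Equiv.Perm (Fin (m + 2)) → G} (hE : PosLift E)
    (h : ∀ i (hi : i + 1 < m + 2), E (sw i hi) = φ (.of ⟨i, by omega⟩)) :
    φ (sphWord (m + 2)) = E (finRotate (m + 2)) * E (finRotate (m + 2))⁻¹ := by
  have h' : ∀ i (hi : i + 1 < m + 2), E (sw i hi) = φ (fgen (m + 2) (i + 1)) := by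
    intro i hi
    rw [h, fgen, dif_pos ⟨by omega, hi⟩]
    rfl
  have e : ∀ k, (List.range' 1 k).map (fgen (m + 2)) =
      (List.range k).map fun i => fgen (m + 2) (i + 1) := by
    intro k
    rw [List.range'_eq_map_range, List.map_map]
    refine List.map_congr_left fun i _ => ?_
    simp [add_comm]
  rw [hE.cycle_inv h' (finRotate (m + 2)) finRotate_val,
    hE.cycle h' (finRotate (m + 2))⁻¹ finRotate_inv_val, sphWord, List.map_reverse, e]
  simp only [map_mul, map_list_prod, List.map_map, Nat.add_sub_cancel, List.map_reverse]
  have e2 : List.range (m + 2 - 1) = List.range m ++ [m] := List.range_succ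
  rw [e2]
  simp [Function.comp_def, mul_assoc]

end SphBraid

namespace SphBraid
open Topology Filter Set unitInterval

/-- The homomorphism on fundamental groups induced by the affine chart. -/
def affHom (n : ℕ) : FundamentalGroup (Conf n) (stdConf n) →*
    FundamentalGroup (WSph n) (aff (stdConf n)) :=
  FundamentalGroup.map ⟨aff, continuous_aff⟩ (stdConf n)

theorem affHom_mk {n : ℕ} (γ : Path (stdConf n) (stdConf n)) :
    affHom n (Path.Homotopic.Quotient.mk γ : Path.Homotopic.Quotient _ _) =
      (Path.Homotopic.Quotient.mk (γ.map continuous_aff) : Path.Homotopic.Quotient _ _) := rfl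

theorem affHom_surjective (m : ℕ) : Function.Surjective (affHom (m + 2)) := by
  intro γ
  obtain ⟨δ, hδ⟩ := exists_path_aff (x := stdConf (m + 2)) (y := stdConf (m + 2)) γ
  exact ⟨(Path.Homotopic.Quotient.mk δ : Path.Homotopic.Quotient _ _), by rw [affHom_mk, hδ]⟩

theorem toHom_eq_id {n : ℕ} {M : Transport (Conf n) (FundamentalGroup (Conf n) (stdConf n))}
    (hM : IsChartTransport lift M) : M.toHom (stdConf n) = MonoidHom.id _ := by
  refine MonoidHom.eq_of_eqOn_dense (closure_lift_sw n) ?_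
  rintro _ ⟨i, hi, rfl⟩
  exact M.toHom_lift posLift_lift hM (sw i hi)

theorem affHom_meridian {n : ℕ} (N : Tube n) (e : N.cover)
    (β : Path (stdConf (n + 1)) (N.param e)) :
    ∃ ℓ : FundamentalGroup (Conf (n + 1)) (stdConf (n + 1)), affHom (n + 1) ℓ = 1 ∧
      ∀ {G : Type} [Group G] (M : Transport (Conf (n + 1)) G),
        M.toHom _ ℓ = (M.val _ _ (.mk β))⁻¹ * M.along N.param e (N.deck e) * M.val _ _ (.mk β) := by
  have γ := PathConnectedSpace.somePath e (N.deck e)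
  set μ : Path (N.param e) (N.param e) :=
    (γ.map N.param.continuous).cast rfl (N.param_deck e).symm with hμ
  refine ⟨(Path.Homotopic.Quotient.mk (β.trans (μ.trans β.symm)) : Path.Homotopic.Quotient _ _),
    ?_, ?_⟩
  · have h : Path.Homotopic.Quotient.mk (μ.map continuous_aff) = .mk (.refl _) := by
      refine N.chart.sc _ _ _ _ (fun t => ?_) fun t => ?_
      · exact ⟨_, N.mem_cover.1 (γ t).2, (N.aff_confAt (γ t).2).symm⟩
      · exact ⟨_, N.mem_cover.1 e.2, (N.aff_confAt e.2).symm⟩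
    rw [affHom_mk, Path.map_trans, Path.map_trans, ← Path.map_symm,
      Path.Homotopic.Quotient.mk_trans, Path.Homotopic.Quotient.mk_trans, h,
      Path.Homotopic.Quotient.mk_refl, Path.Homotopic.Quotient.refl_trans,
      Path.Homotopic.Quotient.mk_symm, Path.Homotopic.Quotient.trans_symm]
    rfl
  · intro G _ M
    rw [M.toHom_apply, Path.Homotopic.Quotient.mk_trans, M.map_trans,
      Path.Homotopic.Quotient.mk_trans, M.map_trans, Path.Homotopic.Quotient.mk_symm, M.map_symm,
      M.along_eq N.param γ, transport_congr M.val μ (γ.map N.param.continuous) fun t => rfl]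

theorem mul_eq_one_of_conj {G : Type*} [Group G] {x y g c : G}
    (h : c⁻¹ * (g⁻¹ * (x * y)⁻¹ * g) * c = 1) : y * x = 1 := by
  have h1 : (g * c)⁻¹ * (x * y)⁻¹ * ((g * c)⁻¹)⁻¹ = 1 := by simpa [mul_assoc] using h
  rw [conj_eq_one_iff, inv_eq_one] at h1
  exact mul_eq_one_comm.1 h1

theorem affHom_lift_finRotate (m : ℕ) :
    affHom (m + 2) (lift (finRotate (m + 2)) * lift (finRotate (m + 2))⁻¹) = 1 := by
  have hz : Function.Injective (stdTuple (m + 1)) :=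
    injective_of_mem_sorted (stdTuple_mem_sorted 0)
  obtain ⟨N, -⟩ := exists_tube hz
  obtain ⟨M, hM⟩ := exists_transport (posLift_lift (n := m + 2))
  obtain ⟨e, g, h⟩ := exists_along_meridian N posLift_lift hM
  obtain ⟨β⟩ := joined_stdConf (N.param e)
  obtain ⟨ℓ, h1, h2⟩ := affHom_meridian N e β
  have h3 := h2 M
  rw [toHom_eq_id hM, MonoidHom.id_apply, h] at h3
  rw [h3] at h1
  simp only [map_mul, map_inv] at h1 ⊢
  exact mul_eq_one_of_conj h1

end SphBraid

namespace SphBraid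
open Topology Filter Set unitInterval

section Extension
variable {G : Type*} [Group G] {n : ℕ} {M : Transport (Conf (n + 1)) G}

/-- The transport is trivial along the meridians at infinity. -/
def IsMeridianTrivial (M : Transport (Conf (n + 1)) G) : Prop :=
  ∀ (N : Tube n) (e : N.cover), M.along N.param e (N.deck e) = 1

theorem along_deck_iterate (hM : IsMeridianTrivial M) (N : Tube n) (e : N.cover) (k : ℕ) :
    M.along N.param e (N.deck^[k] e) = 1 := by
  induction k with
  | zero => exact M.along_self _ _
  | succ k ih => rw [Function.iterate_succ_apply', M.along_trans _ _ (N.deck^[k] e), ih, hM, one_mul]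

theorem deck_val (N : Tube n) (e : N.cover) :
    (N.deck e).1 = (e.1.1, e.1.2 + 2 * Real.pi * Complex.I) := rfl

theorem deck_iterate_val (N : Tube n) (e : N.cover) (k : ℕ) :
    (N.deck^[k] e).1 = (e.1.1, e.1.2 + k * (2 * Real.pi * Complex.I)) := by
  induction k with
  | zero => simp
  | succ k ih =>
    rw [Function.iterate_succ_apply']
    rw [deck_val, ih]
    refine Prod.ext rfl ?_
    push_cast; ring

theorem along_eq_of_exp_eq (hM : IsMeridianTrivial M) (N : Tube n) {e₀ e e' : N.cover}
    (h1 : e.1.1 = e'.1.1) (h2 : Complex.exp e.1.2 = Complex.exp e'.1.2) :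
    M.along N.param e₀ e = M.along N.param e₀ e' := by
  obtain ⟨k, hk⟩ := Complex.exp_eq_exp_iff_exists_int.1 h2
  have key : ∀ (j : ℕ) (a b : N.cover), a.1.1 = b.1.1 →
      a.1.2 = b.1.2 + j * (2 * Real.pi * Complex.I) →
      M.along N.param e₀ a = M.along N.param e₀ b := by
    intro j a b hab hj
    have : a = N.deck^[j] b := Subtype.ext (by
      rw [deck_iterate_val]
      exact Prod.ext hab hj)
    rw [this, M.along_trans _ _ b, along_deck_iterate hM, one_mul]
  obtain ⟨j, rfl | rfl⟩ := k.eq_nat_or_neg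
  · exact key j e e' h1 (by simpa using hk)
  · refine (key j e' e h1.symm ?_).symm
    rw [hk]; push_cast; ring

/-- A local primitive of the transport at `u`. -/
def IsPrim (M : Transport (Conf (n + 1)) G) (F : Conf (n + 1) → G) (u : Conf (n + 1)) : Prop :=
  ∃ O ∈ 𝓝 u, ∀ x (γ : Path u x), (∀ t, γ t ∈ O) → M.val u x (.mk γ) = (F x)⁻¹ * F u

theorem IsPrim.eventually {F F' : Conf (n + 1) → G} {u : Conf (n + 1)} (h : IsPrim M F u)
    (h' : IsPrim M F' u) : ∀ᶠ x in 𝓝 u, F x * (F' x)⁻¹ = F u * (F' u)⁻¹ := by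
  have _ : LocallyPathConnectedSpace (Conf (n + 1)) := isOpen_conf.locallyPathConnectedSpace
  obtain ⟨O, hO, h1⟩ := h
  obtain ⟨O', hO', h2⟩ := h'
  filter_upwards [pathComponentIn_mem_nhds (Filter.inter_mem hO hO')] with x hx
  obtain ⟨γ, hγ⟩ := hx
  have e1 := h1 x γ fun t => (hγ t).1
  have e2 := h2 x γ fun t => (hγ t).2
  rw [e1] at e2
  have e3 : F x * ((F x)⁻¹ * F u) * (F' u)⁻¹ = F x * ((F' x)⁻¹ * F' u) * (F' u)⁻¹ := by rw [e2]
  simpa [mul_assoc] using e3.symm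

/-- The coordinates near infinity on the universal cover. -/
def logCoord (p : WSph (n + 1)) : (Fin n → ℂ) × ℂ :=
  ((hcoord (vec p)).1, Complex.log (hcoord (vec p)).2)

instance : Nonempty (Conf n) := ⟨stdConf n⟩

/-- The primitives of the transport in the charts. -/
def prim (r : Equiv.Perm (Fin (n + 1)) → G) (M : Transport (Conf (n + 1)) G) :
    ℝ ⊕ Tube n → WSph (n + 1) → G
  | .inl t, p => val r t (Function.invFun aff p)
  | .inr N, p => by
    classical
    exact if h : logCoord p ∈ N.cover then
      (M.along N.param ⟨_, N.cover_nonempty.some_mem⟩ ⟨_, h⟩)⁻¹ else 1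

theorem prim_inl (r : Equiv.Perm (Fin (n + 1)) → G) (t : ℝ) (u : Conf (n + 1)) :
    prim r M (.inl t) (aff u) = val r t u := by
  rw [prim, Function.leftInverse_invFun injective_aff]

theorem prim_inr (r : Equiv.Perm (Fin (n + 1)) → G) (N : Tube n) {p : WSph (n + 1)}
    (h : logCoord p ∈ N.cover) : prim r M (.inr N) p =
      (M.along N.param ⟨_, N.cover_nonempty.some_mem⟩ ⟨_, h⟩)⁻¹ := by
  rw [prim, dif_pos h]

theorem isPrim_inl {r : Equiv.Perm (Fin (n + 1)) → G} (hM : IsChartTransport r M) {t : ℝ}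
    {u : Conf (n + 1)} (hu : u ∈ (chart (n + 1) t).carrier) :
    IsPrim M (fun x => prim r M (.inl t) (aff x)) u := by
  refine ⟨_, (isOpen_chart t).mem_nhds hu, fun x γ hγ => ?_⟩
  simp only [prim_inl]
  exact hM t _ _ γ hγ

theorem isPrim_inr (r : Equiv.Perm (Fin (n + 1)) → G) (hM : IsMeridianTrivial M) {N : Tube n}
    {u : Conf (n + 1)} (hu : aff u ∈ N.chart.carrier) :
    IsPrim M (fun x => prim r M (.inr N) (aff x)) u := by
  obtain ⟨q, hq⟩ : ∃ q : Conf (n + 1) → (Fin n → ℂ) × ℂ, q = fun x => hcoord (vec (aff x)) :=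
    ⟨_, rfl⟩
  set V : Set (Conf (n + 1)) := aff ⁻¹' N.chart.carrier with hV
  have hVo : IsOpen V := N.isOpen_chart.preimage continuous_aff
  have hqc : ContinuousOn q V := by
    rw [hq]
    exact N.continuousOn_hcoord_vec.comp continuous_aff.continuousOn fun x hx => hx
  have hqb : ∀ x ∈ V, q x ∈ N.ball := by
    intro x hx
    rw [hq]
    exact (N.mem_chart.1 hx).1
  have hqi : ∀ x ∈ V, inf (q x) = aff x := by
    intro x hx
    rw [hq]
    exact (N.mem_chart.1 hx).2
  have hq0 : ∀ x ∈ V, (q x).2 ≠ 0 := by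
    intro x hx
    rw [hq]
    exact (N.exists_cover_of_mem hx ⟨x, rfl⟩).1
  have hql : ∀ x, logCoord (aff x) = ((q x).1, Complex.log (q x).2) := by
    intro x
    rw [hq]
    rfl
  have hlog : ∀ x ∈ V, logCoord (aff x) ∈ N.cover := fun x hx =>
    (N.exists_cover_of_mem hx ⟨x, rfl⟩).2
  clear hq
  set s₀ := (q u).2 with hs₀
  have hs : s₀ ≠ 0 := hq0 u hu
  set O : Set (Conf (n + 1)) := {x | x ∈ V ∧ (q x).2 / s₀ ∈ Complex.slitPlane} with hO
  have hOn : O ∈ 𝓝 u := by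
    have h1 : ContinuousAt (fun x => (q x).2 / s₀) u :=
      ((hqc.continuousAt (hVo.mem_nhds hu)).snd).div_const _
    have h2 : (q u).2 / s₀ ∈ Complex.slitPlane := by
      rw [← hs₀, div_self hs]; exact Complex.one_mem_slitPlane
    exact Filter.inter_mem (hVo.mem_nhds hu)
      (h1.preimage_mem_nhds (Complex.isOpen_slitPlane.mem_nhds h2))
  set E : Conf (n + 1) → (Fin n → ℂ) × ℂ :=
    fun x => ((q x).1, Complex.log s₀ + Complex.log ((q x).2 / s₀)) with hE
  have hexp : ∀ x ∈ O, Complex.exp (E x).2 = (q x).2 := by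
    intro x hx
    rw [hE, Complex.exp_add, Complex.exp_log hs, Complex.exp_log (Complex.slitPlane_ne_zero hx.2)]
    field_simp
  have hmem : ∀ x ∈ O, E x ∈ N.cover := by
    intro x hx
    rw [N.mem_cover, hexp x hx]
    exact hqb x hx.1
  have hparam : ∀ x (hx : x ∈ O), N.param ⟨E x, hmem x hx⟩ = x := by
    intro x hx
    refine injective_aff ((N.aff_confAt (hmem x hx)).trans ?_)
    rw [hexp x hx]
    exact hqi x hx.1
  have hprim : ∀ x (hx : x ∈ O), prim r M (.inr N) (aff x) =
      (M.along N.param ⟨_, N.cover_nonempty.some_mem⟩ ⟨E x, hmem x hx⟩)⁻¹ := by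
    intro x hx
    rw [prim_inr r N (hlog x hx.1)]
    refine inv_inj.2 (along_eq_of_exp_eq hM N ?_ ?_)
    · simp only [hql, hE]
    · simp only [hql]
      rw [hexp x hx, Complex.exp_log (hq0 x hx.1)]
  have hEc : ContinuousOn E O := by
    have h1 := hqc.mono (fun x (hx : x ∈ O) => hx.1)
    exact h1.fst.prodMk (continuousOn_const.add
      ((h1.snd.div_const _).clog fun x hx => hx.2))
  have huO : u ∈ O := mem_of_mem_nhds hOn
  refine ⟨O, hOn, fun x γ hγ => ?_⟩
  have hxO : x ∈ O := by simpa using hγ 1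
  have hc : Continuous fun t : I => (⟨E (γ t), hmem _ (hγ t)⟩ : N.cover) :=
    (hEc.comp_continuous γ.continuous hγ).subtype_mk _
  simp only [hprim u huO, hprim x hxO]
  rw [inv_inv, M.along_trans N.param _ ⟨E u, hmem u huO⟩ ⟨E x, hmem x hxO⟩, mul_inv_cancel_right]
  exact (M.along_eq_of_lift N.param hc (by simp) (by simp) γ fun t => hparam _ (hγ t)).symm

theorem eventually_prim_tube (r : Equiv.Perm (Fin (n + 1)) → G) (N N' : Tube n) {p : WSph (n + 1)}
    (h : p ∈ N.chart.carrier) (h' : p ∈ N'.chart.carrier) :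
    ∃ c, ∀ᶠ x in 𝓝[range aff] p, prim r M (.inr N) x * (prim r M (.inr N') x)⁻¹ = c := by
  obtain ⟨e, he, he'⟩ := N.cover_nonempty_inter N' (w := (hcoord (vec p)).1)
    (N.mem_chart.1 h).1 (N'.mem_chart.1 h').1
  refine ⟨(M.along N.param ⟨_, N.cover_nonempty.some_mem⟩ ⟨e, he⟩)⁻¹ *
    M.along N'.param ⟨_, N'.cover_nonempty.some_mem⟩ ⟨e, he'⟩, ?_⟩
  filter_upwards [self_mem_nhdsWithin, mem_nhdsWithin_of_mem_nhds (N.isOpen_chart.mem_nhds h),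
    mem_nhdsWithin_of_mem_nhds (N'.isOpen_chart.mem_nhds h')] with x hx hN hN'
  have h1 : logCoord x ∈ N.cover := (N.exists_cover_of_mem hN hx).2
  have h2 : logCoord x ∈ N'.cover := (N'.exists_cover_of_mem hN' hx).2
  have key : M.along N.param ⟨e, he⟩ ⟨_, h1⟩ = M.along N'.param ⟨e, he'⟩ ⟨_, h2⟩ := by
    obtain ⟨γ, hγ⟩ := ((N.convex_cover.inter N'.convex_cover).isPathConnected
      ⟨e, he, he'⟩).joinedIn e ⟨he, he'⟩ (logCoord x) ⟨h1, h2⟩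
    exact M.along_congr N.param N'.param (g := fun t => ⟨γ t, (hγ t).1⟩)
      (g' := fun t => ⟨γ t, (hγ t).2⟩) (γ.continuous.subtype_mk _) (by simp) (by simp)
      (γ.continuous.subtype_mk _) (by simp) (by simp) fun t => rfl
  rw [prim_inr r N h1, prim_inr r N' h2, M.along_trans N.param _ ⟨e, he⟩,
    M.along_trans N'.param _ ⟨e, he'⟩, key]
  group

theorem isPrim_prim {r : Equiv.Perm (Fin (n + 1)) → G} (hM : IsChartTransport r M)
    (hM' : IsMeridianTrivial M) (i : ℝ ⊕ Tube n) {u : Conf (n + 1)}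
    (hu : aff u ∈ (wchart n i).carrier) : IsPrim M (fun x => prim r M i (aff x)) u := by
  rcases i with t | N
  · obtain ⟨u', hu', he⟩ := hu
    rw [injective_aff he] at hu'
    exact isPrim_inl hM hu'
  · exact isPrim_inr r hM' hu

theorem eventually_prim {r : Equiv.Perm (Fin (n + 1)) → G} (hM : IsChartTransport r M)
    (hM' : IsMeridianTrivial M) (i j : ℝ ⊕ Tube n) (p : WSph (n + 1))
    (hi : p ∈ (wchart n i).carrier) (hj : p ∈ (wchart n j).carrier) :
    ∃ c, ∀ᶠ x in 𝓝[range aff] p, prim r M i x * (prim r M j x)⁻¹ = c := by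
  by_cases hp : p ∈ range aff
  · obtain ⟨u, rfl⟩ := hp
    refine ⟨prim r M i (aff u) * (prim r M j (aff u))⁻¹, ?_⟩
    rw [← isOpenEmbedding_aff.isEmbedding.map_nhds_eq, Filter.eventually_map]
    exact (isPrim_prim hM hM' i hi).eventually (isPrim_prim hM hM' j hj)
  · rcases i with t | N
    · exact absurd (wchart_inl_subset t hi) hp
    · rcases j with t | N'
      · exact absurd (wchart_inl_subset t hj) hp
      · exact eventually_prim_tube r N N' hi hj

end Extension

theorem exists_extension {G : Type*} [Group G] {m : ℕ} {M : Transport (Conf (m + 2)) G}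
    {r : Equiv.Perm (Fin (m + 2)) → G} (hM : IsChartTransport r M) (hM' : IsMeridianTrivial M) :
    ∃ M' : Transport (WSph (m + 2)) G, ∀ x y (γ : Path x y),
      M'.val _ _ (.mk (γ.map continuous_aff)) = M.val x y (.mk γ) := by
  obtain ⟨L, h1, h2⟩ := exists_holonomy (V := fun i => (wchart (m + 1) i).carrier) isOpen_wchart
    exists_mem_wchart dense_range_aff (prim r M) (eventually_prim hM hM')
  refine ⟨⟨L, h1⟩, fun x y γ => ?_⟩
  refine path_induction (V := fun t => (chart (m + 2) t).carrier) isOpen_chart exists_mem_chart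
    (P := fun x y γ => L _ _ (γ.map ⟨aff, continuous_aff⟩) = M.val x y γ) ?_ ?_ x y (.mk γ)
  · intro x y z γ δ hγ hδ
    rw [M.map_trans, ← hγ, ← hδ, ← h1]
    congr 1
    induction γ using Path.Homotopic.Quotient.ind with | mk γ
    induction δ using Path.Homotopic.Quotient.ind with | mk δ
    rw [← Path.Homotopic.Quotient.mk_trans, ← Path.Homotopic.Quotient.mk_map,
      Path.map_trans]
    rfl
  · intro t x y γ hγ
    refine (h2 (.inl t) _ _ (γ.map continuous_aff) (fun s => ⟨_, hγ s, rfl⟩) ⟨x, rfl⟩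
      ⟨y, rfl⟩).trans ?_
    rw [prim_inl, prim_inl, hM t _ _ γ hγ]

end SphBraid

namespace SphBraid
open Topology Filter Set unitInterval

theorem isMeridianTrivial_of {G : Type*} [Group G] {n : ℕ} {r : Equiv.Perm (Fin (n + 1)) → G}
    (hr : PosLift r) {M : Transport (Conf (n + 1)) G} (hM : IsChartTransport r M)
    (h : r (finRotate (n + 1)) * r (finRotate (n + 1))⁻¹ = 1) : IsMeridianTrivial M := by
  intro N
  obtain ⟨e, g, he⟩ := exists_along_meridian N hr hM
  refine M.along_shift_self N.param N.deck N.param_deck (e₀ := e) ?_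
  rw [he, mul_eq_one_comm.1 h]
  simp

variable (m : ℕ)

/-- The Artin generators of the spherical braid group. -/
def gen (i : ℕ) : PresentedGroup (braidRels (m + 2) ∪ {sphWord (m + 2)}) :=
  if h : i < m + 1 then PresentedGroup.of ⟨i, h⟩ else 1

variable {m}

theorem gen_eq {i : ℕ} (h : i < m + 1) : gen m i = PresentedGroup.mk _ (.of ⟨i, h⟩) :=
  dif_pos h

theorem gen_comm (i j : ℕ) (hij : i + 2 ≤ j) (hj : j + 1 < m + 2) :
    gen m i * gen m j = gen m j * gen m i := by
  rw [gen_eq (by omega : i < m + 1), gen_eq (by omega : j < m + 1), ← mul_inv_eq_one, mul_inv_rev,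
    ← mul_assoc]
  simp only [← map_mul, ← map_inv]
  exact PresentedGroup.one_of_mem (Or.inl (Or.inl ⟨⟨i, by omega⟩, ⟨j, by omega⟩, hij, rfl⟩))

theorem gen_braid (i : ℕ) (hi : i + 2 < m + 2) :
    gen m i * gen m (i + 1) * gen m i = gen m (i + 1) * gen m i * gen m (i + 1) := by
  rw [gen_eq (by omega : i < m + 1), gen_eq (by omega : i + 1 < m + 1), ← mul_inv_eq_one]
  simp only [← map_mul, ← map_inv]
  exact PresentedGroup.one_of_mem (Or.inl (Or.inr ⟨⟨i, by omega⟩, ⟨i + 1, by omega⟩, rfl, rfl⟩))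

theorem posWord_gen_finRotate :
    posWord (gen m) (finRotate (m + 2)) * posWord (gen m) (finRotate (m + 2))⁻¹ = 1 := by
  rw [← map_sphWord (PresentedGroup.mk _) (posLift_posWord gen_comm gen_braid) fun i hi => by
    rw [posWord_sw gen_comm gen_braid i hi, gen_eq (by omega)]]
  exact PresentedGroup.one_of_mem (Or.inr rfl)

variable (m) in
/-- The affine chart maps the half twists to the fundamental group of `WSph`. -/
def affLift (v : Equiv.Perm (Fin (m + 2))) :
    FundamentalGroup (WSph (m + 2)) (aff (stdConf (m + 2))) :=
  affHom (m + 2) (lift v)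

theorem posLift_affLift : PosLift (affLift m) where
  one := by rw [affLift, posLift_lift.one, map_one]
  mul w i hi h := by rw [affLift, posLift_lift.mul w i hi h, map_mul]; rfl

theorem affLift_rels : ∀ w ∈ braidRels (m + 2) ∪ {sphWord (m + 2)},
    FreeGroup.lift (fun i : Fin (m + 2 - 1) => affLift m (sw i (by omega))) w = 1 := by
  rintro w ((⟨i, j, hij, rfl⟩ | ⟨i, j, hij, rfl⟩) | rfl)
  · simp only [map_mul, map_inv, FreeGroup.lift_apply_of]
    rw [posLift_affLift.comm _ _ hij]
    group
  · obtain ⟨j, hj⟩ := j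
    obtain rfl : j = i + 1 := hij
    simp only [map_mul, map_inv, FreeGroup.lift_apply_of]
    rw [posLift_affLift.braid _ _, mul_inv_cancel]
  · rw [map_sphWord _ posLift_affLift fun i hi => by rw [FreeGroup.lift_apply_of], affLift, affLift,
      ← map_mul, affHom_lift_finRotate]

variable (m) in
/-- The homomorphism from the spherical braid group to the fundamental group of `WSph`. -/
def braidHom : PresentedGroup (braidRels (m + 2) ∪ {sphWord (m + 2)}) →*
    FundamentalGroup (WSph (m + 2)) (aff (stdConf (m + 2))) :=
  PresentedGroup.toGroup affLift_rels

theorem braidHom_of (i : Fin (m + 2 - 1)) :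
    braidHom m (PresentedGroup.of i) = affLift m (sw i (by omega)) :=
  PresentedGroup.toGroup.of affLift_rels

theorem braidHom_surjective : Function.Surjective (braidHom m) := by
  rw [← MonoidHom.range_eq_top, eq_top_iff, ← MonoidHom.range_eq_top.2 (affHom_surjective m),
    MonoidHom.range_eq_map (affHom (m + 2)), ← closure_lift_sw, MonoidHom.map_closure,
    Subgroup.closure_le]
  rintro _ ⟨_, ⟨i, hi, rfl⟩, rfl⟩
  exact ⟨.of ⟨i, by omega⟩, braidHom_of _⟩

theorem braidHom_injective : Function.Injective (braidHom m) := by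
  have hr : PosLift (posWord (gen m) : Equiv.Perm (Fin (m + 2)) → _) :=
    posLift_posWord gen_comm gen_braid
  obtain ⟨M, hM⟩ := exists_transport hr
  obtain ⟨M', hM'⟩ := exists_extension hM (isMeridianTrivial_of hr hM posWord_gen_finRotate)
  have h : ∀ γ, M'.toHom _ (affHom (m + 2) γ) = M.toHom _ γ := by
    intro γ
    obtain ⟨δ, rfl⟩ : ∃ δ : Path _ _, (Path.Homotopic.Quotient.mk δ :
        Path.Homotopic.Quotient _ _) = γ :=
      Path.Homotopic.Quotient.mk_surjective γ
    exact hM' _ _ δ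
  have key : (M'.toHom _).comp (braidHom m) = MonoidHom.id _ := by
    refine PresentedGroup.ext fun i => ?_
    rw [MonoidHom.comp_apply, braidHom_of, affLift, h, M.toHom_lift hr hM,
      posWord_sw gen_comm gen_braid, gen_eq (by omega)]
    rfl
  exact Function.LeftInverse.injective fun g => DFunLike.congr_fun key g

end SphBraid

/-- For every `d ≥ 2` and every basepoint `w₀ ∈ W_d`, the fundamental group
`π₁(W_d, w₀)` is isomorphic to the spherical braid group `Br^s_d`. -/
theorem fundamentalGroup_WSph_iso_sphBraidGroup (d : ℕ) (hd : 2 ≤ d) (w₀ : WSph d) :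
    Nonempty (FundamentalGroup (WSph d) w₀ ≃* SphBraidGroup d) := by
  obtain ⟨m, rfl⟩ := Nat.exists_eq_add_of_le' hd
  exact ⟨(FundamentalGroup.fundamentalGroupMulEquivOfPathConnected w₀
    (SphBraid.aff (SphBraid.stdConf (m + 2)))).trans (MulEquiv.ofBijective (SphBraid.braidHom m)
      ⟨SphBraid.braidHom_injective, SphBraid.braidHom_surjective⟩).symm⟩

end
end

section
/- Let n ≥ 1, k ≥ 2 and u, v ∈ ℂ, and set p_{u,v}(x) := (x^k + v)^n − u^{n+1}. Then there exists x ∈ ℂ with p_{u,v}(x) = 0 and x^{k−1}(x^k + v)^{n−1} = 0 (i.e., p_{u,v} has a repeated root) if and only if u^{(n−1)(n+1)}·(u^{n+1} − v^n) = 0. -/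
open Polynomial

noncomputable section

/-- The polynomial `p_{u,v}(x) = (x^k + v)^n - u^{n+1}` has a repeated root (a common
zero with `x^{k-1}(x^k + v)^{n-1}`) if and only if
`u^{(n-1)(n+1)} (u^{n+1} - v^n) = 0`. -/
theorem degeneracy_locus_two_parameter_family
    (n k : ℕ) (hn : 1 ≤ n) (hk : 2 ≤ k) (u v : ℂ) :
    (∃ x : ℂ, (x ^ k + v) ^ n - u ^ (n + 1) = 0 ∧
        x ^ (k - 1) * (x ^ k + v) ^ (n - 1) = 0) ↔
      u ^ ((n - 1) * (n + 1)) * (u ^ (n + 1) - v ^ n) = 0 := by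
  constructor
  · rintro ⟨x, hp, hd⟩
    rcases mul_eq_zero.mp hd with hx | hx
    · have hx0 : x = 0 := eq_zero_of_pow_eq_zero hx
      subst hx0
      rw [zero_pow (by omega), zero_add] at hp
      rw [← neg_sub, hp, neg_zero, mul_zero]
    · have hn1 : n - 1 ≠ 0 := by
        intro h
        simp [h] at hx
      rw [eq_zero_of_pow_eq_zero hx, zero_pow (by omega), zero_sub, neg_eq_zero] at hp
      rw [eq_zero_of_pow_eq_zero hp, zero_pow (mul_ne_zero hn1 n.succ_ne_zero), zero_mul]
  · intro h
    rcases mul_eq_zero.mp h with h | h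
    · have hn1 : n - 1 ≠ 0 := by
        intro h0
        simp [h0] at h
      obtain ⟨x, hx⟩ := IsAlgClosed.exists_pow_nat_eq (-v) (n := k) (by omega)
      refine ⟨x, ?_, ?_⟩
      · rw [hx, eq_zero_of_pow_eq_zero h, neg_add_cancel, zero_pow (by omega),
          zero_pow n.succ_ne_zero, sub_zero]
      · rw [hx, neg_add_cancel, zero_pow hn1, mul_zero]
    · refine ⟨0, ?_, ?_⟩
      · rw [zero_pow (by omega), zero_add, ← neg_sub, h, neg_zero]
      · rw [zero_pow (by omega), zero_mul]

end
end

section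
/- Let d ≥ 3 and u ∈ ℂ, and set p_u(x,z) := (u·x^{d−1} + z^{d−1})^d − x^{d(d−1)}. Then there exists (x,z) ∈ ℂ² with (x,z) ≠ (0,0), p_u(x,z) = 0, and z^{d−2}·(u·x^{d−1} + z^{d−1})^{d−1} = 0 if and only if u^d = 1. -/
open Polynomial

noncomputable section

/-- The binary form `p_u(x,z) = (u x^{d-1} + z^{d-1})^d - x^{d(d-1)}` has a repeated root
on `ℙ¹` (a nontrivial common zero with `z^{d-2}(u x^{d-1} + z^{d-1})^{d-1}`) if and only
if `u^d = 1`. -/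
theorem degeneracy_locus_plane_curve_family (d : ℕ) (hd : 3 ≤ d) (u : ℂ) :
    (∃ x z : ℂ, (x, z) ≠ (0, 0) ∧
        (u * x ^ (d - 1) + z ^ (d - 1)) ^ d - x ^ (d * (d - 1)) = 0 ∧
        z ^ (d - 2) * (u * x ^ (d - 1) + z ^ (d - 1)) ^ (d - 1) = 0) ↔
      u ^ d = 1 := by
  obtain ⟨n, rfl⟩ : ∃ n, d = n + 3 := ⟨d - 3, by omega⟩
  simp only [show n + 3 - 1 = n + 2 by omega,
    show n + 3 - 2 = n + 1 by omega]
  constructor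
  · rintro ⟨x, z, hxz, hp, hdp⟩
    rcases mul_eq_zero.mp hdp with hz | hw
    · obtain rfl : z = 0 := eq_zero_of_pow_eq_zero hz
      have hx : x ≠ 0 := by
        rintro rfl
        exact hxz rfl
      rw [zero_pow (by omega), add_zero, mul_pow, ← pow_mul, mul_comm (n + 2), sub_eq_zero] at hp
      exact (mul_eq_right₀ (pow_ne_zero _ hx)).mp hp
    · have hw := eq_zero_of_pow_eq_zero hw
      rw [hw, zero_pow (by omega), zero_sub, neg_eq_zero] at hp
      obtain rfl : x = 0 := eq_zero_of_pow_eq_zero hp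
      rw [zero_pow (by omega), mul_zero, zero_add] at hw
      obtain rfl : z = 0 := eq_zero_of_pow_eq_zero hw
      exact absurd rfl hxz
  · intro hu
    exact ⟨1, 0, by simp, by simp [hu], by simp⟩

end
end
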